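/- Under the a priori hypotheses, for every ε ∈ (0,T) there exists c_ε > 0 depending only on Ω, ε, T, C_u, C_φ, C_f such that (dd^c u) restricted to the holomorphic tangent bundle of ∂Ω dominates c_ε·(dd^c|z|²) there; that is, for every p ∈ ∂Ω, every t ∈ (ε,T), and every ξ ∈ ℂⁿ with Σ_α (∂ρ/∂z_α)(p) ξ_α = 0 (ρ a defining function of Ω), one has Σ_{α,β} u_{αβ̄}(p,t) ξ_α ξ̄_β ≥ c_ε |ξ|². -/

import Mathlib

open Set Metric Complex Topology Filter Bornology
open scoped ComplexOrder

noncomputable section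

/-- `ℂⁿ` with its Euclidean structure. -/
abbrev Cn (n : ℕ) := EuclideanSpace ℂ (Fin n)

/-- The `α`-th coordinate vector scaled by `c`. -/
def cvec (n : ℕ) (α : Fin n) (c : ℂ) : Cn n := EuclideanSpace.single α c

variable {n : ℕ}

/-- Wirtinger derivative `∂/∂z_α` (within a set), via the real Fréchet derivative. -/
def wderW (s : Set (Cn n)) (α : Fin n) (u : Cn n → ℂ) (z : Cn n) : ℂ :=
  (fderivWithin ℝ u s z (cvec n α 1) - Complex.I * fderivWithin ℝ u s z (cvec n α Complex.I)) / 2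

/-- Conjugate Wirtinger derivative `∂/∂z̄_β` (within a set). -/
def wderBarW (s : Set (Cn n)) (β : Fin n) (u : Cn n → ℂ) (z : Cn n) : ℂ :=
  (fderivWithin ℝ u s z (cvec n β 1) + Complex.I * fderivWithin ℝ u s z (cvec n β Complex.I)) / 2

/-- The complex Hessian matrix `u_{αβ̄} = ∂²u/∂z_α ∂z̄_β` of a real valued function,
computed within a set `s`. -/
def cHessW (s : Set (Cn n)) (u : Cn n → ℝ) (z : Cn n) : Matrix (Fin n) (Fin n) ℂ :=
  Matrix.of fun α β => wderW s α (wderBarW s β fun w => (u w : ℂ)) z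

/-- The complex Hessian matrix `u_{αβ̄}`. -/
def cHess (u : Cn n → ℝ) : Cn n → Matrix (Fin n) (Fin n) ℂ := cHessW univ u

/-- The Euclidean Laplacian (within a set) of `v : ℂⁿ → ℝ`, i.e. the sum of all pure second
derivatives in the `2n` underlying real coordinate directions. -/
def lapW (s : Set (Cn n)) (v : Cn n → ℝ) (z : Cn n) : ℝ :=
  ∑ α : Fin n,
    (fderivWithin ℝ (fun y => fderivWithin ℝ v s y (cvec n α 1)) s z (cvec n α 1) +
      fderivWithin ℝ (fun y => fderivWithin ℝ v s y (cvec n α Complex.I)) s z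
        (cvec n α Complex.I))

/-- The Euclidean Laplacian of `v : ℂⁿ → ℝ`. -/
def lap (v : Cn n → ℝ) : Cn n → ℝ := lapW univ v

/-- A bounded smooth strictly pseudoconvex domain of `ℂⁿ`: a bounded (nonempty) domain with a
smooth strictly plurisubharmonic defining function `ρ` on a bounded neighbourhood of its closure,
with nonvanishing differential on the boundary. -/
def IsSPCDomain (Ω : Set (Cn n)) : Prop :=
  IsOpen Ω ∧ Ω.Nonempty ∧ IsBounded Ω ∧
    ∃ (U : Set (Cn n)) (ρ : Cn n → ℝ), IsOpen U ∧ IsBounded U ∧ closure Ω ⊆ U ∧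
      ContDiffOn ℝ (⊤ : ℕ∞) ρ U ∧ (∀ z ∈ U, (cHess ρ z).PosDef) ∧
      Ω = {z ∈ U | ρ z < 0} ∧ ∀ z ∈ frontier Ω, fderiv ℝ ρ z ≠ 0

/-- Membership in `C^{2;1}(Ω̄ × [0,T))`: `u(·,t) ∈ C²(Ω̄)` for each `t ∈ [0,T)`,
`u(z,·) ∈ C¹([0,T))` for each `z ∈ Ω̄`, and `∂u/∂t` together with all second spatial
derivatives are continuous on `Ω̄ × [0,T)`. -/
def C21 (n : ℕ) (Ω : Set (Cn n)) (T : ℝ) (u : Cn n × ℝ → ℝ) : Prop :=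
  (∀ t ∈ Ico (0 : ℝ) T, ContDiffOn ℝ 2 (fun z => u (z, t)) (closure Ω)) ∧
  (∀ z ∈ closure Ω, ContDiffOn ℝ 1 (fun s => u (z, s)) (Ico (0 : ℝ) T)) ∧
  ContinuousOn (fun p : Cn n × ℝ => derivWithin (fun s => u (p.1, s)) (Ico (0 : ℝ) T) p.2)
    (closure Ω ×ˢ Ico (0 : ℝ) T) ∧
  ∀ v w : Cn n, ContinuousOn
    (fun p : Cn n × ℝ =>
      fderivWithin ℝ (fun y => fderivWithin ℝ (fun x => u (x, p.2)) (closure Ω) y v)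
        (closure Ω) p.1 w)
    (closure Ω ×ˢ Ico (0 : ℝ) T)

/-- The hypotheses of the a priori estimates theorem: `φ ∈ C^∞(Ω̄×[0,T))`,
`f ∈ C^∞([0,T)×Ω̄×ℝ)`, `u ∈ C^∞(Ω×(0,T)) ∩ C^{2;1}(Ω̄×[0,T))` is strictly plurisubharmonic
in `z` and solves `∂u/∂t = log det(u_{αβ̄}) + f(t,z,u)` on `Ω×(0,T)` with `u = φ` on
`∂Ω×[0,T)`, `sup_Ω |u(·,0)| ≤ Cu`, `f` nonincreasing in the last variable,
`‖f‖_{C²((0,T)×Ω×ℝ)} ≤ Cf` and `‖φ‖_{C⁴(Ω×(0,T))} ≤ Cφv` (parabolic norm). -/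
def AprioriHyps (n : ℕ) (Ω : Set (Cn n)) (T Cu Cφv Cf : ℝ)
    (u φ : Cn n × ℝ → ℝ) (f : ℝ × Cn n × ℝ → ℝ) : Prop :=
  ContDiffOn ℝ (⊤ : ℕ∞) φ (closure Ω ×ˢ Ico (0 : ℝ) T) ∧
  ContDiffOn ℝ (⊤ : ℕ∞) f (Ico (0 : ℝ) T ×ˢ closure Ω ×ˢ (univ : Set ℝ)) ∧
  ContDiffOn ℝ (⊤ : ℕ∞) u (Ω ×ˢ Ioo (0 : ℝ) T) ∧
  C21 n Ω T u ∧
  (∀ t ∈ Ioo (0 : ℝ) T, ∀ z ∈ Ω, (cHess (fun w => u (w, t)) z).PosDef) ∧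
  (∀ z ∈ Ω, ∀ t ∈ Ioo (0 : ℝ) T,
    deriv (fun s => u (z, s)) t
      = Real.log ((cHess (fun w => u (w, t)) z).det.re) + f (t, z, u (z, t))) ∧
  (∀ z ∈ frontier Ω, ∀ t ∈ Ico (0 : ℝ) T, u (z, t) = φ (z, t)) ∧
  (∀ z ∈ Ω, |u (z, 0)| ≤ Cu) ∧
  (∀ t ∈ Ioo (0 : ℝ) T, ∀ z ∈ Ω, ∀ r : ℝ, deriv (fun y => f (t, z, y)) r ≤ 0) ∧
  (∀ k : ℕ, k ≤ 2 → ∀ p ∈ Ioo (0 : ℝ) T ×ˢ Ω ×ˢ (univ : Set ℝ),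
    ‖iteratedFDeriv ℝ k f p‖ ≤ Cf) ∧
  (∀ j l : ℕ, j + 2 * l ≤ 4 → ∀ z ∈ Ω, ∀ t ∈ Ioo (0 : ℝ) T,
    ‖iteratedFDeriv ℝ j (fun w => iteratedDeriv l (fun s => φ (w, s)) t) z‖ ≤ Cφv)

section PartPA
theorem eig_ge {M : Matrix (Fin n) (Fin n) ℂ} (hM : M.IsHermitian) {c : ℝ}
    (h : ∀ x : Fin n → ℂ, c * (star x ⬝ᵥ x).re ≤ (star x ⬝ᵥ (M.mulVec x)).re) (i : Fin n) :
    c ≤ hM.eigenvalues i := by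
  rw [hM.eigenvalues_eq i]
  have h1 := h (hM.eigenvectorBasis i)
  have h2 : (star (hM.eigenvectorBasis i : Fin n → ℂ) ⬝ᵥ (hM.eigenvectorBasis i : Fin n → ℂ)) = 1 := by
    have := hM.eigenvectorBasis.orthonormal.1 i
    have h3 := inner_self_eq_norm_sq_to_K (𝕜 := ℂ) (hM.eigenvectorBasis i)
    rw [this, EuclideanSpace.inner_eq_star_dotProduct, dotProduct_comm] at h3
    simpa using h3
  rw [h2] at h1
  simpa using h1

theorem eig_le {M : Matrix (Fin n) (Fin n) ℂ} (hM : M.IsHermitian) {c : ℝ}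
    (h : ∀ x : Fin n → ℂ, (star x ⬝ᵥ (M.mulVec x)).re ≤ c * (star x ⬝ᵥ x).re) (i : Fin n) :
    hM.eigenvalues i ≤ c := by
  rw [hM.eigenvalues_eq i]
  have h1 := h (hM.eigenvectorBasis i)
  have h2 : (star (hM.eigenvectorBasis i : Fin n → ℂ) ⬝ᵥ (hM.eigenvectorBasis i : Fin n → ℂ)) = 1 := by
    have := hM.eigenvectorBasis.orthonormal.1 i
    have h3 := inner_self_eq_norm_sq_to_K (𝕜 := ℂ) (hM.eigenvectorBasis i)
    rw [this, EuclideanSpace.inner_eq_star_dotProduct, dotProduct_comm] at h3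
    simpa using h3
  rw [h2] at h1
  simpa using h1

theorem form_ge_of_eig {M : Matrix (Fin n) (Fin n) ℂ} (hM : M.IsHermitian) {c : ℝ}
    (h : ∀ i, c ≤ hM.eigenvalues i) (x : Fin n → ℂ) :
    c * (star x ⬝ᵥ x).re ≤ (star x ⬝ᵥ (M.mulVec x)).re := by
  have key : (M - (c : ℂ) • (1 : Matrix (Fin n) (Fin n) ℂ)).PosSemidef := by
    have hU : (hM.eigenvectorUnitary : Matrix (Fin n) (Fin n) ℂ) *
      (star (hM.eigenvectorUnitary : Matrix (Fin n) (Fin n) ℂ)) = 1 := by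
      simp
    have h1 : M - (c : ℂ) • (1 : Matrix (Fin n) (Fin n) ℂ) =
        (hM.eigenvectorUnitary : Matrix (Fin n) (Fin n) ℂ) *
        Matrix.diagonal (fun i => ((hM.eigenvalues i - c : ℝ) : ℂ)) *
        (hM.eigenvectorUnitary : Matrix (Fin n) (Fin n) ℂ).conjTranspose := by
      have h2 := hM.spectral_theorem
      rw [Unitary.conjStarAlgAut_apply] at h2
      have h3 : Matrix.diagonal (fun i => ((hM.eigenvalues i - c : ℝ) : ℂ)) =
        Matrix.diagonal (RCLike.ofReal ∘ hM.eigenvalues : Fin n → ℂ) - (c : ℂ) • 1 := by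
        ext i j
        by_cases hij : i = j
        · subst hij; simp
        · simp [hij]
      rw [h3, mul_sub, sub_mul, ← Matrix.star_eq_conjTranspose]
      conv_lhs => rw [h2]
      simp [hU]
    rw [h1]
    apply Matrix.PosSemidef.mul_mul_conjTranspose_same
    apply Matrix.PosSemidef.diagonal
    intro i
    simp only [Pi.zero_apply]
    exact_mod_cast sub_nonneg.2 (h i)
  have := key.re_dotProduct_nonneg x
  simp only [Matrix.sub_mulVec, dotProduct_sub, Matrix.smul_mulVec, Matrix.one_mulVec, dotProduct_smul] at this
  simpa using this

theorem det_ge_one {M : Matrix (Fin n) (Fin n) ℂ} (hM : M.IsHermitian)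
    (h : ∀ i, 1 ≤ hM.eigenvalues i) : 1 ≤ M.det.re := by
  rw [hM.det_eq_prod_eigenvalues]
  have : (∏ i, (hM.eigenvalues i : ℂ)) = ((∏ i, hM.eigenvalues i : ℝ) : ℂ) := by push_cast; rfl
  erw [this]
  rw [Complex.ofReal_re]
  calc (1:ℝ) = ∏ i : Fin n, (1:ℝ) := by simp
    _ ≤ _ := Finset.prod_le_prod (by simp) (fun i _ => h i)

theorem det_mono {A B : Matrix (Fin n) (Fin n) ℂ} (hA : A.PosDef) (hAB : (B - A).PosSemidef) :
    A.det.re ≤ B.det.re := by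
  obtain ⟨C, hC⟩ : ∃ C : Matrix (Fin n) (Fin n) ℂ, A = C.conjTranspose * C := by
    open scoped MatrixOrder in
    have := CStarAlgebra.nonneg_iff_eq_star_mul_self.mp (Matrix.nonneg_iff_posSemidef.2 hA.posSemidef)
    exact this
  have hdet : C.det ≠ 0 := by
    intro h0
    have := hA.det_pos
    rw [hC, Matrix.det_mul, h0] at this
    simp at this
  have hu : IsUnit C.det := isUnit_iff_ne_zero.2 hdet
  set N : Matrix (Fin n) (Fin n) ℂ := (C⁻¹).conjTranspose * (B - A) * C⁻¹ with hN
  have hNp : N.PosSemidef := hAB.conjTranspose_mul_mul_same _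
  have hB : B = C.conjTranspose * (1 + N) * C := by
    have e1 : C.conjTranspose * (C⁻¹).conjTranspose = 1 := by
      rw [← Matrix.conjTranspose_mul, Matrix.nonsing_inv_mul _ hu]; simp
    have e2 : C⁻¹ * C = 1 := Matrix.nonsing_inv_mul _ hu
    rw [mul_add, add_mul, mul_one, ← hC, hN]
    have : C.conjTranspose * ((C⁻¹).conjTranspose * (B - A) * C⁻¹) * C
      = (C.conjTranspose * (C⁻¹).conjTranspose) * (B - A) * (C⁻¹ * C) := by noncomm_ring
    rw [this, e1, e2]; simp
  have hH : (1 + N).IsHermitian := Matrix.isHermitian_one.add hNp.1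
  have h1 : 1 ≤ (1 + N).det.re := by
    apply det_ge_one hH
    apply eig_ge hH
    intro x
    have := hNp.re_dotProduct_nonneg x
    simp only [Matrix.add_mulVec, Matrix.one_mulVec, dotProduct_add, Complex.add_re]
    simp at this ⊢
    linarith
  have hpos : 0 ≤ A.det.re := (Complex.le_def.1 hA.det_pos.le).1
  have him : A.det.im = 0 := (Complex.le_def.1 hA.det_pos.le).2.symm
  have : B.det = A.det * (1 + N).det := by
    rw [hB, hC]; simp only [Matrix.det_mul]; ring
  rw [this, Complex.mul_re, him]
  nlinarith

theorem form_ge_of_det {M : Matrix (Fin n) (Fin n) ℂ} (hM : M.PosDef) {c K : ℝ} (hK : 0 < K)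
    (hdet : c ≤ M.det.re)
    (h : ∀ x : Fin n → ℂ, (star x ⬝ᵥ (M.mulVec x)).re ≤ K * (star x ⬝ᵥ x).re) (x : Fin n → ℂ) :
    c / K ^ (n - 1) * (star x ⬝ᵥ x).re ≤ (star x ⬝ᵥ (M.mulVec x)).re := by
  apply form_ge_of_eig hM.1
  intro i
  rw [div_le_iff₀ (by positivity)]
  refine hdet.trans ?_
  rw [hM.1.det_eq_prod_eigenvalues]
  have : (∏ i, (hM.1.eigenvalues i : ℂ)) = ((∏ i, hM.1.eigenvalues i : ℝ) : ℂ) := by push_cast; rfl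
  erw [this]
  rw [Complex.ofReal_re, ← Finset.mul_prod_erase _ _ (Finset.mem_univ i)]
  apply mul_le_mul_of_nonneg_left _ (hM.eigenvalues_pos i).le
  calc _ ≤ ∏ j ∈ Finset.univ.erase i, K := Finset.prod_le_prod (fun j _ => (hM.eigenvalues_pos j).le)
          (fun j _ => eig_le hM.1 h j)
    _ = _ := by simp

end PartPA

section PartPB
/-- Points of `s` near `p` can be joined to `p` by a two-segment path inside `s`. -/
def QS {E : Type*} [NormedAddCommGroup E] [NormedSpace ℝ E] (s : Set E) (p : E) (R : ℝ) : Prop :=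
  ∀ y ∈ s, ‖y - p‖ < R → ∃ q, segment ℝ p q ⊆ s ∧ segment ℝ q y ⊆ s ∧ ‖q - p‖ ≤ 2 * ‖y - p‖

theorem QS.mono {E : Type*} [NormedAddCommGroup E] [NormedSpace ℝ E] {s : Set E} {p : E} {R R' : ℝ}
    (h : QS s p R) (hR : R' ≤ R) : QS s p R' := fun y hy hyR => h y hy (hyR.trans_le hR)

theorem QS.grow {E F : Type*} [NormedAddCommGroup E] [NormedSpace ℝ E] [NormedAddCommGroup F]
    [NormedSpace ℝ F] {s : Set E} {p : E} {R : ℝ} (hQ : QS s p R)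
    {h : E → F} {h' : E → E →L[ℝ] F} {A : ℝ} {k : ℕ} (hA : 0 ≤ A) (h0 : h p = 0)
    (hd : ∀ y ∈ s, ‖y - p‖ < R → HasFDerivWithinAt h (h' y) s y)
    (hb : ∀ y ∈ s, ‖y - p‖ < R → ‖h' y‖ ≤ A * ‖y - p‖ ^ k) :
    ∀ y ∈ s, ‖y - p‖ < R / 2 → ‖h y‖ ≤ 5 * 2 ^ k * A * ‖y - p‖ ^ (k + 1) := by
  intro y hy hyR
  have hRpos : 0 < R := by linarith [norm_nonneg (y - p)]
  obtain ⟨q, hpq, hqy, hq⟩ := hQ y hy (by linarith)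
  have hconv : Convex ℝ (closedBall p (2 * ‖y - p‖)) := convex_closedBall _ _
  have hpB : p ∈ closedBall p (2 * ‖y - p‖) := by simp
  have hqB : q ∈ closedBall p (2 * ‖y - p‖) := by rw [mem_closedBall, dist_eq_norm]; exact hq
  have hyB : y ∈ closedBall p (2 * ‖y - p‖) := by
    rw [mem_closedBall, dist_eq_norm]; linarith [norm_nonneg (y - p)]
  have main : ∀ a b : E, a ∈ closedBall p (2 * ‖y - p‖) → b ∈ closedBall p (2 * ‖y - p‖) →
      segment ℝ a b ⊆ s → ‖h b - h a‖ ≤ A * (2 * ‖y - p‖) ^ k * ‖b - a‖ := by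
    intro a b ha hb' hab
    have hz : ∀ z ∈ segment ℝ a b, ‖z - p‖ ≤ 2 * ‖y - p‖ := by
      intro z hz
      have := hconv.segment_subset ha hb' hz
      rwa [mem_closedBall, dist_eq_norm] at this
    refine (convex_segment a b).norm_image_sub_le_of_norm_hasFDerivWithin_le (f' := h')
      (fun z hzz => ((hd z (hab hzz) ((hz z hzz).trans_lt (by linarith))).mono hab)) ?_
      (left_mem_segment ℝ a b) (right_mem_segment ℝ a b)
    intro z hzz
    refine (hb z (hab hzz) ((hz z hzz).trans_lt (by linarith))).trans ?_
    have := hz z hzz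
    gcongr
  have e1 := main p q hpB hqB hpq
  have e2 := main q y hqB hyB hqy
  have e3 : ‖y - q‖ ≤ 3 * ‖y - p‖ := by
    calc ‖y - q‖ = ‖(y - p) - (q - p)‖ := by congr 1; abel
      _ ≤ ‖y - p‖ + ‖q - p‖ := norm_sub_le _ _
      _ ≤ _ := by linarith
  have hX : 0 ≤ A * (2 * ‖y - p‖) ^ k := by positivity
  calc ‖h y‖ = ‖(h y - h q) + (h q - h p)‖ := by rw [h0]; congr 1; abel
    _ ≤ ‖h y - h q‖ + ‖h q - h p‖ := norm_add_le _ _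
    _ ≤ A * (2 * ‖y - p‖) ^ k * (3 * ‖y - p‖) + A * (2 * ‖y - p‖) ^ k * (2 * ‖y - p‖) := by
        refine add_le_add (e2.trans ?_) (e1.trans ?_) <;> gcongr
    _ = _ := by rw [mul_pow]; ring

/-- second derivative within a set -/
def D2 {E : Type*} [NormedAddCommGroup E] [NormedSpace ℝ E] (s : Set E) (v : E → ℝ) (z : E) :
    E →L[ℝ] E →L[ℝ] ℝ := fderivWithin ℝ (fderivWithin ℝ v s) s z

theorem D2_symm {E : Type*} [NormedAddCommGroup E] [NormedSpace ℝ E] {s : Set E} {v : E → ℝ} {p : E}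
    (hv : ContDiffOn ℝ 2 v s) (hs : UniqueDiffOn ℝ s) (hp : p ∈ s) (hp' : p ∈ closure (interior s))
    (a b : E) : D2 s v p a b = D2 s v p b a := by
  have := (hv p hp).isSymmSndFDerivWithinAt (by simp) hs hp' hp
  exact this a b

theorem quad_hasFDerivAt {E : Type*} [NormedAddCommGroup E] [NormedSpace ℝ E]
    (B : E →L[ℝ] E →L[ℝ] ℝ) (hB : ∀ a b, B a b = B b a) (p y : E) :
    HasFDerivAt (fun y => (1/2 : ℝ) * B (y - p) (y - p)) (B (y - p)) y := by
  have h1 : HasFDerivAt (fun y : E => y - p) (ContinuousLinearMap.id ℝ E) y :=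
    (hasFDerivAt_id y).sub_const p
  have h2 := (B.hasFDerivAt_of_bilinear h1 h1).const_mul (1/2 : ℝ)
  refine h2.congr_fderiv ?_
  ext v
  simp [hB v y, hB v p]
  ring

theorem taylor2 {E : Type*} [NormedAddCommGroup E] [NormedSpace ℝ E] {s : Set E} {v : E → ℝ} {p : E}
    {R : ℝ} (hR : 0 < R)
    (hv : ContDiffOn ℝ 2 v s) (hs : UniqueDiffOn ℝ s) (hp : p ∈ s) (hp' : p ∈ closure (interior s))
    (hQ : QS s p R) {ε : ℝ} (hε : 0 < ε) :
    ∃ r > 0, ∀ y ∈ s, ‖y - p‖ < r →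
      |v y - v p - fderivWithin ℝ v s p (y - p) - (1/2 : ℝ) * D2 s v p (y - p) (y - p)|
        ≤ ε * ‖y - p‖ ^ 2 := by
  have hd1 : DifferentiableOn ℝ v s := hv.differentiableOn (by norm_num)
  have hd2 : DifferentiableOn ℝ (fderivWithin ℝ v s) s :=
    (hv.fderivWithin (m := 1) hs (by norm_num)).differentiableOn (by norm_num)
  have h1 := (hd2 p hp).hasFDerivWithinAt.isLittleO
  have h2 := h1.def (c := ε / 10) (by positivity)
  rw [eventually_nhdsWithin_iff, Metric.eventually_nhds_iff] at h2
  obtain ⟨r, hr, h2⟩ := h2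
  have key := (hQ.mono (min_le_left R r)).grow (k := 1) (A := ε / 10)
    (h := fun y => v y - v p - fderivWithin ℝ v s p (y - p) - (1/2 : ℝ) * D2 s v p (y - p) (y - p))
    (h' := fun y => fderivWithin ℝ v s y - fderivWithin ℝ v s p - D2 s v p (y - p))
    (by positivity) (by simp) ?_ ?_
  · refine ⟨min R r / 2, by positivity, fun y hy hyr => ?_⟩
    refine (key y hy hyr).trans (le_of_eq ?_)
    ring
  · intro y hy _
    have a1 := (hd1 y hy).hasFDerivWithinAt.sub_const (v p)
    have a2 : HasFDerivWithinAt (fun y => fderivWithin ℝ v s p (y - p)) (fderivWithin ℝ v s p) s y := by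
      have := ((fderivWithin ℝ v s p).hasFDerivAt (x := y - p)).comp y ((hasFDerivAt_id y).sub_const p)
      exact this.hasFDerivWithinAt
    exact (a1.sub a2).sub (quad_hasFDerivAt _ (D2_symm hv hs hp hp') p y).hasFDerivWithinAt
  · intro y hy hyr
    have := h2 (y := y) (by rw [dist_eq_norm]; exact hyr.trans_le (min_le_right _ _)) hy
    simpa [D2] using this

theorem D2_nhds {E : Type*} [NormedAddCommGroup E] [NormedSpace ℝ E] {s : Set E} (v : E → ℝ) {p : E}
    (hs : s ∈ 𝓝 p) : D2 s v p = D2 univ v p := by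
  unfold D2
  rw [fderivWithin_of_mem_nhds hs, fderivWithin_univ]
  apply Filter.EventuallyEq.fderiv_eq
  filter_upwards [eventually_mem_nhds_iff.2 hs] with y hy
  rw [fderivWithin_of_mem_nhds hy, fderivWithin_univ]

theorem QS_ball {E : Type*} [NormedAddCommGroup E] [NormedSpace ℝ E] (p : E) {R : ℝ} (hR : 0 < R) :
    QS (ball p R) p R := by
  intro y hy _
  refine ⟨y, (convex_ball p R).segment_subset (mem_ball_self hR) hy,
    (convex_ball p R).segment_subset hy hy, by linarith [norm_nonneg (y - p)]⟩

theorem taylor2_at {E : Type*} [NormedAddCommGroup E] [NormedSpace ℝ E] {v : E → ℝ} {p : E}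
    (hv : ContDiffAt ℝ 2 v p) {ε : ℝ} (hε : 0 < ε) :
    ∃ r > 0, ∀ y, ‖y - p‖ < r →
      |v y - v p - fderiv ℝ v p (y - p) - (1/2 : ℝ) * D2 univ v p (y - p) (y - p)|
        ≤ ε * ‖y - p‖ ^ 2 := by
  obtain ⟨s, hs, hvs⟩ := hv.contDiffOn (m := 2) le_rfl (by simp)
  obtain ⟨R, hR, hRs⟩ := Metric.mem_nhds_iff.1 hs
  have hb : ball p R ∈ 𝓝 p := ball_mem_nhds p hR
  obtain ⟨r, hr, h⟩ := taylor2 hR (hvs.mono hRs) isOpen_ball.uniqueDiffOn (mem_ball_self hR)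
    (by rw [isOpen_ball.interior_eq]; exact subset_closure (mem_ball_self hR)) (QS_ball p hR) hε
  refine ⟨min r R, by positivity, fun y hy => ?_⟩
  have := h y (by rw [mem_ball, dist_eq_norm]; exact hy.trans_le (min_le_right _ _))
    (hy.trans_le (min_le_left _ _))
  rwa [D2_nhds v hb, fderivWithin_of_mem_nhds hb] at this

/-- Levi form (four times the complex Hessian form). -/
def levi (s : Set (Cn n)) (v : Cn n → ℝ) (z e : Cn n) : ℝ :=
  D2 s v z e e + D2 s v z (I • e) (I • e)

theorem levi_nhds {s : Set (Cn n)} (v : Cn n → ℝ) {p : Cn n} (hs : s ∈ 𝓝 p) (e : Cn n) :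
    levi s v p e = levi univ v p e := by
  unfold levi; rw [D2_nhds v hs]

/-- Second-difference test for the Levi form. -/
theorem levi_le {v : Cn n → ℝ} {z e : Cn n} (hv : ContDiffAt ℝ 2 v z) {a b : ℝ}
    (h : ∀ᶠ τ : ℝ in 𝓝[>] 0, v (z + τ • e) + v (z + τ • (I • e)) + v (z + τ • (-e))
      + v (z + τ • (-(I • e))) - 4 * v z ≤ a * τ ^ 2 + b * τ ^ 4) :
    levi univ v z e ≤ a := by
  by_contra hlt
  push Not at hlt
  set η := levi univ v z e - a with hη
  have hηp : 0 < η := by linarith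
  obtain ⟨r, hr, hT⟩ := taylor2_at hv (ε := η / (8 * (‖e‖ ^ 2 + 1))) (by positivity)
  have hev : ∀ᶠ τ : ℝ in 𝓝[>] 0, τ * (‖e‖ + 1) < r ∧ |b| * τ ^ 2 < η / 4 := by
    have c1 : Tendsto (fun τ : ℝ => τ * (‖e‖ + 1)) (𝓝[>] 0) (𝓝 0) := by
      have : Continuous (fun τ : ℝ => τ * (‖e‖ + 1)) := by fun_prop
      simpa using (this.tendsto 0).mono_left nhdsWithin_le_nhds
    have c2 : Tendsto (fun τ : ℝ => |b| * τ ^ 2) (𝓝[>] 0) (𝓝 0) := by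
      have : Continuous (fun τ : ℝ => |b| * τ ^ 2) := by fun_prop
      simpa using (this.tendsto 0).mono_left nhdsWithin_le_nhds
    exact (c1.eventually_lt_const hr).and (c2.eventually_lt_const (by positivity))
  obtain ⟨τ, h1, ⟨h2, h3⟩, hτ⟩ := (h.and (hev.and self_mem_nhdsWithin)).exists
  have hτ0 : 0 < τ := hτ
  have main : ∀ d : Cn n, ‖d‖ = ‖e‖ → v (z + τ • d) ≥ v z + τ * fderiv ℝ v z d
      + (1/2) * τ ^ 2 * D2 univ v z d d - τ ^ 2 * (η / 8) := by
    intro d hd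
    have hn : ‖τ • d‖ = τ * ‖e‖ := by rw [norm_smul, hd, Real.norm_of_nonneg hτ0.le]
    have := hT (z + τ • d) (by
      rw [add_sub_cancel_left, hn]; nlinarith [norm_nonneg e])
    rw [add_sub_cancel_left, hn] at this
    have h4 := (abs_le.1 this).1
    have h5 : η / (8 * (‖e‖ ^ 2 + 1)) * (τ * ‖e‖) ^ 2 ≤ τ ^ 2 * (η / 8) := by
      rw [div_mul_eq_mul_div, div_le_iff₀ (by positivity)]
      have : 0 ≤ η * τ ^ 2 := by positivity
      nlinarith
    simp only [map_smul, ContinuousLinearMap.smul_apply, smul_eq_mul] at h4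
    linarith
  have m1 := main e rfl
  have m2 := main (I • e) (by rw [norm_smul]; simp)
  have m3 := main (-e) (by simp)
  have m4 := main (-(I • e)) (by rw [norm_neg, norm_smul]; simp)
  simp only [map_neg, ContinuousLinearMap.neg_apply, neg_neg] at m3 m4
  have h6 : τ ^ 2 * levi univ v z e - τ ^ 2 * (η / 2) ≤ a * τ ^ 2 + b * τ ^ 4 := by
    unfold levi; linarith
  have h7 : b * τ ^ 4 ≤ τ ^ 2 * (η / 4) := by
    have : b ≤ |b| := le_abs_self b
    have e4 : b * τ ^ 4 ≤ |b| * τ ^ 4 := by gcongr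
    have e5 : |b| * τ ^ 4 = (|b| * τ ^ 2) * τ ^ 2 := by ring
    have : 0 < τ ^ 2 := by positivity
    nlinarith
  have : 0 < τ ^ 2 := by positivity
  nlinarith

theorem levi_local_max {v w : Cn n → ℝ} {z : Cn n} (hv : ContDiffAt ℝ 2 v z)
    (hw : ContDiffAt ℝ 2 w z) (h : IsLocalMin (fun y => w y - v y) z) (e : Cn n) :
    levi univ v z e ≤ levi univ w z e := by
  have h1 : levi univ (fun y => v y - w y) z e = levi univ v z e - levi univ w z e := by
    have : D2 univ (fun y => v y - w y) z = D2 univ v z - D2 univ w z := by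
      unfold D2
      simp only [fderivWithin_univ]
      have e1 : (fderiv ℝ fun y => v y - w y) =ᶠ[𝓝 z] fun y => fderiv ℝ v y - fderiv ℝ w y := by
        filter_upwards [hv.eventually (by simp), hw.eventually (by simp)] with y h1 h2
        exact fderiv_sub (h1.differentiableAt (by norm_num)) (h2.differentiableAt (by norm_num))
      rw [e1.fderiv_eq]
      exact fderiv_sub ((hv.fderiv_right (m := 1) (by norm_num)).differentiableAt (by norm_num))
        ((hw.fderiv_right (m := 1) (by norm_num)).differentiableAt (by norm_num))
    unfold levi; rw [this]; simp; ring
  have h2 := levi_le (v := fun y => v y - w y) (z := z) (e := e) (hv.sub hw) (a := 0) (b := 0) ?_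
  · linarith
  · have key : ∀ d : Cn n, ∀ᶠ τ : ℝ in 𝓝[>] 0, w z - v z ≤ w (z + τ • d) - v (z + τ • d) := by
      intro d
      have : Tendsto (fun τ : ℝ => z + τ • d) (𝓝[>] 0) (𝓝 z) := by
        have : Continuous (fun τ : ℝ => z + τ • d) := by fun_prop
        simpa using (this.tendsto 0).mono_left nhdsWithin_le_nhds
      exact this.eventually h
    filter_upwards [key e, key (I • e), key (-e), key (-(I • e))] with τ a1 a2 a3 a4
    linarith

/-- Sesquilinear form attached to a real bilinear form. -/
def sesq (D : Cn n →L[ℝ] Cn n →L[ℝ] ℝ) (a b : Cn n) : ℂ :=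
  ((D a b + D (I • a) (I • b) : ℝ) : ℂ) + I * ((D a (I • b) - D (I • a) b : ℝ) : ℂ)

theorem smul_real_form (c : ℂ) (a : Cn n) : c • a = c.re • a + c.im • (I • a) := by
  conv_lhs => rw [← Complex.re_add_im c]
  rw [add_smul, mul_smul, Complex.coe_smul, Complex.coe_smul]

theorem I_smul_I_smul (a : Cn n) : I • (I • a) = -a := by
  rw [smul_smul, Complex.I_mul_I, neg_one_smul]

theorem I_smul_real_smul (c : ℝ) (a : Cn n) : I • (c • a) = c • (I • a) := smul_comm _ _ _

theorem sesq_smul_left (D : Cn n →L[ℝ] Cn n →L[ℝ] ℝ) (c : ℂ) (a b : Cn n) :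
    sesq D (c • a) b = c * sesq D a b := by
  rw [smul_real_form]
  unfold sesq
  simp only [smul_add, I_smul_real_smul, I_smul_I_smul, map_add, map_smul, map_neg,
    ContinuousLinearMap.add_apply, ContinuousLinearMap.smul_apply, ContinuousLinearMap.neg_apply,
    smul_eq_mul]
  apply Complex.ext <;> simp <;> ring

theorem sesq_smul_right (D : Cn n →L[ℝ] Cn n →L[ℝ] ℝ) (c : ℂ) (a b : Cn n) :
    sesq D a (c • b) = star c * sesq D a b := by
  rw [smul_real_form]
  unfold sesq
  simp only [smul_add, I_smul_real_smul, I_smul_I_smul, map_add, map_smul, map_neg,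
    ContinuousLinearMap.add_apply, ContinuousLinearMap.smul_apply, ContinuousLinearMap.neg_apply,
    smul_eq_mul]
  apply Complex.ext <;> simp <;> ring

/-- bundled version -/
def sesqL (D : Cn n →L[ℝ] Cn n →L[ℝ] ℝ) : Cn n →ₗ[ℂ] Cn n →ₗ⋆[ℂ] ℂ :=
  LinearMap.mk₂'ₛₗ (RingHom.id ℂ) (starRingEnd ℂ) (sesq D)
    (by intro a a' b; unfold sesq; simp; ring)
    (by intro c a b; rw [sesq_smul_left]; simp)
    (by intro a b b'; unfold sesq; simp; ring)
    (by intro c a b; rw [sesq_smul_right]; simp)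

theorem cvec_I (α : Fin n) : cvec n α I = I • cvec n α 1 := by
  unfold cvec; ext i; by_cases h : i = α <;> simp [h]

theorem vec_eq_sum (ξ : Fin n → ℂ) : (WithLp.toLp 2 ξ : Cn n) = ∑ α, ξ α • cvec n α 1 := by
  ext i
  simp [cvec, Pi.single_apply]

theorem cHessW_eq {s : Set (Cn n)} {v : Cn n → ℝ} {z : Cn n} (hv : ContDiffOn ℝ 2 v s)
    (hs : UniqueDiffOn ℝ s) (hz : z ∈ s) (α β : Fin n) :
    cHessW s v z α β = (1/4 : ℂ) * sesq (D2 s v z) (cvec n α 1) (cvec n β 1) := by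
  have hd1 : DifferentiableOn ℝ v s := hv.differentiableOn (by norm_num)
  have hd2 : DifferentiableOn ℝ (fderivWithin ℝ v s) s :=
    (hv.fderivWithin (m := 1) hs (by norm_num)).differentiableOn (by norm_num)
  have e1 : ∀ y ∈ s, ∀ a, fderivWithin ℝ (fun w => (v w : ℂ)) s y a = ((fderivWithin ℝ v s y a : ℝ) : ℂ) := by
    intro y hy a
    have := (Complex.ofRealCLM.hasFDerivAt.comp_hasFDerivWithinAt y (hd1 y hy).hasFDerivWithinAt).fderivWithin (hs y hy)
    have h2 : (fun w => (v w : ℂ)) = Complex.ofRealCLM ∘ v := rfl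
    rw [h2, this]; simp
  have e2 : ∀ y ∈ s, wderBarW s β (fun w => (v w : ℂ)) y =
      (((fderivWithin ℝ v s y (cvec n β 1) : ℝ) : ℂ) + I * ((fderivWithin ℝ v s y (cvec n β I) : ℝ) : ℂ)) * (2:ℂ)⁻¹ := by
    intro y hy
    unfold wderBarW; rw [e1 y hy, e1 y hy, div_eq_mul_inv]
  have e3 : ∀ b : Cn n, HasFDerivWithinAt (fun y => ((fderivWithin ℝ v s y b : ℝ) : ℂ))
      (Complex.ofRealCLM.comp ((ContinuousLinearMap.apply ℝ ℝ b).comp (D2 s v z))) s z := by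
    intro b
    have := (ContinuousLinearMap.apply ℝ ℝ b).hasFDerivAt.comp_hasFDerivWithinAt z (hd2 z hz).hasFDerivWithinAt
    exact Complex.ofRealCLM.hasFDerivAt.comp_hasFDerivWithinAt z this
  have e4 := (((e3 (cvec n β 1)).add ((e3 (cvec n β I)).const_mul I)).mul_const ((2:ℂ)⁻¹)).fderivWithin (hs z hz)
  have e5 := (fderivWithin_congr e2 (e2 z hz)).trans e4
  show wderW s α (wderBarW s β fun w => (v w : ℂ)) z = _
  unfold wderW
  rw [e5]
  unfold sesq
  simp [cvec_I]
  apply Complex.ext <;> simp <;> ring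

theorem form_eq_levi {s : Set (Cn n)} {v : Cn n → ℝ} {z : Cn n} (hv : ContDiffOn ℝ 2 v s)
    (hs : UniqueDiffOn ℝ s) (hz : z ∈ s) (ξ : Fin n → ℂ) :
    (∑ α, ∑ β, cHessW s v z α β * ξ α * star (ξ β)).re = (1/4) * levi s v z (WithLp.toLp 2 ξ) := by
  have h1 : ∑ α, ∑ β, cHessW s v z α β * ξ α * star (ξ β)
      = (1/4 : ℂ) * sesq (D2 s v z) (WithLp.toLp 2 ξ) (WithLp.toLp 2 ξ) := by
    have : sesq (D2 s v z) (WithLp.toLp 2 ξ) (WithLp.toLp 2 ξ) =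
      sesqL (D2 s v z) (WithLp.toLp 2 ξ) (WithLp.toLp 2 ξ) := rfl
    rw [this, vec_eq_sum]
    simp only [map_sum, LinearMap.sum_apply]
    rw [Finset.mul_sum, Finset.sum_comm]
    refine Finset.sum_congr rfl fun β _ => ?_
    rw [Finset.mul_sum]
    refine Finset.sum_congr rfl fun α _ => ?_
    rw [cHessW_eq hv hs hz, LinearMap.map_smul, LinearMap.smul_apply, LinearMap.map_smulₛₗ]
    have : sesqL (D2 s v z) (cvec n α 1) (cvec n β 1) = sesq (D2 s v z) (cvec n α 1) (cvec n β 1) := rfl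
    rw [this]
    simp only [smul_eq_mul, starRingEnd_apply]
    ring
  rw [h1]
  unfold sesq levi
  simp

end PartPB

section PartPB2
theorem cHessW_nhds {s : Set (Cn n)} (hs : IsOpen s) (v : Cn n → ℝ) {z : Cn n} (hz : z ∈ s) :
    cHessW s v z = cHess v z := by
  ext α β
  show wderW s α (wderBarW s β fun w => (v w : ℂ)) z = wderW univ α (wderBarW univ β fun w => (v w : ℂ)) z
  have h : wderBarW s β (fun w => (v w : ℂ)) =ᶠ[𝓝 z] wderBarW univ β (fun w => (v w : ℂ)) := by
    filter_upwards [hs.mem_nhds hz] with y hy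
    unfold wderBarW
    rw [fderivWithin_of_mem_nhds (hs.mem_nhds hy), fderivWithin_univ]
  unfold wderW
  rw [fderivWithin_of_mem_nhds (hs.mem_nhds hz), fderivWithin_univ, h.fderiv_eq]

theorem exists_open_contDiffOn {v : Cn n → ℝ} {z : Cn n} (hv : ContDiffAt ℝ 2 v z) :
    ∃ s : Set (Cn n), IsOpen s ∧ z ∈ s ∧ ContDiffOn ℝ 2 v s := by
  obtain ⟨s, hs, hvs⟩ := hv.contDiffOn (m := 2) le_rfl (by simp)
  obtain ⟨R, hR, hRs⟩ := Metric.mem_nhds_iff.1 hs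
  exact ⟨ball z R, isOpen_ball, mem_ball_self hR, hvs.mono hRs⟩

theorem cHess_eq {v : Cn n → ℝ} {z : Cn n} (hv : ContDiffAt ℝ 2 v z) (α β : Fin n) :
    cHess v z α β = (1/4 : ℂ) * sesq (D2 univ v z) (cvec n α 1) (cvec n β 1) := by
  obtain ⟨s, hs, hz, hvs⟩ := exists_open_contDiffOn hv
  rw [← cHessW_nhds hs v hz, cHessW_eq hvs hs.uniqueDiffOn hz, D2_nhds v (hs.mem_nhds hz)]

theorem D2_symm_at {v : Cn n → ℝ} {z : Cn n} (hv : ContDiffAt ℝ 2 v z) (a b : Cn n) :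
    D2 univ v z a b = D2 univ v z b a := by
  obtain ⟨s, hs, hz, hvs⟩ := exists_open_contDiffOn hv
  rw [← D2_nhds v (hs.mem_nhds hz)]
  exact D2_symm hvs hs.uniqueDiffOn hz (by rw [hs.interior_eq]; exact subset_closure hz) a b

theorem cHess_herm {v : Cn n → ℝ} {z : Cn n} (hv : ContDiffAt ℝ 2 v z) :
    (cHess v z).IsHermitian := by
  apply Matrix.IsHermitian.ext
  intro i j
  rw [cHess_eq hv, cHess_eq hv]
  unfold sesq
  rw [D2_symm_at hv (cvec n j 1) (cvec n i 1), D2_symm_at hv (I • cvec n j 1) (I • cvec n i 1),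
    D2_symm_at hv (cvec n j 1) (I • cvec n i 1), D2_symm_at hv (I • cvec n j 1) (cvec n i 1)]
  apply Complex.ext <;> simp

theorem cHess_form {v : Cn n → ℝ} {z : Cn n} (hv : ContDiffAt ℝ 2 v z) (x : Fin n → ℂ) :
    (star x ⬝ᵥ ((cHess v z).mulVec x)).re = (1/4) * levi univ v z (WithLp.toLp 2 (star x)) := by
  obtain ⟨s, hs, hz, hvs⟩ := exists_open_contDiffOn hv
  rw [← levi_nhds v (hs.mem_nhds hz), ← form_eq_levi hvs hs.uniqueDiffOn hz, cHessW_nhds hs v hz]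
  congr 1
  simp only [dotProduct, Matrix.mulVec, Finset.mul_sum]
  refine Finset.sum_congr rfl fun α _ => Finset.sum_congr rfl fun β _ => ?_
  simp
  ring

theorem normsq_toLp (x : Fin n → ℂ) : (star x ⬝ᵥ x).re = ‖(WithLp.toLp 2 x : Cn n)‖ ^ 2 := by
  rw [EuclideanSpace.norm_sq_eq]
  simp only [dotProduct, Complex.re_sum]
  refine Finset.sum_congr rfl fun α _ => ?_
  rw [← Complex.normSq_eq_norm_sq, Complex.normSq_apply]
  simp

theorem normsq_toLp_star (x : Fin n → ℂ) : ‖(WithLp.toLp 2 (star x) : Cn n)‖ = ‖(WithLp.toLp 2 x : Cn n)‖ := by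
  rw [EuclideanSpace.norm_eq, EuclideanSpace.norm_eq]; simp

theorem levi_pos_of_posDef {v : Cn n → ℝ} {z : Cn n} (hv : ContDiffAt ℝ 2 v z)
    (h : (cHess v z).PosDef) {e : Cn n} (he : e ≠ 0) : 0 < levi univ v z e := by
  have h1 := cHess_form hv (star (e : Fin n → ℂ))
  have h2 := h.re_dotProduct_pos (x := star (e : Fin n → ℂ)) (by
    intro h0; apply he; ext i
    have := congrFun h0 i
    simpa using this)
  have h3 : (WithLp.toLp 2 (star (star (e : Fin n → ℂ))) : Cn n) = e := by simp
  rw [h3] at h1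
  have h4 : 0 < (star (star (e : Fin n → ℂ)) ⬝ᵥ (cHess v z).mulVec (star (e : Fin n → ℂ))).re := h2
  linarith

theorem det_le_of_levi {v w : Cn n → ℝ} {z : Cn n} (hv : ContDiffAt ℝ 2 v z)
    (hw : ContDiffAt ℝ 2 w z) (hp : (cHess v z).PosDef)
    (h : ∀ e, levi univ v z e ≤ levi univ w z e) :
    (cHess v z).det.re ≤ (cHess w z).det.re := by
  apply det_mono hp
  have hH : (cHess w z - cHess v z).IsHermitian := (cHess_herm hw).sub (cHess_herm hv)
  refine Matrix.PosSemidef.of_dotProduct_mulVec_nonneg hH fun x => ?_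
  rw [Complex.nonneg_iff]
  constructor
  · rw [Matrix.sub_mulVec, dotProduct_sub, Complex.sub_re, cHess_form hv, cHess_form hw]
    linarith [h (WithLp.toLp 2 (star x))]
  · have := hH.im_star_dotProduct_mulVec_self x
    exact this.symm

theorem levi_ge_of_det {v : Cn n → ℝ} {z : Cn n} (hv : ContDiffAt ℝ 2 v z)
    (hp : (cHess v z).PosDef) {K c : ℝ} (hK : 0 < K) (hdet : c ≤ (cHess v z).det.re)
    (h : ∀ e, levi univ v z e ≤ 4 * K * ‖e‖ ^ 2) (e : Cn n) :
    4 * (c / K ^ (n - 1)) * ‖e‖ ^ 2 ≤ levi univ v z e := by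
  have h1 := form_ge_of_det hp hK hdet (fun x => by
    rw [cHess_form hv, normsq_toLp]
    have := h (WithLp.toLp 2 (star x))
    rw [normsq_toLp_star] at this
    linarith) (star (e : Fin n → ℂ))
  have h3 : (WithLp.toLp 2 (star (star (e : Fin n → ℂ))) : Cn n) = e := by simp
  rw [cHess_form hv, normsq_toLp, normsq_toLp_star, h3] at h1
  have h4 : (WithLp.toLp 2 (e : Fin n → ℂ) : Cn n) = e := by simp
  rw [h4] at h1
  linarith

end PartPB2

section PartPC1
/-- `ρ` is a defining function of the bounded open set `Ω`. -/
structure Defn (Ω U : Set (Cn n)) (ρ : Cn n → ℝ) : Prop where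
  open_Ω : IsOpen Ω
  bdd : IsBounded Ω
  open_U : IsOpen U
  sub : closure Ω ⊆ U
  smooth : ContDiffOn ℝ (⊤ : ℕ∞) ρ U
  eq : Ω = {z ∈ U | ρ z < 0}
  ne : ∀ z ∈ frontier Ω, fderiv ℝ ρ z ≠ 0

/-- complex gradient -/
def cgrad (l : Cn n →L[ℝ] ℝ) : Cn n :=
  WithLp.toLp 2 fun α => (l (cvec n α 1) : ℂ) + I * (l (cvec n α I) : ℂ)

theorem inner_cgrad (l : Cn n →L[ℝ] ℝ) (x : Cn n) :
    inner ℂ (cgrad l) x = (l x : ℂ) - I * (l (I • x) : ℂ) := by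
  have hx : x = ∑ α, (x α) • cvec n α 1 := by
    rw [← vec_eq_sum]
  have h1 : inner ℂ (cgrad l) x = ∑ α, ((l (cvec n α 1) : ℂ) - I * (l (cvec n α I) : ℂ)) * x α := by
    rw [PiLp.inner_apply]
    refine Finset.sum_congr rfl fun α _ => ?_
    simp [cgrad]
    ring
  rw [h1]
  conv_rhs => rw [hx]
  rw [Finset.smul_sum]
  simp only [map_sum, Complex.ofReal_sum]
  rw [Finset.mul_sum, ← Finset.sum_sub_distrib]
  refine Finset.sum_congr rfl fun α _ => ?_
  rw [smul_real_form (x α), smul_add, I_smul_real_smul, I_smul_real_smul, I_smul_I_smul, cvec_I]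
  simp only [map_add, map_smul, map_neg, smul_eq_mul]
  apply Complex.ext <;> simp <;> ring

theorem re_inner_cgrad (l : Cn n →L[ℝ] ℝ) (x : Cn n) : (inner ℂ (cgrad l) x).re = l x := by
  rw [inner_cgrad]; simp

theorem cgrad_self (l : Cn n →L[ℝ] ℝ) : l (cgrad l) = ‖cgrad l‖ ^ 2 := by
  rw [← re_inner_cgrad]
  have := inner_self_eq_norm_sq (𝕜 := ℂ) (cgrad l)
  simpa using this

theorem abs_le_cgrad (l : Cn n →L[ℝ] ℝ) (x : Cn n) : |l x| ≤ ‖cgrad l‖ * ‖x‖ := by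
  rw [← re_inner_cgrad]
  exact (Complex.abs_re_le_norm _).trans (norm_inner_le_norm _ _)

theorem norm_le_cgrad (l : Cn n →L[ℝ] ℝ) : ‖l‖ ≤ ‖cgrad l‖ :=
  l.opNorm_le_bound (norm_nonneg _) fun x => by simpa using abs_le_cgrad l x

theorem cgrad_le_norm (l : Cn n →L[ℝ] ℝ) : ‖cgrad l‖ ≤ ‖l‖ := by
  have h1 := cgrad_self l
  have h2 := l.le_opNorm (cgrad l)
  rw [h1, Real.norm_of_nonneg (by positivity)] at h2
  by_contra h
  push Not at h
  nlinarith [norm_nonneg l, norm_nonneg (cgrad l)]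

namespace Defn
variable {Ω U : Set (Cn n)} {ρ : Cn n → ℝ}

theorem compact (h : Defn Ω U ρ) : IsCompact (closure Ω) :=
  Metric.isCompact_of_isClosed_isBounded isClosed_closure h.bdd.closure

theorem fsub (h : Defn Ω U ρ) : frontier Ω ⊆ U := frontier_subset_closure.trans h.sub

theorem fcompact (h : Defn Ω U ρ) : IsCompact (frontier Ω) :=
  h.compact.of_isClosed_subset isClosed_frontier frontier_subset_closure

theorem contDiffAt (h : Defn Ω U ρ) {y : Cn n} (hy : y ∈ U) : ContDiffAt ℝ (⊤ : ℕ∞) ρ y :=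
  h.smooth.contDiffAt (h.open_U.mem_nhds hy)

theorem diffAt (h : Defn Ω U ρ) {y : Cn n} (hy : y ∈ U) : DifferentiableAt ℝ ρ y :=
  (h.contDiffAt hy).differentiableAt (by simp)

theorem le_zero (h : Defn Ω U ρ) {p : Cn n} (hp : p ∈ closure Ω) : ρ p ≤ 0 := by
  have h1 : ContinuousWithinAt ρ Ω p := (h.diffAt (h.sub hp)).continuousAt.continuousWithinAt
  have h2 := h1.mem_closure hp (t := Iic 0) (fun z hz => by
    rw [h.eq] at hz; exact hz.2.le)
  simpa using h2

theorem zero (h : Defn Ω U ρ) {p : Cn n} (hp : p ∈ frontier Ω) : ρ p = 0 := by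
  refine le_antisymm (h.le_zero (frontier_subset_closure hp)) ?_
  by_contra hlt
  push Not at hlt
  have : p ∈ Ω := by rw [h.eq]; exact ⟨h.fsub hp, hlt⟩
  rw [h.open_Ω.frontier_eq] at hp
  exact hp.2 this

theorem fderiv_cont (h : Defn Ω U ρ) : ContinuousOn (fderiv ℝ ρ) U :=
  h.smooth.continuousOn_fderiv_of_isOpen h.open_U (by simp)

/-- uniform constants -/
theorem unif (h : Defn Ω U ρ) : ∃ m > 0, ∃ r > 0, ∀ p ∈ frontier Ω, m ≤ ‖fderiv ℝ ρ p‖ ∧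
    ∀ y, ‖y - p‖ < r → y ∈ U ∧ ‖fderiv ℝ ρ y - fderiv ℝ ρ p‖ ≤ m / 8 := by
  rcases (frontier Ω).eq_empty_or_nonempty with h0 | h0
  · exact ⟨1, one_pos, 1, one_pos, by simp [h0]⟩
  obtain ⟨p0, hp0, hmin⟩ := h.fcompact.exists_isMinOn h0 ((h.fderiv_cont.mono h.fsub).norm)
  have hm : 0 < ‖fderiv ℝ ρ p0‖ := norm_pos_iff.2 (h.ne p0 hp0)
  obtain ⟨δ, hδ, hsub⟩ := h.fcompact.exists_cthickening_subset_open h.open_U h.fsub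
  have huc := (h.fcompact.cthickening (r := δ)).uniformContinuousOn_of_continuous (h.fderiv_cont.mono hsub)
  rw [Metric.uniformContinuousOn_iff] at huc
  obtain ⟨r, hr, huc⟩ := huc (‖fderiv ℝ ρ p0‖ / 8) (by positivity)
  refine ⟨‖fderiv ℝ ρ p0‖, hm, min r δ, by positivity, fun p hp => ⟨hmin hp, fun y hy => ?_⟩⟩
  have hy1 : y ∈ cthickening δ (frontier Ω) := by
    apply mem_cthickening_of_dist_le y p δ _ hp
    rw [dist_eq_norm]; exact hy.le.trans (min_le_right _ _)
  refine ⟨hsub hy1, ?_⟩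
  have := huc y hy1 p (self_subset_cthickening _ hp) (by
    rw [dist_eq_norm]; exact hy.trans_le (min_le_left _ _))
  rw [dist_eq_norm] at this
  exact this.le

end Defn

/-- local boundary data at `p` -/
structure LocD (Ω U : Set (Cn n)) (ρ : Cn n → ℝ) (p : Cn n) (m r : ℝ) : Prop where
  m_pos : 0 < m
  r_pos : 0 < r
  fr : p ∈ frontier Ω
  lb : m ≤ ‖fderiv ℝ ρ p‖
  nb : ∀ y, ‖y - p‖ < r → y ∈ U ∧ ‖fderiv ℝ ρ y - fderiv ℝ ρ p‖ ≤ m / 8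

namespace LocD
variable {Ω U : Set (Cn n)} {ρ : Cn n → ℝ} {p : Cn n} {m r : ℝ}

theorem mvt (h : Defn Ω U ρ) (L : LocD Ω U ρ p m r) {y y' : Cn n} (hy : ‖y - p‖ < r)
    (hy' : ‖y' - p‖ < r) : |ρ y' - ρ y - fderiv ℝ ρ p (y' - y)| ≤ m / 8 * ‖y' - y‖ := by
  have key := (convex_ball p r).norm_image_sub_le_of_norm_hasFDerivWithin_le
    (f := fun y => ρ y - fderiv ℝ ρ p y) (f' := fun y => fderiv ℝ ρ y - fderiv ℝ ρ p) (C := m / 8)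
    (x := y) (y := y') ?_ ?_ (by rwa [mem_ball, dist_eq_norm]) (by rwa [mem_ball, dist_eq_norm])
  · rw [Real.norm_eq_abs] at key
    convert key using 2
    rw [map_sub]; ring
  · intro z hz
    rw [mem_ball, dist_eq_norm] at hz
    exact ((h.diffAt (L.nb z hz).1).hasFDerivAt.sub (fderiv ℝ ρ p).hasFDerivAt).hasFDerivWithinAt
  · intro z hz
    rw [mem_ball, dist_eq_norm] at hz
    exact (L.nb z hz).2

theorem cone (h : Defn Ω U ρ) (L : LocD Ω U ρ p m r) {y y' : Cn n} (hy : ‖y - p‖ < r)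
    (hy' : ‖y' - p‖ < r) (hyc : y ∈ closure Ω)
    (hl : fderiv ℝ ρ p (y' - y) < - (m / 8 * ‖y' - y‖)) : y' ∈ Ω := by
  have h1 := (abs_le.1 (L.mvt h hy hy')).2
  have h2 := h.le_zero hyc
  rw [h.eq]
  exact ⟨(L.nb y' hy').1, by linarith⟩

/-- gradient -/
theorem grad_lb (L : LocD Ω U ρ p m r) : m ≤ ‖cgrad (fderiv ℝ ρ p)‖ := L.lb.trans (norm_le_cgrad _)

theorem pcl (L : LocD Ω U ρ p m r) : p ∈ closure Ω := frontier_subset_closure L.fr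

/-- inward unit normal -/
theorem normal (L : LocD Ω U ρ p m r) : ∃ ν : Cn n, ‖ν‖ = 1 ∧
    fderiv ℝ ρ p ν = - ‖cgrad (fderiv ℝ ρ p)‖ := by
  have hpos : 0 < ‖cgrad (fderiv ℝ ρ p)‖ := L.m_pos.trans_le L.grad_lb
  refine ⟨-(‖cgrad (fderiv ℝ ρ p)‖⁻¹ • cgrad (fderiv ℝ ρ p)), ?_, ?_⟩
  · rw [norm_neg, norm_smul, norm_inv, norm_norm, inv_mul_cancel₀ hpos.ne']
  · rw [map_neg, map_smul, cgrad_self, smul_eq_mul]; field_simp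

theorem qs (h : Defn Ω U ρ) (L : LocD Ω U ρ p m r) : QS (closure Ω) p (r / 3) := by
  intro y hy hyr
  obtain ⟨ν, hν, hlν⟩ := L.normal
  have hg := L.grad_lb
  have hm := L.m_pos
  have hr := L.r_pos
  set l := fderiv ℝ ρ p
  set d := ‖y - p‖ with hd
  have hd0 : 0 ≤ d := norm_nonneg _
  have hp0 : ‖p - p‖ < r := by simpa using hr
  have hqn : ‖(p + (2 * d) • ν) - p‖ = 2 * d := by
    rw [add_sub_cancel_left, norm_smul, hν, mul_one, Real.norm_of_nonneg (by positivity)]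
  refine ⟨p + (2 * d) • ν, ?_, ?_, hqn.le⟩
  · have hseg : segment ℝ p (p + (2 * d) • ν) ⊆ ball p r :=
      (convex_ball p r).segment_subset (by simpa using hr)
        (by rw [mem_ball, dist_eq_norm, hqn]; linarith)
    intro z hz
    have hzb := hseg hz
    rw [mem_ball, dist_eq_norm] at hzb
    rw [segment_eq_image'] at hz
    obtain ⟨θ, ⟨hθ0, hθ1⟩, rfl⟩ := hz
    simp only [add_sub_cancel_left] at hzb ⊢
    rcases eq_or_lt_of_le (mul_nonneg hθ0 hd0) with h0 | h0
    · have : θ • (2 * d) • ν = (0 : Cn n) := by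
        rw [smul_smul, show θ * (2 * d) = 2 * (θ * d) by ring, ← h0]; simp
      rw [this, add_zero]; exact L.pcl
    · apply subset_closure
      apply L.cone h hp0 (by simpa using hzb) L.pcl
      rw [add_sub_cancel_left, smul_smul, map_smul, norm_smul, hν, hlν, smul_eq_mul,
        Real.norm_of_nonneg (by positivity)]
      nlinarith
  · have hyr' : ‖y - p‖ < r := by linarith
    have hseg : segment ℝ (p + (2 * d) • ν) y ⊆ ball p r :=
      (convex_ball p r).segment_subset 
        (by rw [mem_ball, dist_eq_norm, hqn]; linarith) (by rwa [mem_ball, dist_eq_norm])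
    intro z hz
    have hzb := hseg hz
    rw [mem_ball, dist_eq_norm] at hzb
    rw [segment_symm, segment_eq_image'] at hz
    obtain ⟨θ, ⟨hθ0, hθ1⟩, rfl⟩ := hz
    rcases eq_or_lt_of_le (mul_nonneg hθ0 hd0) with h0 | h0
    · rcases mul_eq_zero.1 h0.symm with h1 | h1
      · simp only [h1, zero_smul, add_zero]; exact hy
      · have : y = p := by rw [← sub_eq_zero, ← norm_eq_zero, ← hd, h1]
        simp only [h1, this]; simpa using L.pcl
    · apply subset_closure
      apply L.cone h hyr' hzb hy
      have e1 : p + (2 * d) • ν - y = (2 * d) • ν - (y - p) := by abel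
      have hθ : 0 < θ := by
        rcases eq_or_lt_of_le hθ0 with h1 | h1
        · rw [← h1] at h0; simp at h0
        · exact h1
      have hdp : 0 < d := by
        rcases eq_or_lt_of_le hd0 with h1 | h1
        · rw [← h1] at h0; simp at h0
        · exact h1
      have e2 : l (p + (2 * d) • ν - y) ≤ -(m * d) := by
        rw [e1, map_sub, map_smul, hlν, smul_eq_mul]
        have := abs_le_cgrad l (y - p)
        rw [← hd] at this
        have := (abs_le.1 this).1
        nlinarith
      have e3 : ‖p + (2 * d) • ν - y‖ ≤ 3 * d := by
        rw [e1]
        refine (norm_sub_le _ _).trans ?_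
        rw [norm_smul, hν, Real.norm_of_nonneg (by positivity), ← hd]; linarith
      rw [add_sub_cancel_left, map_smul, norm_smul, Real.norm_of_nonneg hθ0, smul_eq_mul]
      have e4 : m / 8 * (θ * ‖p + (2 * d) • ν - y‖) ≤ m / 8 * (θ * (3 * d)) := by gcongr
      have e5 : θ * l (p + (2 * d) • ν - y) ≤ θ * (-(m * d)) := by gcongr
      have : 0 < m * (θ * d) := by positivity
      nlinarith

theorem uniqueDiff (h : Defn Ω U ρ) (L : LocD Ω U ρ p m r) : UniqueDiffWithinAt ℝ (closure Ω) p := by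
  obtain ⟨ν, hν, hlν⟩ := L.normal
  have hg := L.grad_lb
  have hm := L.m_pos
  have hr := L.r_pos
  set l := fderiv ℝ ρ p
  set K : Set (Cn n) := {y | ‖y - p‖ < r} ∩ {y | l (y - p) + m / 8 * ‖y - p‖ < 0} with hK
  have hp0 : ‖p - p‖ < r := by simpa using hr
  have hKsub : K ⊆ closure Ω := fun y hy => subset_closure
    (L.cone h hp0 hy.1 L.pcl (by have := hy.2; simp only [mem_setOf_eq] at this; linarith))
  have hKopen : IsOpen K := by
    apply IsOpen.inter
    · exact isOpen_lt (by fun_prop) continuous_const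
    · exact isOpen_lt (by fun_prop) continuous_const
  have hKconv : Convex ℝ K := by
    apply Convex.inter
    · have : {y : Cn n | ‖y - p‖ < r} = ball p r := by ext; simp [dist_eq_norm]
      rw [this]; exact convex_ball p r
    · have c0 : ConvexOn ℝ univ (fun y : Cn n => ‖y - p‖) := by
        have := convexOn_univ_norm (E := Cn n) |>.comp_affineMap (AffineMap.id ℝ (Cn n) - AffineMap.const ℝ (Cn n) p)
        simpa using! this
      have c1 : ConvexOn ℝ univ (fun y : Cn n => l (y - p) + m / 8 * ‖y - p‖) := by
        apply ConvexOn.add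
        · refine ⟨convex_univ, fun x _ y _ a b ha hb hab => le_of_eq ?_⟩
          simp only [map_sub, map_add, map_smul, smul_eq_mul]
          have : l p = (a + b) * l p := by rw [hab, one_mul]
          linear_combination -this
        · exact c0.smul (c := m / 8) (by positivity)
      simpa using c1.convex_lt 0
  have hmem : ∀ τ : ℝ, 0 < τ → τ < r → p + τ • ν ∈ K := by
    intro τ h0 h1
    constructor
    · simp [norm_smul, hν, abs_of_pos h0, h1]
    · simp only [mem_setOf_eq, add_sub_cancel_left, map_smul, hlν, norm_smul, hν, smul_eq_mul, Real.norm_of_nonneg h0.le]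
      nlinarith
  refine UniqueDiffWithinAt.mono (uniqueDiffWithinAt_convex hKconv ?_ ?_) hKsub
  · rw [hKopen.interior_eq]; exact ⟨_, hmem (r/2) (by positivity) (by linarith)⟩
  · have : Tendsto (fun τ : ℝ => p + τ • ν) (𝓝[>] 0) (𝓝 p) := by
      have : Continuous (fun τ : ℝ => p + τ • ν) := by fun_prop
      simpa using (this.tendsto 0).mono_left nhdsWithin_le_nhds
    refine mem_closure_of_tendsto this ?_
    filter_upwards [Ioo_mem_nhdsGT hr] with τ hτ using hmem τ hτ.1 hτ.2

end LocD

theorem Defn.uniqueDiffOn {Ω U : Set (Cn n)} {ρ : Cn n → ℝ} (h : Defn Ω U ρ) :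
    UniqueDiffOn ℝ (closure Ω) := by
  intro p hp
  by_cases hpΩ : p ∈ Ω
  · exact (h.open_Ω.uniqueDiffWithinAt hpΩ).mono subset_closure
  · obtain ⟨m, hm, r, hr, hu⟩ := h.unif
    have hf : p ∈ frontier Ω := by rw [h.open_Ω.frontier_eq]; exact ⟨hp, hpΩ⟩
    exact LocD.uniqueDiff h ⟨hm, hr, hf, (hu p hf).1, (hu p hf).2⟩

theorem Defn.closure_int {Ω U : Set (Cn n)} {ρ : Cn n → ℝ} (h : Defn Ω U ρ) {p : Cn n}
    (hp : p ∈ closure Ω) : p ∈ closure (interior (closure Ω)) :=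
  closure_mono (interior_maximal subset_closure h.open_Ω) hp

end PartPC1

section PartPC2
theorem nat_le_top (k : ℕ) : (k : WithTop ℕ∞) ≤ ((⊤ : ℕ∞) : WithTop ℕ∞) :=
  WithTop.coe_le_coe.2 (le_top : (k : ℕ∞) ≤ ⊤)

namespace Defn
variable {Ω U : Set (Cn n)} {ρ : Cn n → ℝ}

theorem frontier_of (h : Defn Ω U ρ) {a b : Cn n} (ha : a ∈ Ω) (hb : b ∉ Ω) :
    ∃ y ∈ segment ℝ a b, y ∈ frontier Ω := by
  by_contra hcon
  push Not at hcon
  have hpre : IsPreconnected (segment ℝ a b) := (convex_segment a b).isPreconnected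
  have h2 := hpre Ω (closure Ω)ᶜ h.open_Ω isClosed_closure.isOpen_compl ?_ ⟨a, left_mem_segment ℝ a b, ha⟩
    ⟨b, right_mem_segment ℝ a b, ?_⟩
  · obtain ⟨x, _, hx1, hx2⟩ := h2
    exact hx2 (subset_closure hx1)
  · intro y hy
    by_cases hyc : y ∈ closure Ω
    · left
      by_contra hyo
      exact hcon y hy (by rw [h.open_Ω.frontier_eq]; exact ⟨hyc, hyo⟩)
    · right; exact hyc
  · intro hbc
    exact hcon b (right_mem_segment ℝ a b) (by rw [h.open_Ω.frontier_eq]; exact ⟨hbc, hb⟩)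

theorem dir_deriv {v : Cn n → ℝ} {p d : Cn n} {v' : Cn n →L[ℝ] ℝ} (hv : HasFDerivAt v v' p)
    (h0 : v p = 0) (hd : v' d < 0) : ∀ᶠ τ : ℝ in 𝓝[>] 0, v (p + τ • d) < 0 := by
  have h1 : HasDerivAt (fun τ : ℝ => v (p + τ • d)) (v' d) 0 := by
    have e1 : HasDerivAt (fun τ : ℝ => p + τ • d) d 0 := by
      simpa using ((hasDerivAt_id (0:ℝ)).smul_const d).const_add p
    have hv' : HasFDerivAt v v' (p + (0:ℝ) • d) := by simpa using hv
    exact hv'.comp_hasDerivAt (0:ℝ) e1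
  have h2 := h1.hasDerivWithinAt (s := Ioi 0)
  rw [hasDerivWithinAt_iff_tendsto_slope' (by simp)] at h2
  filter_upwards [h2.eventually_lt_const hd, self_mem_nhdsWithin] with τ ht hτ
  have hτ : 0 < τ := hτ
  rw [slope_def_field] at ht
  simp only [zero_smul, add_zero, h0, sub_zero] at ht
  rw [div_lt_iff₀ hτ] at ht
  linarith

theorem tangent (h : Defn Ω U ρ) {p : Cn n} (hp : p ∈ frontier Ω) {e : Cn n}
    (he : fderiv ℝ ρ p e = 0) {ε : ℝ} (hε : 0 < ε) :
    ∀ᶠ τ : ℝ in 𝓝[>] 0, ∃ y ∈ frontier Ω, ‖y - p - τ • e‖ ≤ ε * τ := by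
  set l := fderiv ℝ ρ p with hl
  have hN : 0 < ‖cgrad l‖ := (norm_pos_iff.2 (h.ne p hp)).trans_le (norm_le_cgrad _)
  obtain ⟨ν, hν, hlν⟩ : ∃ ν : Cn n, ‖ν‖ = 1 ∧ l ν < 0 := by
    refine ⟨-(‖cgrad l‖⁻¹ • cgrad l), ?_, ?_⟩
    · rw [norm_neg, norm_smul, norm_inv, norm_norm, inv_mul_cancel₀ hN.ne']
    · rw [map_neg, map_smul, cgrad_self, smul_eq_mul]
      have : 0 < ‖cgrad l‖⁻¹ * ‖cgrad l‖ ^ 2 := by positivity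
      linarith
  have hd := (h.diffAt (h.fsub hp)).hasFDerivAt
  have h0 := h.zero hp
  have a1 := dir_deriv (d := e + ε • ν) hd h0 (by
    rw [map_add, map_smul, ← hl, he, smul_eq_mul]; nlinarith)
  have a2 := dir_deriv (d := e - ε • ν) hd.neg (by simp [h0]) (by
    simp only [neg_apply, map_sub, map_smul, ← hl, he, smul_eq_mul]; nlinarith)
  have hU : ∀ d : Cn n, ∀ᶠ τ : ℝ in 𝓝[>] 0, p + τ • d ∈ U := by
    intro d
    have : Tendsto (fun τ : ℝ => p + τ • d) (𝓝[>] 0) (𝓝 p) := by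
      have : Continuous (fun τ : ℝ => p + τ • d) := by fun_prop
      simpa using (this.tendsto 0).mono_left nhdsWithin_le_nhds
    exact this.eventually (h.open_U.mem_nhds (h.fsub hp))
  filter_upwards [a1, a2, hU (e + ε • ν), self_mem_nhdsWithin] with τ b1 b2 b3 hτ
  have hτ : 0 < τ := hτ
  obtain ⟨y, hy, hyf⟩ := h.frontier_of (a := p + τ • (e + ε • ν)) (b := p + τ • (e - ε • ν))
    (by rw [h.eq]; exact ⟨b3, b1⟩) (by
      rw [h.eq]; intro hh; have := hh.2; simp only [Pi.neg_apply] at b2; linarith)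
  refine ⟨y, hyf, ?_⟩
  have hconv : Convex ℝ (closedBall (p + τ • e) (ε * τ)) := convex_closedBall _ _
  have := hconv.segment_subset ?_ ?_ hy
  · rw [mem_closedBall, dist_eq_norm] at this
    rw [show y - p - τ • e = y - (p + τ • e) by abel]; exact this
  · rw [mem_closedBall, dist_eq_norm, smul_add, smul_smul]
    have : p + (τ • e + (τ * ε) • ν) - (p + τ • e) = (τ * ε) • ν := by abel
    rw [this, norm_smul, hν, Real.norm_of_nonneg (by positivity)]; linarith
  · rw [mem_closedBall, dist_eq_norm, smul_sub, smul_smul]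
    have : p + (τ • e - (τ * ε) • ν) - (p + τ • e) = -((τ * ε) • ν) := by abel
    rw [this, norm_neg, norm_smul, hν, Real.norm_of_nonneg (by positivity)]; linarith

theorem tangent_lin (h : Defn Ω U ρ) {p : Cn n} (hp : p ∈ frontier Ω) {e : Cn n}
    (he : fderiv ℝ ρ p e = 0) {v : Cn n → ℝ} {v' : Cn n →L[ℝ] ℝ}
    (hv : HasFDerivWithinAt v v' (frontier Ω) p) (h0 : ∀ y ∈ frontier Ω, v y = 0) : v' e = 0 := by
  have key : ∀ ε > 0, ε ≤ 1 → |v' e| ≤ ε * (‖v'‖ + (‖e‖ + 1)) := by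
    intro ε hε hε1
    have h1 := hv.isLittleO.def hε
    rw [eventually_nhdsWithin_iff, Metric.eventually_nhds_iff] at h1
    obtain ⟨r, hr, h1⟩ := h1
    have h3 : ∀ᶠ τ : ℝ in 𝓝[>] 0, τ * (‖e‖ + 1) < r := by
      have c1 : Tendsto (fun τ : ℝ => τ * (‖e‖ + 1)) (𝓝[>] 0) (𝓝 0) := by
        have : Continuous (fun τ : ℝ => τ * (‖e‖ + 1)) := by fun_prop
        simpa using (this.tendsto 0).mono_left nhdsWithin_le_nhds
      exact c1.eventually_lt_const hr
    obtain ⟨τ, ⟨y, hy, hyn⟩, h3, hτ⟩ := ((h.tangent hp he hε).and (h3.and self_mem_nhdsWithin)).exists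
    have hτ : 0 < τ := hτ
    have hyp : ‖y - p‖ ≤ τ * (‖e‖ + 1) := by
      calc ‖y - p‖ = ‖(y - p - τ • e) + τ • e‖ := by congr 1; abel
        _ ≤ _ := norm_add_le _ _
        _ ≤ ε * τ + τ * ‖e‖ := by rw [norm_smul, Real.norm_of_nonneg hτ.le]; linarith
        _ ≤ _ := by nlinarith
    have h4 := h1 (y := y) (by rw [dist_eq_norm]; linarith) hy
    rw [h0 y hy, h0 p hp, sub_zero, zero_sub, norm_neg, Real.norm_eq_abs] at h4
    have h5 : τ * v' e = v' (y - p) - v' (y - p - τ • e) := by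
      rw [← map_sub, sub_sub_cancel, map_smul, smul_eq_mul]
    have h6 : |v' (y - p - τ • e)| ≤ ‖v'‖ * (ε * τ) := by
      have := v'.le_opNorm (y - p - τ • e)
      rw [Real.norm_eq_abs] at this
      exact this.trans (by gcongr)
    have h7 : |τ * v' e| ≤ ε * (τ * (‖e‖ + 1)) + ‖v'‖ * (ε * τ) := by
      rw [h5]
      refine (abs_sub _ _).trans (add_le_add (h4.trans (by gcongr)) h6)
    rw [abs_mul, abs_of_pos hτ] at h7
    have : τ * |v' e| ≤ τ * (ε * (‖v'‖ + (‖e‖ + 1))) := by linarith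
    exact le_of_mul_le_mul_left this hτ
  by_contra hne
  have hpos : 0 < |v' e| := abs_pos.2 hne
  set C := ‖v'‖ + (‖e‖ + 1) with hC
  have hCp : 0 < C := by positivity
  have := key (min 1 (|v' e| / (2 * C))) (by positivity) (min_le_left _ _)
  have h2 : min 1 (|v' e| / (2 * C)) * C ≤ |v' e| / (2 * C) * C := by
    gcongr; exact min_le_right _ _
  have h3 : |v' e| / (2 * C) * C = |v' e| / 2 := by field_simp
  linarith

theorem tangent_quad (h : Defn Ω U ρ) {p : Cn n} (hp : p ∈ frontier Ω) {e : Cn n}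
    (he : fderiv ℝ ρ p e = 0) {v : Cn n → ℝ} {Q : Cn n →L[ℝ] Cn n →L[ℝ] ℝ}
    (hv : ∀ ε > 0, ∃ r > 0, ∀ y ∈ frontier Ω, ‖y - p‖ < r → |v y - Q (y - p) (y - p)| ≤ ε * ‖y - p‖ ^ 2)
    (h0 : ∀ y ∈ frontier Ω, v y = 0) : Q e e = 0 := by
  have key : ∀ ε > 0, ε ≤ 1 → |Q e e| ≤ ε * ((‖e‖ + 1) ^ 2 + 2 * ‖Q‖ * (‖e‖ + 1)) := by
    intro ε hε hε1
    obtain ⟨r, hr, h1⟩ := hv ε hε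
    have h3 : ∀ᶠ τ : ℝ in 𝓝[>] 0, τ * (‖e‖ + 1) < r := by
      have c1 : Tendsto (fun τ : ℝ => τ * (‖e‖ + 1)) (𝓝[>] 0) (𝓝 0) := by
        have : Continuous (fun τ : ℝ => τ * (‖e‖ + 1)) := by fun_prop
        simpa using (this.tendsto 0).mono_left nhdsWithin_le_nhds
      exact c1.eventually_lt_const hr
    obtain ⟨τ, ⟨y, hy, hyn⟩, h3, hτ⟩ := ((h.tangent hp he hε).and (h3.and self_mem_nhdsWithin)).exists
    have hτ : 0 < τ := hτ
    have hyp : ‖y - p‖ ≤ τ * (‖e‖ + 1) := by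
      calc ‖y - p‖ = ‖(y - p - τ • e) + τ • e‖ := by congr 1; abel
        _ ≤ _ := norm_add_le _ _
        _ ≤ ε * τ + τ * ‖e‖ := by rw [norm_smul, Real.norm_of_nonneg hτ.le]; linarith
        _ ≤ _ := by nlinarith
    have h4 := h1 y hy (by linarith)
    rw [h0 y hy, zero_sub, abs_neg] at h4
    have h5 : τ ^ 2 * Q e e = Q (y - p) (y - p) - (Q (y - p - τ • e) (y - p) + Q (τ • e) (y - p - τ • e)) := by
      simp only [map_sub, map_smul, smul_eq_mul, sub_apply, smul_apply]
      ring
    have hte : ‖τ • e‖ ≤ τ * (‖e‖ + 1) := by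
      rw [norm_smul, Real.norm_of_nonneg hτ.le]; nlinarith
    have h6 : |Q (y - p - τ • e) (y - p)| ≤ ‖Q‖ * (ε * τ) * (τ * (‖e‖ + 1)) := by
      have := Q.le_opNorm₂ (y - p - τ • e) (y - p)
      rw [Real.norm_eq_abs] at this
      exact this.trans (by gcongr)
    have h7 : |Q (τ • e) (y - p - τ • e)| ≤ ‖Q‖ * (τ * (‖e‖ + 1)) * (ε * τ) := by
      have := Q.le_opNorm₂ (τ • e) (y - p - τ • e)
      rw [Real.norm_eq_abs] at this
      exact this.trans (by gcongr)
    have h8 : |τ ^ 2 * Q e e| ≤ ε * (τ * (‖e‖ + 1)) ^ 2 + (‖Q‖ * (ε * τ) * (τ * (‖e‖ + 1)) + ‖Q‖ * (τ * (‖e‖ + 1)) * (ε * τ)) := by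
      rw [h5]
      refine (abs_sub _ _).trans (add_le_add (h4.trans (by gcongr)) ((abs_add_le _ _).trans (add_le_add h6 h7)))
    rw [abs_mul, abs_of_pos (by positivity : 0 < τ ^ 2)] at h8
    have : τ ^ 2 * |Q e e| ≤ τ ^ 2 * (ε * ((‖e‖ + 1) ^ 2 + 2 * ‖Q‖ * (‖e‖ + 1))) := by
      refine h8.trans (le_of_eq ?_); ring
    exact le_of_mul_le_mul_left this (by positivity)
  by_contra hne
  have hpos : 0 < |Q e e| := abs_pos.2 hne
  set C := (‖e‖ + 1) ^ 2 + 2 * ‖Q‖ * (‖e‖ + 1) with hC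
  have hCp : 0 < C := by positivity
  have := key (min 1 (|Q e e| / (2 * C))) (by positivity) (min_le_left _ _)
  have h2 : min 1 (|Q e e| / (2 * C)) * C ≤ |Q e e| / (2 * C) * C := by
    gcongr; exact min_le_right _ _
  have h3 : |Q e e| / (2 * C) * C = |Q e e| / 2 := by field_simp
  linarith

/-- Boundary identity: a `C²` function vanishing on the boundary is to second order
a multiple of the defining function, along tangential directions. -/
theorem boundary_levi (h : Defn Ω U ρ) {p : Cn n} (hp : p ∈ frontier Ω) {v : Cn n → ℝ}
    (hv : ContDiffOn ℝ 2 v (closure Ω)) (h0 : ∀ y ∈ frontier Ω, v y = 0) :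
    ∃ κ : ℝ, fderivWithin ℝ v (closure Ω) p = κ • fderivWithin ℝ ρ (closure Ω) p ∧
      ∀ e, fderiv ℝ ρ p e = 0 → fderiv ℝ ρ p (I • e) = 0 →
        levi (closure Ω) v p e = κ * levi (closure Ω) ρ p e := by
  have hpc : p ∈ closure Ω := frontier_subset_closure hp
  have hud := h.uniqueDiffOn
  set l := fderiv ℝ ρ p with hl
  have hlw : fderivWithin ℝ ρ (closure Ω) p = l := fderivWithin_eq_fderiv (hud p hpc) (h.diffAt (h.fsub hp))
  have hN : 0 < ‖cgrad l‖ := (norm_pos_iff.2 (h.ne p hp)).trans_le (norm_le_cgrad _)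
  have hlN : l (cgrad l) ≠ 0 := by rw [cgrad_self]; positivity
  have hvd := (hv.differentiableOn (by norm_num) p hpc).hasFDerivWithinAt
  set v' := fderivWithin ℝ v (closure Ω) p with hv'
  have htan : ∀ e, l e = 0 → v' e = 0 := fun e he =>
    h.tangent_lin hp he (hvd.mono frontier_subset_closure) h0
  refine ⟨v' (cgrad l) / l (cgrad l), ?_, ?_⟩
  · rw [hlw]
    ext x
    have := htan (x - (l x / l (cgrad l)) • cgrad l) (by
      rw [map_sub, map_smul, smul_eq_mul]; field_simp; ring)
    rw [map_sub, map_smul, smul_eq_mul] at this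
    rw [smul_apply, smul_eq_mul]
    field_simp at this ⊢
    linarith
  set κ := v' (cgrad l) / l (cgrad l) with hκ
  have hv'κ : ∀ x, v' x = κ * l x := by
    intro x
    have := htan (x - (l x / l (cgrad l)) • cgrad l) (by
      rw [map_sub, map_smul, smul_eq_mul]; field_simp; ring)
    rw [map_sub, map_smul, smul_eq_mul] at this
    rw [hκ]
    field_simp at this ⊢
    linarith
  obtain ⟨m, hm, r, hr, hu⟩ := h.unif
  have L : LocD Ω U ρ p m r := ⟨hm, hr, hp, (hu p hp).1, (hu p hp).2⟩
  have hρ2 : ContDiffOn ℝ 2 ρ (closure Ω) := (h.smooth.of_le (nat_le_top 2)).mono h.sub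
  have hquad : ∀ e, l e = 0 → D2 (closure Ω) v p e e = κ * D2 (closure Ω) ρ p e e := by
    intro e he
    have := h.tangent_quad hp he (v := fun y => v y - κ * ρ y)
      (Q := (1/2 : ℝ) • (D2 (closure Ω) v p - κ • D2 (closure Ω) ρ p)) ?_ ?_
    · simp at this
      linarith
    · intro ε hε
      obtain ⟨r1, hr1, t1⟩ := taylor2 (by positivity) hv hud hpc (h.closure_int hpc) (L.qs h) (ε := ε / 2) (by positivity)
      obtain ⟨r2, hr2, t2⟩ := taylor2 (by positivity) hρ2 hud hpc (h.closure_int hpc) (L.qs h)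
        (ε := ε / (2 * (|κ| + 1))) (by positivity)
      refine ⟨min r1 r2, by positivity, fun y hy hyr => ?_⟩
      have s1 := t1 y (frontier_subset_closure hy) (hyr.trans_le (min_le_left _ _))
      have s2 := t2 y (frontier_subset_closure hy) (hyr.trans_le (min_le_right _ _))
      rw [← hv', hv'κ, h0 p hp] at s1
      rw [hlw, h.zero hp] at s2
      have e1 : v y - κ * ρ y - ((1/2 : ℝ) • (D2 (closure Ω) v p - κ • D2 (closure Ω) ρ p)) (y - p) (y - p)
        = (v y - 0 - κ * l (y - p) - 1 / 2 * D2 (closure Ω) v p (y - p) (y - p))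
          - κ * (ρ y - 0 - l (y - p) - 1 / 2 * D2 (closure Ω) ρ p (y - p) (y - p)) := by
        simp only [smul_apply, sub_apply, smul_eq_mul]; ring
      rw [e1]
      refine (abs_sub _ _).trans ?_
      rw [abs_mul]
      have e2 : |κ| * |ρ y - 0 - l (y - p) - 1 / 2 * D2 (closure Ω) ρ p (y - p) (y - p)|
          ≤ |κ| * (ε / (2 * (|κ| + 1)) * ‖y - p‖ ^ 2) := by gcongr
      have e3 : |κ| * (ε / (2 * (|κ| + 1))) ≤ ε / 2 := by
        rw [mul_div_assoc', div_le_iff₀ (by positivity)]; nlinarith [abs_nonneg κ]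
      have e4 : |κ| * (ε / (2 * (|κ| + 1)) * ‖y - p‖ ^ 2) ≤ ε / 2 * ‖y - p‖ ^ 2 := by
        rw [← mul_assoc]; gcongr
      linarith
    · intro y hy; simp [h0 y hy, h.zero hy]
  intro e h1 h2
  unfold levi
  rw [hquad e h1, hquad _ h2]; ring

end Defn

end PartPC2

section PartPC3
set_option maxSynthPendingDepth 3
theorem quad_hasFDerivAt' {E F : Type*} [NormedAddCommGroup E] [NormedSpace ℝ E]
    [NormedAddCommGroup F] [NormedSpace ℝ F]
    (B : E →L[ℝ] E →L[ℝ] F) (hB : ∀ a b, B a b = B b a) (p y : E) :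
    HasFDerivAt (fun y => (1/2 : ℝ) • B (y - p) (y - p)) (B (y - p)) y := by
  have h1 : HasFDerivAt (fun y : E => y - p) (ContinuousLinearMap.id ℝ E) y :=
    (hasFDerivAt_id y).sub_const p
  have h2 := (B.hasFDerivAt_of_bilinear h1 h1).const_smul (1/2 : ℝ)
  refine h2.congr_fderiv ?_
  ext v
  have e1 : ∀ w : F, (1/2 : ℝ) • (w + w) = w := fun w => by
    rw [← two_smul ℝ w, smul_smul]; norm_num
  have e2 := hB v (y - p)
  have e3 : ((((ContinuousLinearMap.precompR E B) (y - p)) (ContinuousLinearMap.id ℝ E)) v : F)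
      = B (y - p) v := rfl
  simp only [smul_apply, add_apply, e3, ContinuousLinearMap.precompL_apply,
    ContinuousLinearMap.id_apply, e2, e1]

theorem lin_hasFDerivAt {E F : Type*} [NormedAddCommGroup E] [NormedSpace ℝ E]
    [NormedAddCommGroup F] [NormedSpace ℝ F]
    (B : E →L[ℝ] F) (p y : E) : HasFDerivAt (fun y => B (y - p)) B y :=
  (B.hasFDerivAt (x := y - p)).comp y ((hasFDerivAt_id y).sub_const p)

theorem cubic_hasFDerivAt {E : Type*} [NormedAddCommGroup E] [NormedSpace ℝ E]
    (C : E →L[ℝ] E →L[ℝ] E →L[ℝ] ℝ) (hC : ∀ a b, C a b = C b a) (hC' : ∀ a b c, C a b c = C a c b)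
    (p y : E) :
    HasFDerivAt (fun y => (1/6 : ℝ) * C (y - p) (y - p) (y - p)) ((1/2 : ℝ) • C (y - p) (y - p)) y := by
  have h1 : HasFDerivAt (fun y : E => y - p) (ContinuousLinearMap.id ℝ E) y :=
    (hasFDerivAt_id y).sub_const p
  have h2 := ((quad_hasFDerivAt' C hC p y).clm_apply h1).const_mul (1/3 : ℝ)
  have e : (fun y => (1/6 : ℝ) * C (y - p) (y - p) (y - p))
      = fun y => (1/3 : ℝ) * ((1/2 : ℝ) • C (y - p) (y - p)) (y - p) := by
    funext y; simp only [smul_apply, smul_eq_mul]; ring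
  rw [e]
  refine h2.congr_fderiv ?_
  ext v
  have e2 := hC' (y - p) v (y - p)
  simp only [smul_apply, add_apply, ContinuousLinearMap.comp_apply, ContinuousLinearMap.id_apply,
    ContinuousLinearMap.flip_apply, smul_eq_mul]
  rw [e2]; ring

/-- Taylor package at `p`. -/
structure Tay {E : Type*} [NormedAddCommGroup E] [NormedSpace ℝ E] (s : Set E) (p : E) (g : E → ℝ)
    (R M : ℝ) (g1 : E →L[ℝ] ℝ) (g2 : E →L[ℝ] E →L[ℝ] ℝ) (g3 : E →L[ℝ] E →L[ℝ] E →L[ℝ] ℝ) : Prop where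
  symm : ∀ a b, g2 a b = g2 b a
  b1 : ‖g1‖ ≤ M
  b2 : ‖g2‖ ≤ M
  b3 : ‖g3‖ ≤ M
  rem : ∀ y ∈ s, ‖y - p‖ < R →
    |g y - g p - g1 (y - p) - (1/2) * g2 (y - p) (y - p) - (1/6) * g3 (y - p) (y - p) (y - p)|
      ≤ M * ‖y - p‖ ^ 4

theorem taylor4 {E : Type*} [NormedAddCommGroup E] [NormedSpace ℝ E] {s : Set E} {p : E} {g : E → ℝ}
    {R M : ℝ} (hR : 0 ≤ R) (hM : 0 ≤ M) (hQ : QS s p R) (hs : UniqueDiffOn ℝ s)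
    (hcint : ∀ y ∈ s, y ∈ closure (interior s))
    (hp : p ∈ s) (hg : ContDiffOn ℝ 4 g s)
    (hb : ∀ k ≤ 4, ∀ y ∈ s, ‖iteratedFDerivWithin ℝ k g s y‖ ≤ M) :
    ∃ g3, Tay s p g (R / 16) (40000 * M) (fderivWithin ℝ g s p) (D2 s g p) g3 := by
  set d1 := fderivWithin ℝ g s with hd1
  set d2 := fderivWithin ℝ d1 s with hd2
  set d3 := fderivWithin ℝ d2 s with hd3
  set d4 := fderivWithin ℝ d3 s with hd4
  have c1 : ContDiffOn ℝ 3 d1 s := hg.fderivWithin hs (by norm_num)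
  have c2 : ContDiffOn ℝ 2 d2 s := c1.fderivWithin hs (by norm_num)
  have c3 : ContDiffOn ℝ 1 d3 s := c2.fderivWithin hs (by norm_num)
  have f0 : ∀ y ∈ s, HasFDerivWithinAt g (d1 y) s y := fun y hy =>
    (hg.differentiableOn (by norm_num) y hy).hasFDerivWithinAt
  have f1 : ∀ y ∈ s, HasFDerivWithinAt d1 (d2 y) s y := fun y hy =>
    (c1.differentiableOn (by norm_num) y hy).hasFDerivWithinAt
  have f2 : ∀ y ∈ s, HasFDerivWithinAt d2 (d3 y) s y := fun y hy =>
    (c2.differentiableOn (by norm_num) y hy).hasFDerivWithinAt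
  have f3 : ∀ y ∈ s, HasFDerivWithinAt d3 (d4 y) s y := fun y hy =>
    (c3.differentiableOn (by norm_num) y hy).hasFDerivWithinAt
  have n1 : ∀ y ∈ s, ‖d1 y‖ ≤ M := fun y hy => by
    rw [hd1, ← norm_iteratedFDerivWithin_zero (𝕜 := ℝ) (s := s),
      norm_iteratedFDerivWithin_fderivWithin hs hy]; exact hb 1 (by norm_num) y hy
  have n2 : ∀ y ∈ s, ‖d2 y‖ ≤ M := fun y hy => by
    rw [hd2, ← norm_iteratedFDerivWithin_zero (𝕜 := ℝ) (s := s),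
      norm_iteratedFDerivWithin_fderivWithin hs hy, hd1,
      norm_iteratedFDerivWithin_fderivWithin hs hy]; exact hb 2 (by norm_num) y hy
  have n3 : ∀ y ∈ s, ‖d3 y‖ ≤ M := fun y hy => by
    rw [hd3, ← norm_iteratedFDerivWithin_zero (𝕜 := ℝ) (s := s),
      norm_iteratedFDerivWithin_fderivWithin hs hy, hd2,
      norm_iteratedFDerivWithin_fderivWithin hs hy, hd1,
      norm_iteratedFDerivWithin_fderivWithin hs hy]; exact hb 3 (by norm_num) y hy
  have n4 : ∀ y ∈ s, ‖d4 y‖ ≤ M := fun y hy => by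
    have q1 : ‖d4 y‖ = ‖iteratedFDerivWithin ℝ 1 d3 s y‖ := (norm_iteratedFDerivWithin_one d3 (hs y hy)).symm
    have q2 : ‖iteratedFDerivWithin ℝ 1 d3 s y‖ = ‖iteratedFDerivWithin ℝ 2 d2 s y‖ :=
      norm_iteratedFDerivWithin_fderivWithin hs hy
    have q3 : ‖iteratedFDerivWithin ℝ 2 d2 s y‖ = ‖iteratedFDerivWithin ℝ 3 d1 s y‖ :=
      norm_iteratedFDerivWithin_fderivWithin hs hy
    have q4 : ‖iteratedFDerivWithin ℝ 3 d1 s y‖ = ‖iteratedFDerivWithin ℝ 4 g s y‖ :=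
      norm_iteratedFDerivWithin_fderivWithin hs hy
    rw [q1, q2, q3, q4]; exact hb 4 (by norm_num) y hy
  have s2 : ∀ y ∈ s, ∀ a b, d2 y a b = d2 y b a := fun y hy a b =>
    D2_symm (hg.of_le (by norm_num)) hs hy (hcint y hy) a b
  have s3 : ∀ a b, d3 p a b = d3 p b a := by
    intro a b
    exact (c1 p hp).isSymmSndFDerivWithinAt (n := 3) (by simp; norm_num) hs (hcint p hp) hp a b
  have s3' : ∀ a b c, d3 p a b c = d3 p a c b := by
    intro a b c
    have e : ∀ b c, HasFDerivWithinAt (fun y => d2 y b c)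
      (((ContinuousLinearMap.apply ℝ ℝ c).comp (ContinuousLinearMap.apply ℝ (E →L[ℝ] ℝ) b)).comp (d3 p)) s p := by
      intro b c
      exact ((ContinuousLinearMap.apply ℝ ℝ c).comp (ContinuousLinearMap.apply ℝ (E →L[ℝ] ℝ) b)).hasFDerivAt.comp_hasFDerivWithinAt p (f2 p hp)
    have e1 := (e c b).congr (f₁ := fun y => d2 y b c) (fun y hy => s2 y hy b c) (s2 p hp b c)
    have e2 := (hs p hp).eq (e b c) e1
    have := congrArg (fun L => L a) e2
    simpa using this
  have k3 := hQ.grow (k := 0) (A := M) (h := fun y => d3 y - d3 p) (h' := d4) hM (by simp)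
    (fun y hy _ => (f3 y hy).sub_const _) (fun y hy _ => by simpa using n4 y hy)
  have k2 := (hQ.mono (R' := R / 2) ?_).grow (k := 1) (A := 5 * M) (h := fun y => d2 y - d2 p - d3 p (y - p))
    (h' := fun y => d3 y - d3 p) (by positivity) (by simp)
    (fun y hy _ => ((f2 y hy).sub_const _).sub (lin_hasFDerivAt _ p y).hasFDerivWithinAt)
    (fun y hy hyr => (k3 y hy hyr).trans (le_of_eq (by ring)))
  have k1 := (hQ.mono (R' := R / 4) ?_).grow (k := 2) (A := 50 * M)
    (h := fun y => d1 y - d1 p - d2 p (y - p) - (1/2 : ℝ) • d3 p (y - p) (y - p))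
    (h' := fun y => d2 y - d2 p - d3 p (y - p)) (by positivity) (by simp)
    (fun y hy _ => (((f1 y hy).sub_const _).sub (lin_hasFDerivAt _ p y).hasFDerivWithinAt).sub
      (quad_hasFDerivAt' _ s3 p y).hasFDerivWithinAt)
    (fun y hy hyr => (k2 y hy (by linarith)).trans (le_of_eq (by ring)))
  have k0 := (hQ.mono (R' := R / 8) ?_).grow (k := 3) (A := 1000 * M)
    (h := fun y => g y - g p - d1 p (y - p) - (1/2 : ℝ) • d2 p (y - p) (y - p)
      - (1/6 : ℝ) * d3 p (y - p) (y - p) (y - p))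
    (h' := fun y => d1 y - d1 p - d2 p (y - p) - (1/2 : ℝ) • d3 p (y - p) (y - p)) (by positivity) (by simp)
    (fun y hy _ => ((((f0 y hy).sub_const _).sub (lin_hasFDerivAt _ p y).hasFDerivWithinAt).sub
      (quad_hasFDerivAt' _ (s2 p hp) p y).hasFDerivWithinAt).sub
      (cubic_hasFDerivAt _ s3 s3' p y).hasFDerivWithinAt)
    (fun y hy hyr => (k1 y hy (by linarith)).trans (le_of_eq (by ring)))
  · refine ⟨d3 p, s2 p hp, (n1 p hp).trans (by linarith), (n2 p hp).trans (by linarith),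
      (n3 p hp).trans (by linarith), fun y hy hyr => ?_⟩
    have := k0 y hy (by linarith)
    rw [Real.norm_eq_abs] at this
    refine (le_of_eq ?_).trans (this.trans (le_of_eq (by ring)))
    rfl
  all_goals linarith

end PartPC3

section PartPE1
set_option maxSynthPendingDepth 3
/-- multiplication by `I` -/
def Jm : Cn n →L[ℝ] Cn n := (I • ContinuousLinearMap.id ℂ (Cn n)).restrictScalars ℝ

theorem Jm_apply (x : Cn n) : Jm x = I • x := by simp [Jm]

theorem norm_I_smul (x : Cn n) : ‖I • x‖ = ‖x‖ := by rw [norm_smul]; simp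

/-- Hermitian part -/
def Hf (g : Cn n →L[ℝ] Cn n →L[ℝ] ℝ) (x y : Cn n) : ℝ := (g x y + g (I • x) (I • y)) / 4
/-- complex bilinear part -/
def Bf (g : Cn n →L[ℝ] Cn n →L[ℝ] ℝ) (x y : Cn n) : ℝ := (g x y - g (I • x) (I • y)) / 4

/-- Hermitian part as a linear form -/
def HfL (g : Cn n →L[ℝ] Cn n →L[ℝ] ℝ) (x : Cn n) : Cn n →L[ℝ] ℝ :=
  (1/4 : ℝ) • (g x + (g (I • x)).comp Jm)

theorem HfL_apply (g : Cn n →L[ℝ] Cn n →L[ℝ] ℝ) (x y : Cn n) : HfL g x y = Hf g x y := by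
  simp [HfL, Hf, Jm_apply]; ring

section forms
variable (g : Cn n →L[ℝ] Cn n →L[ℝ] ℝ)

theorem Hf_add_left (x x' y : Cn n) : Hf g (x + x') y = Hf g x y + Hf g x' y := by
  simp [Hf]; ring
theorem Hf_add_right (x y y' : Cn n) : Hf g x (y + y') = Hf g x y + Hf g x y' := by
  simp [Hf]; ring
theorem Bf_add_left (x x' y : Cn n) : Bf g (x + x') y = Bf g x y + Bf g x' y := by
  simp [Bf]; ring
theorem Bf_add_right (x y y' : Cn n) : Bf g x (y + y') = Bf g x y + Bf g x y' := by
  simp [Bf]; ring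

theorem Hf_bound {M : ℝ} (hM : ‖g‖ ≤ M) (x y : Cn n) : |Hf g x y| ≤ M / 2 * ‖x‖ * ‖y‖ := by
  have h1 := g.le_opNorm₂ x y
  have h2 := g.le_opNorm₂ (I • x) (I • y)
  rw [norm_I_smul, norm_I_smul] at h2
  rw [Real.norm_eq_abs] at h1 h2
  have h3 : ‖g‖ * ‖x‖ * ‖y‖ ≤ M * ‖x‖ * ‖y‖ := by gcongr
  unfold Hf
  rw [abs_div, abs_of_pos (by norm_num : (0:ℝ) < 4)]
  have := abs_add_le (g x y) (g (I • x) (I • y))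
  linarith

theorem Bf_bound {M : ℝ} (hM : ‖g‖ ≤ M) (x y : Cn n) : |Bf g x y| ≤ M / 2 * ‖x‖ * ‖y‖ := by
  have h1 := g.le_opNorm₂ x y
  have h2 := g.le_opNorm₂ (I • x) (I • y)
  rw [norm_I_smul, norm_I_smul] at h2
  rw [Real.norm_eq_abs] at h1 h2
  have h3 : ‖g‖ * ‖x‖ * ‖y‖ ≤ M * ‖x‖ * ‖y‖ := by gcongr
  unfold Bf
  rw [abs_div, abs_of_pos (by norm_num : (0:ℝ) < 4)]
  have := abs_sub (g x y) (g (I • x) (I • y))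
  linarith

theorem HfL_norm {M : ℝ} (hM : ‖g‖ ≤ M) (x : Cn n) : ‖HfL g x‖ ≤ M / 2 * ‖x‖ := by
  have : 0 ≤ M := (norm_nonneg _).trans hM
  refine (HfL g x).opNorm_le_bound (by positivity) fun y => ?_
  rw [HfL_apply, Real.norm_eq_abs]
  exact Hf_bound g hM x y

theorem half_eq (x : Cn n) : (1/2) * g x x = Bf g x x + Hf g x x := by unfold Bf Hf; ring

theorem Hf_symm (hg : ∀ a b, g a b = g b a) (x y : Cn n) : Hf g x y = Hf g y x := by
  unfold Hf; rw [hg x y, hg (I • x)]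

theorem Hf_smul (c : ℂ) (x y : Cn n) : Hf g (c • x) y = Hf g x (star c • y) := by
  rw [smul_real_form c, smul_real_form (star c)]
  unfold Hf
  simp only [smul_add, I_smul_real_smul, I_smul_I_smul, map_add, map_smul, map_neg,
    add_apply, smul_apply, neg_apply, smul_eq_mul]
  simp
  ring

theorem Hf_smul_smul (c : ℂ) (x : Cn n) : Hf g (c • x) (c • x) = ‖c‖ ^ 2 * Hf g x x := by
  rw [← Complex.normSq_eq_norm_sq, Complex.normSq_apply]
  rw [smul_real_form c]
  unfold Hf
  simp only [smul_add, I_smul_real_smul, I_smul_I_smul, map_add, map_smul, map_neg,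
    add_apply, smul_apply, neg_apply, smul_eq_mul]
  ring

/-- complex bilinear form at `ξ` -/
def qF (ξ : Cn n) : ℂ := (Bf g ξ ξ : ℂ) - I * (Bf g (I • ξ) ξ : ℂ)

theorem Bf_smul_smul (hg : ∀ a b, g a b = g b a) (c : ℂ) (x : Cn n) :
    Bf g (c • x) (c • x) = (c ^ 2 * qF g x).re := by
  rw [smul_real_form c]
  unfold qF Bf
  simp only [smul_add, I_smul_real_smul, I_smul_I_smul, map_add, map_smul, map_neg,
    add_apply, smul_apply, neg_apply, smul_eq_mul]
  rw [hg x (I • x)]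
  simp [pow_two]
  ring

theorem qF_bound {M : ℝ} (hM : ‖g‖ ≤ M) {ξ : Cn n} (hξ : ‖ξ‖ = 1) : ‖qF g ξ‖ ≤ M := by
  unfold qF
  refine (norm_sub_le _ _).trans ?_
  have h1 := Bf_bound g hM ξ ξ
  have h2 := Bf_bound g hM (I • ξ) ξ
  rw [norm_I_smul, hξ] at h2
  rw [hξ] at h1
  rw [norm_mul, Complex.norm_I, Complex.norm_real, Complex.norm_real, Real.norm_eq_abs, Real.norm_eq_abs]
  linarith
end forms

/-- the vector `k` -/
def kV (l : Cn n →L[ℝ] ℝ) (g : Cn n →L[ℝ] Cn n →L[ℝ] ℝ) (ξ : Cn n) : Cn n :=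
  (qF g ξ / ((‖cgrad l‖ ^ 2 : ℝ) : ℂ)) • cgrad l

/-- the map `W` -/
def WV (ξ k x : Cn n) : Cn n := x - (inner ℂ ξ x) • ξ + (inner ℂ ξ x) ^ 2 • k

/-- `Re P` -/
def PF (l : Cn n →L[ℝ] ℝ) (g : Cn n →L[ℝ] Cn n →L[ℝ] ℝ) (x : Cn n) : ℝ := l x + Bf g x x

theorem s_bound {ξ : Cn n} (hξ : ‖ξ‖ = 1) (x : Cn n) : ‖(inner ℂ ξ x : ℂ)‖ ≤ ‖x‖ := by
  have := norm_inner_le_norm (𝕜 := ℂ) ξ x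
  rwa [hξ, one_mul] at this

theorem kV_bound {l : Cn n →L[ℝ] ℝ} {g : Cn n →L[ℝ] Cn n →L[ℝ] ℝ} {ξ : Cn n} {M m : ℝ}
    (hM : ‖g‖ ≤ M) (hm : 0 < m) (hN : m ≤ ‖cgrad l‖) (hξ : ‖ξ‖ = 1) : ‖kV l g ξ‖ ≤ M / m := by
  have hNp : 0 < ‖cgrad l‖ := hm.trans_le hN
  have hq := qF_bound g hM hξ
  unfold kV
  rw [norm_smul, norm_div, Complex.norm_real, Real.norm_of_nonneg (by positivity)]
  have : ‖qF g ξ‖ / ‖cgrad l‖ ^ 2 * ‖cgrad l‖ = ‖qF g ξ‖ / ‖cgrad l‖ := by field_simp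
  rw [this]
  gcongr
  exact (norm_nonneg _).trans hM

theorem inner_xi_N {l : Cn n →L[ℝ] ℝ} {ξ : Cn n} (h : inner ℂ (cgrad l) ξ = 0) : inner ℂ ξ (cgrad l) = 0 := by
  rw [← inner_conj_symm, h]; simp

theorem inner_xi_k {l : Cn n →L[ℝ] ℝ} (g : Cn n →L[ℝ] Cn n →L[ℝ] ℝ) {ξ : Cn n} (h : inner ℂ (cgrad l) ξ = 0) :
    inner ℂ ξ (kV l g ξ) = 0 := by
  unfold kV; rw [inner_smul_right, inner_xi_N h, mul_zero]

theorem inner_self_one {ξ : Cn n} (hξ : ‖ξ‖ = 1) : inner ℂ ξ ξ = 1 := by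
  rw [inner_self_eq_norm_sq_to_K, hξ]; simp

theorem inner_xi_W {ξ k : Cn n} (hξ : ‖ξ‖ = 1) (hk : inner ℂ ξ k = 0) (x : Cn n) :
    inner ℂ ξ (WV ξ k x) = 0 := by
  unfold WV
  rw [inner_add_right, inner_sub_right, inner_smul_right, inner_smul_right, hk, inner_self_one hξ]
  ring

theorem inner_N_W {l : Cn n →L[ℝ] ℝ} (g : Cn n →L[ℝ] Cn n →L[ℝ] ℝ) {ξ : Cn n}
    (h : inner ℂ (cgrad l) ξ = 0) (hN : 0 < ‖cgrad l‖) (x : Cn n) :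
    inner ℂ (cgrad l) (WV ξ (kV l g ξ) x) = inner ℂ (cgrad l) x + (inner ℂ ξ x) ^ 2 * qF g ξ := by
  unfold WV kV
  rw [inner_add_right, inner_sub_right, inner_smul_right, inner_smul_right, inner_smul_right, h,
    inner_self_eq_norm_sq_to_K]
  have : ((‖cgrad l‖ : ℝ) : ℂ) ≠ 0 := by exact_mod_cast hN.ne'
  push_cast
  simp only [Complex.coe_algebraMap]
  field_simp
  ring

/-- local hypotheses on `ρ` at `p`, in terms of Taylor coefficients -/
structure EH (M m μ : ℝ) (l : Cn n →L[ℝ] ℝ) (g : Cn n →L[ℝ] Cn n →L[ℝ] ℝ)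
    (g3 : Cn n →L[ℝ] Cn n →L[ℝ] Cn n →L[ℝ] ℝ) (ξ : Cn n) : Prop where
  M1 : 1 ≤ M
  m0 : 0 < m
  m1 : m ≤ 1
  μ0 : 0 < μ
  μ1 : μ ≤ 1
  symm : ∀ a b, g a b = g b a
  b1 : ‖l‖ ≤ M
  b2 : ‖g‖ ≤ M
  b3 : ‖g3‖ ≤ M
  N : m ≤ ‖cgrad l‖
  levi : ∀ e, μ * ‖e‖ ^ 2 ≤ 4 * Hf g e e
  xi : ‖ξ‖ = 1
  tan : inner ℂ (cgrad l) ξ = 0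

theorem tri_bound {g3 : Cn n →L[ℝ] Cn n →L[ℝ] Cn n →L[ℝ] ℝ} {M : ℝ} (hM : ‖g3‖ ≤ M) (a b c : Cn n) :
    |g3 a b c| ≤ M * ‖a‖ * ‖b‖ * ‖c‖ := by
  have h1 := (g3 a b).le_opNorm c
  have h2 := g3.le_opNorm₂ a b
  rw [Real.norm_eq_abs] at h1
  refine h1.trans ?_
  have : ‖g3‖ * ‖a‖ * ‖b‖ ≤ M * ‖a‖ * ‖b‖ := by gcongr
  exact mul_le_mul_of_nonneg_right (h2.trans this) (norm_nonneg c)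

namespace EH
variable {M m μ : ℝ} {l : Cn n →L[ℝ] ℝ} {g : Cn n →L[ℝ] Cn n →L[ℝ] ℝ}
    {g3 : Cn n →L[ℝ] Cn n →L[ℝ] Cn n →L[ℝ] ℝ} {ξ : Cn n}

theorem w_le (h : EH M m μ l g g3 ξ) (x : Cn n) :
    ‖x - (inner ℂ ξ x : ℂ) • ξ‖ ≤ ‖WV ξ (kV l g ξ) x‖ + M / m * ‖x‖ ^ 2 := by
  have e : x - (inner ℂ ξ x : ℂ) • ξ = WV ξ (kV l g ξ) x - (inner ℂ ξ x : ℂ) ^ 2 • kV l g ξ := by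
    unfold WV; abel
  rw [e]
  refine (norm_sub_le _ _).trans ?_
  rw [norm_smul, norm_pow]
  have h1 := s_bound h.xi x
  have h2 := kV_bound (l := l) h.b2 h.m0 h.N h.xi
  have : ‖(inner ℂ ξ x : ℂ)‖ ^ 2 * ‖kV l g ξ‖ ≤ ‖x‖ ^ 2 * (M / m) := by gcongr
  linarith

/-- `Re P - l(W)` -/
theorem P_W (h : EH M m μ l g g3 ξ) (x : Cn n) :
    |PF l g x - l (WV ξ (kV l g ξ) x)| ≤ M * ‖x‖ * ‖x - (inner ℂ ξ x : ℂ) • ξ‖ := by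
  set s : ℂ := inner ℂ ξ x with hs
  set w := x - s • ξ with hw
  have hx : x = s • ξ + w := by rw [hw]; abel
  have e1 : l (WV ξ (kV l g ξ) x) = l x + Bf g (s • ξ) (s • ξ) := by
    rw [← re_inner_cgrad, inner_N_W g h.tan (h.m0.trans_le h.N), Complex.add_re, re_inner_cgrad,
      Bf_smul_smul g h.symm]
  have e2 : Bf g x x = Bf g (s • ξ) (s • ξ) + Bf g (s • ξ) w + Bf g w x := by
    have q1 : Bf g x x = Bf g (s • ξ) x + Bf g w x := by
      rw [← Bf_add_left, ← hx]
    have q2 : Bf g (s • ξ) x = Bf g (s • ξ) (s • ξ) + Bf g (s • ξ) w := by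
      rw [← Bf_add_right, ← hx]
    rw [q1, q2]
  have e3 : PF l g x - l (WV ξ (kV l g ξ) x) = Bf g (s • ξ) w + Bf g w x := by
    unfold PF; rw [e1, e2]; ring
  rw [e3]
  have b1 := Bf_bound g h.b2 (s • ξ) w
  have b2 := Bf_bound g h.b2 w x
  have b3 : ‖s • ξ‖ ≤ ‖x‖ := by rw [norm_smul, h.xi, mul_one]; exact s_bound h.xi x
  have hM := h.M1
  have b4 : M / 2 * ‖s • ξ‖ * ‖w‖ ≤ M / 2 * ‖x‖ * ‖w‖ := by gcongr
  refine (abs_add_le _ _).trans ?_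
  linarith

theorem P_upper (h : EH M m μ l g g3 ξ) {x : Cn n} (hx : ‖x‖ ≤ m * μ / (16 * M ^ 2))
    (hρ : l x + (1/2) * g x x + (1/6) * g3 x x x ≤ M * ‖x‖ ^ 4) :
    PF l g x ≤ - (μ / 8) * ‖x‖ ^ 2 := by
  have h1 := half_eq g x
  have h2 := h.levi x
  have h3 := (abs_le.1 (tri_bound h.b3 x x x)).1
  have hM := h.M1
  have hm := h.m0
  have hμ := h.μ0
  have hx1 : ‖x‖ * (16 * M ^ 2) ≤ m * μ := by rwa [le_div_iff₀ (by positivity)] at hx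
  have hxM : 16 * (M * ‖x‖) ≤ μ := by
    have e1 : M * ‖x‖ ≤ M ^ 2 * ‖x‖ := by
      have := norm_nonneg x
      have : M ≤ M ^ 2 := by nlinarith
      gcongr
    have e2 : m * μ ≤ μ := by nlinarith [h.m1]
    linarith
  have hx2 : ‖x‖ ≤ 1 := by
    have := norm_nonneg x
    have := h.μ1
    nlinarith
  have e3 : M * ‖x‖ ^ 4 ≤ (μ / 16) * ‖x‖ ^ 2 := by
    have : M * ‖x‖ ^ 2 ≤ μ / 16 := by nlinarith [norm_nonneg x]
    calc M * ‖x‖ ^ 4 = (M * ‖x‖ ^ 2) * ‖x‖ ^ 2 := by ring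
      _ ≤ _ := by gcongr
  have e4 : M * ‖x‖ * ‖x‖ * ‖x‖ ≤ (μ / 16) * ‖x‖ ^ 2 := by
    calc M * ‖x‖ * ‖x‖ * ‖x‖ = (M * ‖x‖) * ‖x‖ ^ 2 := by ring
      _ ≤ _ := by gcongr; linarith
  have : 0 ≤ μ * ‖x‖ ^ 2 := by positivity
  unfold PF
  nlinarith

theorem x_sq_le (h : EH M m μ l g g3 ξ) {x : Cn n} (hx : ‖x‖ ≤ m * μ / (16 * M ^ 2))
    (hρ : l x + (1/2) * g x x + (1/6) * g3 x x x ≤ M * ‖x‖ ^ 4) :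
    ‖x‖ ^ 2 ≤ 32 * M / μ * ‖WV ξ (kV l g ξ) x‖ := by
  have h1 := h.P_upper hx hρ
  have h2 := (abs_le.1 (h.P_W x)).1
  have h3 := h.w_le x
  have h4 : |l (WV ξ (kV l g ξ) x)| ≤ M * ‖WV ξ (kV l g ξ) x‖ := by
    have := l.le_opNorm (WV ξ (kV l g ξ) x)
    rw [Real.norm_eq_abs] at this
    exact this.trans (by gcongr; exact h.b1)
  have h5 := (abs_le.1 h4).1
  have hM := h.M1
  have hm := h.m0
  have hμ := h.μ0
  set X := ‖x‖
  set W := ‖WV ξ (kV l g ξ) x‖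
  have hX : 0 ≤ X := norm_nonneg x
  have hW : 0 ≤ W := norm_nonneg _
  have hx1 : X * (16 * M ^ 2) ≤ m * μ := by rwa [le_div_iff₀ (by positivity)] at hx
  have hx2 : X ≤ 1 := by
    have := h.μ1
    have := h.m1
    nlinarith
  have e1 : M * X * ‖x - (inner ℂ ξ x : ℂ) • ξ‖ ≤ M * X * (W + M / m * X ^ 2) := by gcongr
  have e2 : M * X * (M / m * X ^ 2) ≤ μ / 16 * X ^ 2 := by
    have : M * X * (M / m) ≤ μ / 16 := by
      rw [mul_div_assoc', div_le_div_iff₀ hm (by norm_num)]; nlinarith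
    calc M * X * (M / m * X ^ 2) = (M * X * (M / m)) * X ^ 2 := by ring
      _ ≤ _ := by gcongr
  have e3 : M * X * W ≤ M * W := by
    have : M * X ≤ M * 1 := by gcongr
    nlinarith
  rw [div_mul_eq_mul_div, le_div_iff₀ hμ]
  nlinarith

end EH

end PartPE1

section PartPE2
set_option maxSynthPendingDepth 3
theorem cubic_split {g3 : Cn n →L[ℝ] Cn n →L[ℝ] Cn n →L[ℝ] ℝ} {M : ℝ} (hM : ‖g3‖ ≤ M) {ξ : Cn n}
    (hξ : ‖ξ‖ = 1) : ∃ A b : ℂ, ‖A‖ ≤ M ∧ ‖b‖ ≤ M ∧ ∀ s : ℂ,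
      (1/6) * g3 (s • ξ) (s • ξ) (s • ξ) = (A * s ^ 3).re + (b * s).re * ‖s‖ ^ 2 := by
  have hb : ∀ a b c : Cn n, ‖a‖ = 1 → ‖b‖ = 1 → ‖c‖ = 1 → |g3 a b c| ≤ M := by
    intro a b c ha hb hc
    have := tri_bound hM a b c
    rw [ha, hb, hc] at this; linarith
  have hI : ‖I • ξ‖ = 1 := by rw [norm_I_smul, hξ]
  have h0 := abs_le.1 (hb _ _ _ hξ hξ hξ)
  have h1 := abs_le.1 (hb _ _ _ hI hξ hξ)
  have h2 := abs_le.1 (hb _ _ _ hξ hI hξ)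
  have h3 := abs_le.1 (hb _ _ _ hξ hξ hI)
  have h4 := abs_le.1 (hb _ _ _ hI hI hξ)
  have h5 := abs_le.1 (hb _ _ _ hI hξ hI)
  have h6 := abs_le.1 (hb _ _ _ hξ hI hI)
  have h7 := abs_le.1 (hb _ _ _ hI hI hI)
  obtain ⟨c0, hc0⟩ : ∃ c, c = g3 ξ ξ ξ / 6 := ⟨_, rfl⟩
  obtain ⟨c1, hc1⟩ : ∃ c, c = (g3 (I • ξ) ξ ξ + g3 ξ (I • ξ) ξ + g3 ξ ξ (I • ξ)) / 6 := ⟨_, rfl⟩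
  obtain ⟨c2, hc2⟩ : ∃ c, c = (g3 (I • ξ) (I • ξ) ξ + g3 (I • ξ) ξ (I • ξ) + g3 ξ (I • ξ) (I • ξ)) / 6 := ⟨_, rfl⟩
  obtain ⟨c3, hc3⟩ : ∃ c, c = g3 (I • ξ) (I • ξ) (I • ξ) / 6 := ⟨_, rfl⟩
  refine ⟨⟨(c0 - c2) / 4, (c3 - c1) / 4⟩, ⟨(3 * c0 + c2) / 4, -(c1 + 3 * c3) / 4⟩, ?_, ?_, ?_⟩
  · refine (Complex.norm_le_abs_re_add_abs_im _).trans ?_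
    have e1 : |(c0 - c2) / 4| ≤ M / 2 := by rw [abs_le]; constructor <;> linarith
    have e2 : |(c3 - c1) / 4| ≤ M / 2 := by rw [abs_le]; constructor <;> linarith
    simp only
    linarith
  · refine (Complex.norm_le_abs_re_add_abs_im _).trans ?_
    have e1 : |(3 * c0 + c2) / 4| ≤ M / 2 := by rw [abs_le]; constructor <;> linarith
    have e2 : |-(c1 + 3 * c3) / 4| ≤ M / 2 := by rw [abs_le]; constructor <;> linarith
    simp only
    linarith
  · intro s
    obtain ⟨a, b⟩ := s
    rw [← Complex.normSq_eq_norm_sq, Complex.normSq_apply, smul_real_form]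
    simp only [map_add, map_smul, add_apply, smul_apply, smul_eq_mul, pow_succ, pow_zero, one_mul,
      Complex.mul_re, Complex.mul_im]
    have e : (1 / 6 : ℝ) * (a * (a * (a * g3 ξ ξ ξ + b * g3 ξ ξ (I • ξ)) + b * (a * g3 ξ (I • ξ) ξ + b * g3 ξ (I • ξ) (I • ξ)))
      + b * (a * (a * g3 (I • ξ) ξ ξ + b * g3 (I • ξ) ξ (I • ξ)) + b * (a * g3 (I • ξ) (I • ξ) ξ + b * g3 (I • ξ) (I • ξ) (I • ξ))))
      = c0 * a ^ 3 + c1 * a ^ 2 * b + c2 * a * b ^ 2 + c3 * b ^ 3 := by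
      rw [hc0, hc1, hc2, hc3]; ring
    have e' : c0 * a ^ 3 + c1 * a ^ 2 * b + c2 * a * b ^ 2 + c3 * b ^ 3 =
      (c0 - c2) / 4 * (a * a * a - b * b * a - (a * b + b * a) * b) -
       (c3 - c1) / 4 * ((a * a - b * b) * b + (a * b + b * a) * a) +
       ((3 * c0 + c2) / 4 * a - -(c1 + 3 * c3) / 4 * b) * (a * a + b * b) := by ring
    linear_combination e + e'

theorem tri_diff {g3 : Cn n →L[ℝ] Cn n →L[ℝ] Cn n →L[ℝ] ℝ} {M : ℝ} (hM : ‖g3‖ ≤ M) {x y w : Cn n}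
    (hx : x = y + w) (hy : ‖y‖ ≤ ‖x‖) : |g3 x x x - g3 y y y| ≤ 3 * M * ‖w‖ * ‖x‖ ^ 2 := by
  have e : g3 x x x - g3 y y y = g3 w x x + g3 y w x + g3 y y w := by
    have e1 : g3 x x x = g3 y x x + g3 w x x := by
      conv_lhs => rw [show g3 x = g3 y + g3 w by rw [← map_add, ← hx]]
      simp
    have e2 : g3 y x x = g3 y y x + g3 y w x := by
      conv_lhs => rw [show g3 y x = g3 y y + g3 y w by rw [← map_add, ← hx]]
      simp
    have e3 : g3 y y x = g3 y y y + g3 y y w := by rw [← map_add, ← hx]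
    rw [e1, e2, e3]; ring
  have hM0 : 0 ≤ M := (norm_nonneg _).trans hM
  have h1 := tri_bound hM w x x
  have h2 := tri_bound hM y w x
  have h3 := tri_bound hM y y w
  have h4 : M * ‖y‖ * ‖w‖ * ‖x‖ ≤ M * ‖x‖ * ‖w‖ * ‖x‖ := by gcongr
  have h5 : M * ‖y‖ * ‖y‖ * ‖w‖ ≤ M * ‖x‖ * ‖x‖ * ‖w‖ := by gcongr
  rw [e]
  have := abs_add_three (g3 w x x) (g3 y w x) (g3 y y w)
  nlinarith

theorem Hf_split (g : Cn n →L[ℝ] Cn n →L[ℝ] ℝ) (hg : ∀ a b, g a b = g b a) (s : ℂ) (ξ w : Cn n) :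
    Hf g (s • ξ + w) (s • ξ + w) = ‖s‖ ^ 2 * Hf g ξ ξ + 2 * Hf g (s • ξ) w + Hf g w w := by
  rw [Hf_add_left, Hf_add_right, Hf_add_right, Hf_smul_smul, Hf_symm g hg w (s • ξ)]; ring

theorem w_le_x {ξ : Cn n} (hξ : ‖ξ‖ = 1) (x : Cn n) : ‖x - (inner ℂ ξ x : ℂ) • ξ‖ ≤ 2 * ‖x‖ := by
  refine (norm_sub_le _ _).trans ?_
  rw [norm_smul, hξ]
  have := s_bound hξ x
  linarith

namespace EH
variable {M m μ : ℝ} {l : Cn n →L[ℝ] ℝ} {g : Cn n →L[ℝ] Cn n →L[ℝ] ℝ}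
    {g3 : Cn n →L[ℝ] Cn n →L[ℝ] Cn n →L[ℝ] ℝ} {ξ : Cn n}

/-- `l0 |s|^2 = - l(W) + E` on the boundary -/
theorem s_sq (h : EH M m μ l g g3 ξ) {x : Cn n} (hx : ‖x‖ ≤ 1)
    (hρ : |l x + (1/2) * g x x + (1/6) * g3 x x x| ≤ M * ‖x‖ ^ 4) :
    |Hf g ξ ξ * ‖(inner ℂ ξ x : ℂ)‖ ^ 2 + l (WV ξ (kV l g ξ) x)| ≤
      4 * M * ‖x‖ * (‖x - (inner ℂ ξ x : ℂ) • ξ‖ + ‖x‖ ^ 2) := by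
  set s : ℂ := inner ℂ ξ x with hs
  set w := x - s • ξ with hw
  have hxw : x = s • ξ + w := by rw [hw]; abel
  have h1 := Hf_split g h.symm s ξ w
  rw [← hxw] at h1
  have h2 := h.P_W x
  rw [← hs, ← hw] at h2
  have h3 := half_eq g x
  have h4 := tri_bound h.b3 x x x
  have h5 := Hf_bound g h.b2 (s • ξ) w
  have h6 := Hf_bound g h.b2 w w
  have hsx : ‖s • ξ‖ ≤ ‖x‖ := by rw [norm_smul, h.xi, mul_one]; exact s_bound h.xi x
  have hwx : ‖w‖ ≤ 2 * ‖x‖ := w_le_x h.xi x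
  have hM := h.M1
  have h5' : M / 2 * ‖s • ξ‖ * ‖w‖ ≤ M / 2 * ‖x‖ * ‖w‖ := by gcongr
  have h6' : M / 2 * ‖w‖ * ‖w‖ ≤ M / 2 * (2 * ‖x‖) * ‖w‖ := by gcongr
  have h7 : M * ‖x‖ ^ 4 ≤ M * ‖x‖ ^ 3 := by
    have : ‖x‖ ^ 4 ≤ ‖x‖ ^ 3 := pow_le_pow_of_le_one (norm_nonneg _) hx (by norm_num)
    gcongr
  unfold PF at h2
  have h8 : 0 ≤ M * ‖x‖ ^ 3 := by positivity
  rw [abs_le] at *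
  constructor <;> nlinarith

end EH

end PartPE2

section PartPE3
set_option maxSynthPendingDepth 3
/-- the pluriharmonic part of the barrier -/
def F0 (l p1 : Cn n →L[ℝ] ℝ) (p2 : Cn n →L[ℝ] Cn n →L[ℝ] ℝ) (ξ k : Cn n) (A c : ℂ) (x : Cn n) : ℝ :=
  p1 x + Bf p2 x x + (A * (inner ℂ ξ x) ^ 3).re + (c * inner ℂ ξ x * inner ℂ (cgrad l) (WV ξ k x)).re

def K2 (M m μ : ℝ) : ℝ := 1 + M / m * (32 * M / μ)
def Kb (M m : ℝ) : ℝ := 2 * M ^ 2 / m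
def Kc (M m μ : ℝ) : ℝ := 2 * Kb M m / μ
def Kg (M m μ : ℝ) : ℝ := 2 * (M + Kc M m μ * M)
def K3 (M m μ : ℝ) : ℝ := (2 * M + 32 * M * Kb M m / μ) * K2 M m μ ^ 2

namespace EH
variable {M m μ : ℝ} {l : Cn n →L[ℝ] ℝ} {g : Cn n →L[ℝ] Cn n →L[ℝ] ℝ}
    {g3 : Cn n →L[ℝ] Cn n →L[ℝ] Cn n →L[ℝ] ℝ} {ξ : Cn n}

theorem x_sq_le2 (h : EH M m μ l g g3 ξ) {x : Cn n} (hx : ‖x‖ ≤ m * μ / (16 * M ^ 2))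
    (hρ : l x + (1/2) * g x x + (1/6) * g3 x x x ≤ M * ‖x‖ ^ 4) :
    ‖x‖ ^ 2 ≤ K2 M m μ * ‖WV ξ (kV l g ξ) x‖ ∧
    ‖x - (inner ℂ ξ x : ℂ) • ξ‖ ≤ K2 M m μ * ‖WV ξ (kV l g ξ) x‖ := by
  have h1 := h.x_sq_le hx hρ
  have h2 := h.w_le x
  have hM := h.M1
  have hm := h.m0
  have hμ := h.μ0
  have hMm : 1 ≤ M / m := by rw [le_div_iff₀ hm]; linarith [h.m1]
  have hW := norm_nonneg (WV ξ (kV l g ξ) x)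
  have hC : 0 ≤ 32 * M / μ := by positivity
  constructor
  · refine h1.trans ?_
    unfold K2
    gcongr
    nlinarith
  · have : M / m * ‖x‖ ^ 2 ≤ M / m * (32 * M / μ * ‖WV ξ (kV l g ξ) x‖) := by gcongr
    unfold K2
    nlinarith

theorem x_le_one (h : EH M m μ l g g3 ξ) {x : Cn n} (hx : ‖x‖ ≤ m * μ / (16 * M ^ 2)) : ‖x‖ ≤ 1 := by
  have hM := h.M1
  refine hx.trans ?_
  rw [div_le_one (by positivity)]
  have := h.m0; have := h.m1; have := h.μ0; have := h.μ1
  nlinarith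

theorem EB (h : EH M m μ l g g3 ξ) (p1 : Cn n →L[ℝ] ℝ) (p2 : Cn n →L[ℝ] Cn n →L[ℝ] ℝ)
    (p3 : Cn n →L[ℝ] Cn n →L[ℝ] Cn n →L[ℝ] ℝ) (hs2 : ∀ a b, p2 a b = p2 b a)
    (hb2 : ‖p2‖ ≤ M) (hb3 : ‖p3‖ ≤ M) (h0 : Hf p2 ξ ξ = 0) :
    ∃ (A c : ℂ) (gv : Cn n), ‖A‖ ≤ M ∧ ‖c‖ ≤ Kc M m μ ∧ ‖gv‖ ≤ Kg M m μ ∧ inner ℂ ξ gv = 0 ∧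
    ∀ x, ‖x‖ ≤ m * μ / (16 * M ^ 2) →
      |l x + (1/2) * g x x + (1/6) * g3 x x x| ≤ M * ‖x‖ ^ 4 →
      p1 x + (1/2) * p2 x x + (1/6) * p3 x x x + M * ‖x‖ ^ 4 ≤
        F0 l p1 p2 ξ (kV l g ξ) A c x +
          (star (inner ℂ ξ x : ℂ) * inner ℂ gv (WV ξ (kV l g ξ) x)).re +
          K3 M m μ * ‖WV ξ (kV l g ξ) x‖ ^ 2 := by
  have hM := h.M1
  have hm := h.m0
  have hμ := h.μ0
  obtain ⟨A, b0, hA, hb0, hc⟩ := cubic_split hb3 h.xi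
  set k := kV l g ξ with hk
  set gh := cgrad (HfL p2 ξ) with hgh
  obtain ⟨b, hb⟩ : ∃ b : ℂ, b = b0 - 2 * inner ℂ gh k := ⟨_, rfl⟩
  have hghb : ‖gh‖ ≤ M / 2 := by
    have := (cgrad_le_norm (HfL p2 ξ)).trans (HfL_norm p2 hb2 ξ)
    rw [h.xi] at this; linarith
  have hkb : ‖k‖ ≤ M / m := kV_bound h.b2 h.m0 h.N h.xi
  have hbb : ‖b‖ ≤ Kb M m := by
    rw [hb]
    refine (norm_sub_le _ _).trans ?_
    rw [norm_mul]
    have h1 := norm_inner_le_norm (𝕜 := ℂ) gh k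
    have h2 : ‖gh‖ * ‖k‖ ≤ M / 2 * (M / m) := by gcongr
    have h3 : M ≤ M ^ 2 / m := by rw [le_div_iff₀ hm]; nlinarith [h.m1]
    have h4 : M / 2 * (M / m) = M ^ 2 / m / 2 := by ring
    unfold Kb
    rw [mul_div_assoc]
    simp only [Complex.norm_ofNat]
    linarith
  obtain ⟨l0, hl0⟩ : ∃ l0, l0 = Hf g ξ ξ := ⟨_, rfl⟩
  have hl0b : μ / 4 ≤ l0 := by
    have := h.levi ξ
    rw [h.xi] at this; linarith
  have hl0p : 0 < l0 := by linarith
  obtain ⟨c, hcd⟩ : ∃ c : ℂ, c = -(((1 / (2 * l0) : ℝ) : ℂ) * b) := ⟨_, rfl⟩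
  have hβ : 0 ≤ Kb M m := by unfold Kb; positivity
  have hcb : ‖c‖ ≤ Kc M m μ := by
    rw [hcd, norm_neg, norm_mul, Complex.norm_real, Real.norm_of_nonneg (by positivity)]
    unfold Kc
    calc 1 / (2 * l0) * ‖b‖ ≤ 1 / (2 * (μ / 4)) * Kb M m := by gcongr
      _ = _ := by field_simp; ring
  have hKc : 0 ≤ Kc M m μ := (norm_nonneg _).trans hcb
  set N := cgrad l with hN
  have hNb : ‖N‖ ≤ M := (cgrad_le_norm l).trans h.b1
  obtain ⟨gt, hgt⟩ : ∃ gt : Cn n, gt = (2 : ℂ) • gh + (star (star c)) • N := ⟨_, rfl⟩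
  rw [star_star] at hgt
  have hgtb : ‖gt‖ ≤ M + Kc M m μ * M := by
    rw [hgt]
    refine (norm_add_le _ _).trans ?_
    rw [norm_smul, norm_smul]
    have : ‖c‖ * ‖N‖ ≤ Kc M m μ * M := by gcongr
    simp only [Complex.norm_ofNat]
    linarith
  refine ⟨A, c, gt - (inner ℂ ξ gt : ℂ) • ξ, hA, hcb, ?_, ?_, ?_⟩
  · refine (w_le_x h.xi gt).trans ?_
    unfold Kg; linarith
  · rw [inner_sub_right, inner_smul_right, inner_self_one h.xi]; ring
  intro x hx hρ
  have hx1 := h.x_le_one hx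
  have hS := h.s_sq hx1 hρ
  obtain ⟨hX, hw⟩ := h.x_sq_le2 hx (le_of_abs_le hρ)
  have hxiW : inner ℂ ξ (WV ξ k x) = 0 := inner_xi_W h.xi (inner_xi_k g h.tan) x
  rw [← hk, ← hl0] at hS
  rw [← hk] at hX hw
  set s : ℂ := inner ℂ ξ x with hs
  obtain ⟨w, hwd⟩ : ∃ w, w = x - s • ξ := ⟨_, rfl⟩
  rw [← hwd] at hS hw
  have hxw : x = s • ξ + w := by rw [hwd]; abel
  obtain ⟨W, hWd⟩ : ∃ W, W = WV ξ k x := ⟨_, rfl⟩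
  rw [← hWd] at hS hX hw hxiW
  have hWw : w = W - s ^ 2 • k := by rw [hwd, hWd]; unfold WV; rw [← hs]; abel
  -- hermitian part of ψ
  have e1 := Hf_split p2 hs2 s ξ w
  rw [← hxw, h0, Hf_smul, ← HfL_apply p2 ξ, ← re_inner_cgrad, ← hgh, inner_smul_right] at e1
  have e2 : (star s * inner ℂ gh w).re = (star s * inner ℂ gh W).re - (inner ℂ gh k * s).re * ‖s‖ ^ 2 := by
    rw [hWw, inner_sub_right, inner_smul_right, mul_sub, Complex.sub_re]
    congr 1
    have : star s * (s ^ 2 * inner ℂ gh k) = ((‖s‖ ^ 2 : ℝ) : ℂ) * (inner ℂ gh k * s) := by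
      rw [← Complex.normSq_eq_norm_sq, Complex.normSq_eq_conj_mul_self]
      simp only [Complex.star_def]; ring
    rw [this, Complex.re_ofReal_mul]; ring
  have e3 := half_eq p2 x
  have e4 := hc s
  have e5 : (b * s).re = (b0 * s).re - 2 * (inner ℂ gh k * s).re := by
    rw [hb, sub_mul, Complex.sub_re, mul_assoc]
    congr 1
    simp
  -- bilinear identity
  have e6 : (star s * inner ℂ (gt - (inner ℂ ξ gt : ℂ) • ξ) W).re =
      2 * (star s * inner ℂ gh W).re + (star s * (star c * inner ℂ N W)).re := by
    rw [inner_sub_left, inner_smul_left, hxiW, hgt, inner_add_left, inner_smul_left, inner_smul_left]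
    simp [mul_add, mul_left_comm]
  have e7 : (c * s * inner ℂ N W).re + (star s * (star c * inner ℂ N W)).re =
      - (1 / l0) * ((b * s).re * l W) := by
    rw [← re_inner_cgrad l W, ← hN, hcd]
    have : ∀ (r : ℝ) (a d e : ℂ), (-((r : ℂ) * a) * d * e).re + (star d * (star (-((r : ℂ) * a)) * e)).re
      = - (2 * r) * ((a * d).re * e.re) := by
      intro r a d e
      simp
      ring
    rw [this]
    congr 1
    field_simp
  have e8 : (b * s).re * ‖s‖ ^ 2 = - (1 / l0) * ((b * s).re * l W) +
      (1 / l0) * ((b * s).re * (l0 * ‖s‖ ^ 2 + l W)) := by field_simp; ring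
  -- errors
  have hbs : |(b * s).re| ≤ Kb M m * ‖x‖ := by
    refine (Complex.abs_re_le_norm _).trans ?_
    rw [norm_mul]
    have := s_bound h.xi x
    rw [← hs] at this
    gcongr
  have q1 : (1 / l0) * ((b * s).re * (l0 * ‖s‖ ^ 2 + l W)) ≤
      (4 / μ) * ((Kb M m * ‖x‖) * (4 * M * ‖x‖ * (‖w‖ + ‖x‖ ^ 2))) := by
    have a1 : (b * s).re * (l0 * ‖s‖ ^ 2 + l W) ≤
        (Kb M m * ‖x‖) * (4 * M * ‖x‖ * (‖w‖ + ‖x‖ ^ 2)) := by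
      refine (le_abs_self _).trans ?_
      rw [abs_mul]
      gcongr
    have a2 : 1 / l0 ≤ 4 / μ := by
      rw [div_le_div_iff₀ hl0p hμ]; linarith
    have a3 : 0 ≤ (Kb M m * ‖x‖) * (4 * M * ‖x‖ * (‖w‖ + ‖x‖ ^ 2)) := by positivity
    calc _ ≤ 1 / l0 * ((Kb M m * ‖x‖) * (4 * M * ‖x‖ * (‖w‖ + ‖x‖ ^ 2))) := by gcongr
      _ ≤ _ := by gcongr
  have q2 := le_of_abs_le (tri_diff hb3 hxw (by rw [norm_smul, h.xi, mul_one]; exact s_bound h.xi x))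
  have q3 := le_of_abs_le (Hf_bound p2 hb2 w w)
  set Y := K2 M m μ * ‖W‖ with hY
  have hYp : 0 ≤ Y := (norm_nonneg _).trans hw
  have q4 : ‖w‖ * ‖w‖ ≤ Y * Y := by gcongr
  have q5 : ‖w‖ * ‖x‖ ^ 2 ≤ Y * Y := by gcongr
  have q6 : ‖x‖ ^ 2 * ‖x‖ ^ 2 ≤ Y * Y := by gcongr
  have q7 : (4 / μ) * ((Kb M m * ‖x‖) * (4 * M * ‖x‖ * (‖w‖ + ‖x‖ ^ 2))) =
      16 * M * Kb M m / μ * (‖w‖ * ‖x‖ ^ 2 + ‖x‖ ^ 2 * ‖x‖ ^ 2) := by ring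
  have q8 : 16 * M * Kb M m / μ * (‖w‖ * ‖x‖ ^ 2 + ‖x‖ ^ 2 * ‖x‖ ^ 2) ≤
      16 * M * Kb M m / μ * (Y * Y + Y * Y) := by gcongr
  have q9 : K3 M m μ * ‖W‖ ^ 2 = 2 * M * (Y * Y) + 16 * M * Kb M m / μ * (Y * Y + Y * Y) := by
    rw [hY]; unfold K3; ring
  have q10 : M * (‖w‖ * ‖w‖) ≤ M * (Y * Y) := by gcongr
  have q11 : M * (‖w‖ * ‖x‖ ^ 2) ≤ M * (Y * Y) := by gcongr
  have q12 : M * (‖x‖ ^ 2 * ‖x‖ ^ 2) ≤ M * (Y * Y) := by gcongr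
  have q13 : (1/6) * p3 x x x ≤ (1/6) * p3 (s • ξ) (s • ξ) (s • ξ) + M * (‖w‖ * ‖x‖ ^ 2) / 2 := by linarith
  have q14 : M * ‖x‖ ^ 4 = M * (‖x‖ ^ 2 * ‖x‖ ^ 2) := by ring
  rw [← hWd, e6, q9]
  unfold F0
  rw [← hs, ← hWd, ← hN]
  clear_value Y
  have t1 : (1/2) * p2 x x = Bf p2 x x + 2 * (star s * inner ℂ gh W).re
      - 2 * ((inner ℂ gh k * s).re * ‖s‖ ^ 2) + Hf p2 w w := by
    rw [e3, e1, e2]; ring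
  have t2 : (b * s).re * ‖s‖ ^ 2 = (b0 * s).re * ‖s‖ ^ 2 - 2 * ((inner ℂ gh k * s).re * ‖s‖ ^ 2) := by
    rw [e5]; ring
  linarith
end EH

end PartPE3

section PartPE4
set_option maxSynthPendingDepth 3
/-- four point sum -/
def four (F : Cn n → ℝ) (x e : Cn n) : ℝ := F (x + e) + F (x + I • e) + F (x + -e) + F (x + -(I • e))

theorem four_PF (l : Cn n →L[ℝ] ℝ) (g : Cn n →L[ℝ] Cn n →L[ℝ] ℝ) (x e : Cn n) :
    four (PF l g) x e = 4 * PF l g x := by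
  unfold four PF Bf
  simp only [smul_add, smul_neg, I_smul_I_smul, map_add, map_neg, add_apply, neg_apply]
  ring

theorem four_F0 {l p1 : Cn n →L[ℝ] ℝ} {p2 : Cn n →L[ℝ] Cn n →L[ℝ] ℝ} {ξ : Cn n} {A c : ℂ}
    {g : Cn n →L[ℝ] Cn n →L[ℝ] ℝ} (h : inner ℂ (cgrad l) ξ = 0) (hN : 0 < ‖cgrad l‖) (x e : Cn n) :
    four (F0 l p1 p2 ξ (kV l g ξ) A c) x e = 4 * F0 l p1 p2 ξ (kV l g ξ) A c x := by
  have key : ∀ y, F0 l p1 p2 ξ (kV l g ξ) A c y = PF p1 p2 y + (A * (inner ℂ ξ y) ^ 3 +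
      c * inner ℂ ξ y * (inner ℂ (cgrad l) y + (inner ℂ ξ y) ^ 2 * qF g ξ)).re := by
    intro y
    unfold F0 PF
    rw [inner_N_W g h hN, Complex.add_re]; ring
  have h1 := four_PF p1 p2 x e
  unfold four at h1 ⊢
  simp only [key]
  have h2 : ∀ y : Cn n, inner ℂ y (x + e) = inner ℂ y x + inner ℂ y e ∧
      inner ℂ y (x + I • e) = inner ℂ y x + I * inner ℂ y e ∧
      inner ℂ y (x + -e) = inner ℂ y x - inner ℂ y e ∧
      inner ℂ y (x + -(I • e)) = inner ℂ y x - I * inner ℂ y e := by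
    intro y
    refine ⟨?_, ?_, ?_, ?_⟩ <;> simp [inner_add_right, inner_neg_right, inner_smul_right] <;> ring
  obtain ⟨a1, a2, a3, a4⟩ := h2 ξ
  obtain ⟨b1, b2, b3, b4⟩ := h2 (cgrad l)
  rw [a1, a2, a3, a4, b1, b2, b3, b4]
  generalize (inner ℂ ξ x : ℂ) = s at *
  generalize (inner ℂ ξ e : ℂ) = σ at *
  generalize (inner ℂ (cgrad l) x : ℂ) = t at *
  generalize (inner ℂ (cgrad l) e : ℂ) = τ at *
  have h3 : (A * (s + σ) ^ 3 + c * (s + σ) * (t + τ + (s + σ) ^ 2 * qF g ξ)) +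
      (A * (s + I * σ) ^ 3 + c * (s + I * σ) * (t + I * τ + (s + I * σ) ^ 2 * qF g ξ)) +
      (A * (s - σ) ^ 3 + c * (s - σ) * (t - τ + (s - σ) ^ 2 * qF g ξ)) +
      (A * (s - I * σ) ^ 3 + c * (s - I * σ) * (t - I * τ + (s - I * σ) ^ 2 * qF g ξ)) =
      ((4 : ℝ) : ℂ) * (A * s ^ 3 + c * s * (t + s ^ 2 * qF g ξ)) := by
    push_cast
    linear_combination (6 * A * s * σ ^ 2 + 2 * c * σ * τ + 6 * c * qF g ξ * s * σ ^ 2) * Complex.I_sq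
  have h4 := congrArg Complex.re h3
  rw [Complex.re_ofReal_mul, Complex.add_re, Complex.add_re, Complex.add_re] at h4
  linarith

theorem four_norm (G G1 Q : Cn n) : ‖G + G1 + Q‖ ^ 2 + ‖G + I • G1 - Q‖ ^ 2 + ‖G - G1 + Q‖ ^ 2 +
    ‖G - I • G1 - Q‖ ^ 2 = 4 * (‖G‖ ^ 2 + ‖G1‖ ^ 2 + ‖Q‖ ^ 2) := by
  have h1 := parallelogram_law_with_norm ℂ (G + Q) G1
  have h2 := parallelogram_law_with_norm ℂ (G - Q) (I • G1)
  have h3 := parallelogram_law_with_norm ℂ G Q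
  rw [norm_I_smul] at h2
  rw [show G + G1 + Q = G + Q + G1 by abel, show G - G1 + Q = G + Q - G1 by abel,
    show G + I • G1 - Q = G - Q + I • G1 by abel, show G - I • G1 - Q = G - Q - I • G1 by abel]
  linarith

/-- the map `G` -/
def GV (ξ k gv : Cn n) (x : Cn n) : Cn n := WV ξ k x + (inner ℂ ξ x : ℂ) • gv
/-- its linearisation -/
def G1V (ξ k gv : Cn n) (x e : Cn n) : Cn n :=
  e - (inner ℂ ξ e : ℂ) • ξ + (2 * inner ℂ ξ x * inner ℂ ξ e : ℂ) • k + (inner ℂ ξ e : ℂ) • gv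

theorem four_G (ξ k gv x e : Cn n) : four (fun x => ‖GV ξ k gv x‖ ^ 2) x e =
    4 * (‖GV ξ k gv x‖ ^ 2 + ‖G1V ξ k gv x e‖ ^ 2 + ‖(inner ℂ ξ e : ℂ) ^ 2 • k‖ ^ 2) := by
  rw [← four_norm]
  unfold four
  have key : ∀ c : ℂ, GV ξ k gv (x + c • e) = GV ξ k gv x + c • G1V ξ k gv x e + c ^ 2 • ((inner ℂ ξ e : ℂ) ^ 2 • k) := by
    intro c
    unfold GV G1V WV
    rw [inner_add_right, inner_smul_right]
    module
  have k1 := key 1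
  have k2 := key I
  have k3 := key (-1)
  have k4 := key (-I)
  simp only [one_smul, neg_smul, one_pow, Complex.I_sq, even_two, Even.neg_pow, ← sub_eq_add_neg] at k1 k2 k3 k4
  simp only [← sub_eq_add_neg]
  rw [k1, k2, k3, k4]

theorem four_sq (x e : Cn n) : four (fun x => ‖x‖ ^ 2) x e = 4 * (‖x‖ ^ 2 + ‖e‖ ^ 2) := by
  have := four_norm x e 0
  simp only [add_zero, sub_zero, norm_zero] at this
  unfold four
  simp only [← sub_eq_add_neg]
  rw [this]; ring

theorem G1V_smul (ξ k gv x e : Cn n) (τ : ℝ) : G1V ξ k gv x (τ • e) = τ • G1V ξ k gv x e := by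
  rw [← Complex.coe_smul, ← Complex.coe_smul]
  unfold G1V
  rw [inner_smul_right]
  module

theorem G1V_bound {ξ k gv x : Cn n} (hξ : ‖ξ‖ = 1) (hx : ‖x‖ ≤ 1) (e : Cn n) :
    ‖G1V ξ k gv x e‖ ≤ (2 + 2 * ‖k‖ + ‖gv‖) * ‖e‖ := by
  unfold G1V
  have h1 := w_le_x hξ e
  have h2 := s_bound hξ e
  have h3 := (s_bound hξ x).trans hx
  refine (norm_add₃_le).trans ?_
  rw [norm_smul, norm_smul, norm_mul, norm_mul]
  simp only [Complex.norm_ofNat]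
  have h4 : 2 * ‖(inner ℂ ξ x : ℂ)‖ * ‖(inner ℂ ξ e : ℂ)‖ * ‖k‖ ≤ 2 * 1 * ‖e‖ * ‖k‖ := by gcongr
  have h5 : ‖(inner ℂ ξ e : ℂ)‖ * ‖gv‖ ≤ ‖e‖ * ‖gv‖ := by gcongr
  linarith

theorem G1V_ker {ξ k gv : Cn n} (x : Cn n) (hξ : ‖ξ‖ = 1) (hk : inner ℂ ξ k = 0) (hg : inner ℂ ξ gv = 0) :
    ∃ e, 1 ≤ ‖e‖ ∧ G1V ξ k gv x e = 0 := by
  have h1 : inner ℂ ξ (ξ - (2 * inner ℂ ξ x : ℂ) • k - gv) = 1 := by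
    rw [inner_sub_right, inner_sub_right, inner_smul_right, hk, hg, inner_self_one hξ]; ring
  refine ⟨ξ - (2 * inner ℂ ξ x : ℂ) • k - gv, ?_, ?_⟩
  · have := s_bound hξ (ξ - (2 * inner ℂ ξ x : ℂ) • k - gv)
    rw [h1] at this
    simpa using this
  · unfold G1V
    rw [h1]
    module

theorem GV_sq (ξ k gv x : Cn n) {B : ℝ} (hB : 0 < B) :
    B * ‖WV ξ k x‖ ^ 2 + (star (inner ℂ ξ x : ℂ) * inner ℂ gv (WV ξ k x)).re ≤
    B * ‖GV ξ k (((1 / (2 * B) : ℝ) : ℂ) • gv) x‖ ^ 2 := by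
  unfold GV
  have := norm_add_sq (𝕜 := ℂ) (WV ξ k x) ((inner ℂ ξ x : ℂ) • ((1 / (2 * B) : ℝ) : ℂ) • gv)
  rw [this]
  have e : RCLike.re (inner ℂ (WV ξ k x) ((inner ℂ ξ x : ℂ) • ((1 / (2 * B) : ℝ) : ℂ) • gv)) =
      1 / (2 * B) * (star (inner ℂ ξ x : ℂ) * inner ℂ gv (WV ξ k x)).re := by
    rw [inner_re_symm, inner_smul_left, inner_smul_left, Complex.conj_ofReal]
    rw [show (starRingEnd ℂ) (inner ℂ ξ x) * (((1 / (2 * B) : ℝ) : ℂ) * inner ℂ gv (WV ξ k x)) =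
      ((1 / (2 * B) : ℝ) : ℂ) * (star (inner ℂ ξ x) * inner ℂ gv (WV ξ k x)) by
        simp only [Complex.star_def]; ring]
    exact Complex.re_ofReal_mul _ _
  rw [e]
  have h1 : B * (2 * (1 / (2 * B) * (star (inner ℂ ξ x : ℂ) * inner ℂ gv (WV ξ k x)).re)) =
    (star (inner ℂ ξ x : ℂ) * inner ℂ gv (WV ξ k x)).re := by field_simp
  have h2 : 0 ≤ B * ‖(inner ℂ ξ x : ℂ) • ((1 / (2 * B) : ℝ) : ℂ) • gv‖ ^ 2 := by positivity
  nlinarith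

end PartPE4

section PartPE5
set_option maxSynthPendingDepth 3
def K4 (M m μ : ℝ) : ℝ := M / 2 + M + Kc M m μ * M * (3 * (M / m))
def KB (M m μ r : ℝ) : ℝ := K3 M m μ + 1 + (6 * M + K4 M m μ + Kg M m μ * (3 * (M / m))) / (r ^ 2 / (32 * M / μ)) ^ 2
def KG (M m μ : ℝ) : ℝ := 2 + 2 * (M / m) + Kg M m μ
def KK (M m μ r : ℝ) : ℝ := 1 + KB M m μ r * KG M m μ ^ 2
def Kδ (n : ℕ) (M m μ r c : ℝ) : ℝ := min 1 (c / KK M m μ r ^ (n - 1) / 2)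
def Kη (n : ℕ) (M m μ r c : ℝ) : ℝ := Kδ n M m μ r c / (2 * M)

/-- four-point comparison -/
theorem levi_le_four {v H : Cn n → ℝ} {p z : Cn n} (hv : ContDiffAt ℝ 2 v z)
    (hmax : ∀ᶠ y in 𝓝 z, v y - H (y - p) ≤ v z - H (z - p)) {e : Cn n} {a b : ℝ}
    (h : ∀ τ : ℝ, four H (z - p) (τ • e) = 4 * H (z - p) + a * τ ^ 2 + b * τ ^ 4) :
    levi univ v z e ≤ a := by
  refine levi_le (b := b) hv ?_
  have c : ∀ d : Cn n, ∀ᶠ τ : ℝ in 𝓝[>] 0, v (z + τ • d) - H (z + τ • d - p) ≤ v z - H (z - p) := by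
    intro d
    have : Tendsto (fun τ : ℝ => z + τ • d) (𝓝[>] 0) (𝓝 z) := by
      have hc : Continuous (fun τ : ℝ => z + τ • d) := by fun_prop
      simpa using (hc.tendsto 0).mono_left nhdsWithin_le_nhds
    exact this.eventually hmax
  filter_upwards [c e, c (I • e), c (-e), c (-(I • e))] with τ h1 h2 h3 h4
  have h5 := h τ
  unfold four at h5
  have e1 : ∀ d : Cn n, z + τ • d - p = z - p + τ • d := by intro d; abel
  rw [e1] at h1 h2 h3 h4
  rw [smul_neg] at h3 h4 ⊢
  rw [smul_neg]
  rw [← I_smul_real_smul] at h2 h4 ⊢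
  linarith

theorem WV_bound {ξ k x : Cn n} {K : ℝ} (hξ : ‖ξ‖ = 1) (hx : ‖x‖ ≤ 1) (hk : ‖k‖ ≤ K) (hK : 1 ≤ K) :
    ‖WV ξ k x‖ ≤ 3 * K * ‖x‖ := by
  unfold WV
  refine (norm_add_le _ _).trans ?_
  have h1 := w_le_x hξ x
  have h2 := s_bound hξ x
  rw [norm_smul, norm_pow]
  have h3 : ‖(inner ℂ ξ x : ℂ)‖ ^ 2 * ‖k‖ ≤ ‖x‖ ^ 2 * K := by gcongr
  nlinarith [norm_nonneg x, mul_nonneg (norm_nonneg x) (sub_nonneg.2 hK), mul_nonneg (mul_nonneg (norm_nonneg x) (sub_nonneg.2 hx)) (by linarith : (0:ℝ) ≤ K)]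

theorem F0_bound {M m μ : ℝ} {l p1 : Cn n →L[ℝ] ℝ} {p2 : Cn n →L[ℝ] Cn n →L[ℝ] ℝ} {ξ k : Cn n}
    {A c : ℂ} (hM : 1 ≤ M) (hm : 0 < m) (hm1 : m ≤ 1) (h1 : ‖l‖ ≤ M) (h2 : ‖p2‖ ≤ M) (hξ : ‖ξ‖ = 1) (hk : ‖k‖ ≤ M / m)
    (hA : ‖A‖ ≤ M) (hc : ‖c‖ ≤ Kc M m μ) {x : Cn n} (hx : ‖x‖ ≤ 1) :
    |F0 l p1 p2 ξ k A c x - p1 x| ≤ K4 M m μ * ‖x‖ ^ 2 := by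
  have hMm : 1 ≤ M / m := by rw [le_div_iff₀ hm]; linarith
  have e : F0 l p1 p2 ξ k A c x - p1 x = Bf p2 x x + (A * (inner ℂ ξ x) ^ 3).re +
      (c * inner ℂ ξ x * inner ℂ (cgrad l) (WV ξ k x)).re := by unfold F0; ring
  rw [e]
  refine (abs_add_three _ _ _).trans ?_
  have a1 := Bf_bound p2 h2 x x
  have hs := s_bound hξ x
  have a2 : |(A * (inner ℂ ξ x) ^ 3).re| ≤ M * ‖x‖ ^ 2 := by
    refine (Complex.abs_re_le_norm _).trans ?_
    rw [norm_mul, norm_pow]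
    calc _ ≤ M * ‖x‖ ^ 3 := by gcongr
      _ ≤ M * ‖x‖ ^ 2 := by
        have : ‖x‖ ^ 3 ≤ ‖x‖ ^ 2 := pow_le_pow_of_le_one (norm_nonneg _) hx (by norm_num)
        gcongr
  have a3 : |(c * inner ℂ ξ x * inner ℂ (cgrad l) (WV ξ k x)).re| ≤ Kc M m μ * M * (3 * (M / m)) * ‖x‖ ^ 2 := by
    refine (Complex.abs_re_le_norm _).trans ?_
    rw [norm_mul, norm_mul]
    have b1 := norm_inner_le_norm (𝕜 := ℂ) (cgrad l) (WV ξ k x)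
    have b2 := (cgrad_le_norm l).trans h1
    have b3 := WV_bound hξ hx hk hMm
    have hKc : 0 ≤ Kc M m μ := (norm_nonneg _).trans hc
    calc _ ≤ Kc M m μ * ‖x‖ * (M * (3 * (M / m) * ‖x‖)) := by
          gcongr
          exact b1.trans (by gcongr)
      _ = _ := by ring
  unfold K4
  nlinarith

theorem K_pos {M m μ r c : ℝ} (hM : 1 ≤ M) (hm : 0 < m) (hμ : 0 < μ) (hr : 0 < r) :
    0 < Kb M m ∧ 0 < Kc M m μ ∧ 0 < Kg M m μ ∧ 0 < K3 M m μ ∧ 0 < K4 M m μ ∧ 1 ≤ KB M m μ r ∧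
    K3 M m μ ≤ KB M m μ r ∧ 1 ≤ KK M m μ r ∧ (0 < c → 0 < Kη n M m μ r c) := by
  have hb : 0 < Kb M m := by unfold Kb; positivity
  have hc : 0 < Kc M m μ := by unfold Kc; positivity
  have hg : 0 < Kg M m μ := by unfold Kg; positivity
  have h2 : 0 < K2 M m μ := by unfold K2; positivity
  have h3 : 0 < K3 M m μ := by unfold K3; positivity
  have h4 : 0 < K4 M m μ := by unfold K4; positivity
  have hB : 0 ≤ (6 * M + K4 M m μ + Kg M m μ * (3 * (M / m))) / (r ^ 2 / (32 * M / μ)) ^ 2 := by positivity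
  have hB1 : 1 ≤ KB M m μ r := by unfold KB; linarith
  have hB2 : K3 M m μ ≤ KB M m μ r := by unfold KB; linarith
  have hK : 1 ≤ KK M m μ r := by
    unfold KK
    have : 0 ≤ KB M m μ r * KG M m μ ^ 2 := by positivity
    linarith
  refine ⟨hb, hc, hg, h3, h4, hB1, hB2, hK, fun h => ?_⟩
  unfold Kη Kδ
  positivity

end PartPE5

section PartPE6
set_option maxSynthPendingDepth 3
set_option maxHeartbeats 1600000 in
theorem barrier {Ω : Set (Cn n)} (hΩ : IsOpen Ω) (hbd : IsBounded Ω) {p : Cn n}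
    {M m μ r c0 : ℝ} {l p1 : Cn n →L[ℝ] ℝ} {g p2 : Cn n →L[ℝ] Cn n →L[ℝ] ℝ}
    {g3 p3 : Cn n →L[ℝ] Cn n →L[ℝ] Cn n →L[ℝ] ℝ} {ξ : Cn n} {v : Cn n → ℝ}
    (h : EH M m μ l g g3 ξ) (hr : 0 < r) (hr1 : r ≤ m * μ / (16 * M ^ 2)) (hc0 : 0 < c0)
    (hρ1 : ∀ y ∈ closure Ω, ‖y - p‖ ≤ r → l (y - p) + (1/2) * g (y - p) (y - p) +
      (1/6) * g3 (y - p) (y - p) (y - p) ≤ M * ‖y - p‖ ^ 4)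
    (hρ2 : ∀ y ∈ frontier Ω, ‖y - p‖ ≤ r → |l (y - p) + (1/2) * g (y - p) (y - p) +
      (1/6) * g3 (y - p) (y - p) (y - p)| ≤ M * ‖y - p‖ ^ 4)
    (hψ : ∀ y ∈ frontier Ω, ‖y - p‖ ≤ r → v y ≤ v p + p1 (y - p) + (1/2) * p2 (y - p) (y - p) +
      (1/6) * p3 (y - p) (y - p) (y - p) + M * ‖y - p‖ ^ 4)
    (hb1 : ‖p1‖ ≤ M) (hb2 : ‖p2‖ ≤ M) (hb3 : ‖p3‖ ≤ M) (hs2 : ∀ a b, p2 a b = p2 b a)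
    (h0 : Hf p2 ξ ξ = 0) (hpc : p ∈ closure Ω)
    (hvM : ∀ y ∈ closure Ω, |v y| ≤ M) (hvc : ContinuousOn v (closure Ω))
    (hv2 : ∀ y ∈ Ω, ContDiffAt ℝ 2 v y) (hpd : ∀ y ∈ Ω, (cHess v y).PosDef)
    (hdet : ∀ y ∈ Ω, c0 ≤ (cHess v y).det.re) :
    ∃ C, ∀ y ∈ closure Ω, ‖y - p‖ ≤ r →
      v y ≤ v p + p1 (y - p) + Kη n M m μ r c0 * l (y - p) + C * ‖y - p‖ ^ 2 := by
  have hM := h.M1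
  have hm := h.m0
  have hμ := h.μ0
  obtain ⟨-, hKc, hKg, -, hK4, hB1, hB3, hK1, hη⟩ := K_pos (n := n) (c := c0) hM hm hμ hr
  replace hη := hη hc0
  obtain ⟨A, c, gv, hA, hc, hgv, hgξ, hEB⟩ := h.EB p1 p2 p3 hs2 hb2 hb3 h0
  have hkb : ‖kV l g ξ‖ ≤ M / m := kV_bound h.b2 h.m0 h.N h.xi
  have hkξ : inner ℂ ξ (kV l g ξ) = 0 := inner_xi_k g h.tan
  have hMm : 1 ≤ M / m := by rw [le_div_iff₀ hm]; linarith [h.m1]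
  obtain ⟨B, hBd⟩ : ∃ B, B = KB M m μ r := ⟨_, rfl⟩
  obtain ⟨δ, hδd⟩ : ∃ δ, δ = Kδ n M m μ r c0 := ⟨_, rfl⟩
  obtain ⟨η, hηd⟩ : ∃ η, η = Kη n M m μ r c0 := ⟨_, rfl⟩
  have hηδ : η * (2 * M) = δ := by rw [hηd, hδd]; unfold Kη; field_simp
  have hBpos : 0 < B := by linarith
  rw [← hBd] at hB1 hB3
  rw [← hηd] at hη ⊢
  have hδpos : 0 < δ := by rw [← hηδ]; positivity
  have hδ1 : δ ≤ 1 := by rw [hδd]; unfold Kδ; exact min_le_left _ _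
  have hη1 : η ≤ 1 := by nlinarith
  set k := kV l g ξ with hk
  obtain ⟨G', hG'⟩ : ∃ G' : Cn n, G' = ((1 / (2 * B) : ℝ) : ℂ) • gv := ⟨_, rfl⟩
  have hG'b : ‖G'‖ ≤ Kg M m μ := by
    rw [hG', norm_smul, Complex.norm_real, Real.norm_of_nonneg (by positivity)]
    have : 1 / (2 * B) ≤ 1 := by rw [div_le_one (by positivity)]; linarith
    calc _ ≤ 1 * ‖gv‖ := by gcongr
      _ ≤ _ := by linarith
  have hG'ξ : inner ℂ ξ G' = 0 := by rw [hG', inner_smul_right, hgξ, mul_zero]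
  -- the barrier
  obtain ⟨H, hH⟩ : ∃ H : Cn n → ℝ, H = fun x => F0 l p1 p2 ξ k A c x + η * PF l g x + δ * ‖x‖ ^ 2 +
      B * ‖GV ξ k G' x‖ ^ 2 := ⟨_, rfl⟩
  have hHlow : ∀ x, F0 l p1 p2 ξ k A c x + η * PF l g x + δ * ‖x‖ ^ 2 + B * ‖WV ξ k x‖ ^ 2 +
      (star (inner ℂ ξ x : ℂ) * inner ℂ gv (WV ξ k x)).re ≤ H x := by
    intro x
    have := GV_sq ξ k gv x hBpos
    rw [← hG'] at this
    rw [hH]; dsimp only; linarith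
  have hsmall : ∀ {x : Cn n}, ‖x‖ ≤ r → ‖x‖ ≤ 1 := fun hx => h.x_le_one (hx.trans hr1)
  -- main comparison
  have hmain : ∀ y ∈ closure Ω, ‖y - p‖ ≤ r → v y ≤ v p + H (y - p) := by
    have hS : IsCompact (closure Ω ∩ closedBall p r) :=
      hbd.isCompact_closure.inter_right isClosed_closedBall
    have hne : (closure Ω ∩ closedBall p r).Nonempty := ⟨p, hpc, by simp [hr.le]⟩
    have hHc : Continuous H := by
      rw [hH]; unfold F0 PF GV WV Bf; fun_prop
    have hfc : ContinuousOn (fun y => v y - H (y - p)) (closure Ω ∩ closedBall p r) := by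
      refine (hvc.mono inter_subset_left).sub ?_
      exact (hHc.comp (continuous_id.sub continuous_const)).continuousOn
    obtain ⟨z, hz, hzmax⟩ := hS.exists_isMaxOn hne hfc
    have hzr : ‖z - p‖ ≤ r := by simpa [dist_eq_norm] using hz.2
    suffices hzle : v z - H (z - p) ≤ v p by
      intro y hy hyr
      have := hzmax (show y ∈ closure Ω ∩ closedBall p r from ⟨hy, by simpa [dist_eq_norm] using hyr⟩)
      simp only [mem_setOf_eq] at this
      linarith
    have hz1 := hsmall hzr
    by_cases hzf : z ∈ frontier Ω
    · -- boundary
      have b1 := hψ z hzf hzr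
      have b2 := hρ2 z hzf hzr
      have b3 := hEB (z - p) (hzr.trans hr1) b2
      have b4 := hHlow (z - p)
      set x := z - p
      have b5 : -(2 * M) * ‖x‖ ^ 2 ≤ PF l g x := by
        have c1 := (abs_le.1 b2).1
        have c2 := half_eq g x
        have c3 := le_of_abs_le (Hf_bound g h.b2 x x)
        have c4 := le_of_abs_le (tri_bound h.b3 x x x)
        have c5 : M * ‖x‖ * ‖x‖ * ‖x‖ ≤ M * ‖x‖ ^ 2 := by
          have : ‖x‖ ^ 3 ≤ ‖x‖ ^ 2 := pow_le_pow_of_le_one (norm_nonneg _) hz1 (by norm_num)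
          have : M * ‖x‖ ^ 3 ≤ M * ‖x‖ ^ 2 := by gcongr
          linarith
        have c6 : M * ‖x‖ ^ 4 ≤ M * ‖x‖ ^ 2 := by
          have : ‖x‖ ^ 4 ≤ ‖x‖ ^ 2 := pow_le_pow_of_le_one (norm_nonneg _) hz1 (by norm_num)
          gcongr
        have c7 : 0 ≤ M * ‖x‖ ^ 2 := by positivity
        unfold PF
        linarith
      have b6 : η * (-(2 * M) * ‖x‖ ^ 2) ≤ η * PF l g x := by gcongr
      have b7 : η * (-(2 * M) * ‖x‖ ^ 2) = - δ * ‖x‖ ^ 2 := by rw [← hηδ]; ring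
      have b8 : K3 M m μ * ‖WV ξ k x‖ ^ 2 ≤ B * ‖WV ξ k x‖ ^ 2 := by gcongr
      linarith
    · have hzΩ : z ∈ Ω := by
        by_contra hn
        exact hzf ⟨hz.1, by rwa [hΩ.interior_eq]⟩
      rcases hzr.lt_or_eq with hlt | heq
      · -- interior maximum: contradiction
        exfalso
        have hloc : ∀ᶠ y in 𝓝 z, v y - H (y - p) ≤ v z - H (z - p) := by
          have : Ω ∩ ball p r ∈ 𝓝 z := (hΩ.inter isOpen_ball).mem_nhds ⟨hzΩ, by simpa [dist_eq_norm] using hlt⟩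
          filter_upwards [this] with y hy
          exact hzmax (show y ∈ closure Ω ∩ closedBall p r from ⟨subset_closure hy.1, ball_subset_closedBall hy.2⟩)
        have hlev : ∀ e, levi univ v z e ≤ 4 * δ * ‖e‖ ^ 2 + 4 * B * ‖G1V ξ k G' (z - p) e‖ ^ 2 := by
          intro e
          refine levi_le_four (b := 4 * B * ‖(inner ℂ ξ e : ℂ) ^ 2 • k‖ ^ 2) (hv2 z hzΩ) hloc ?_
          intro τ
          have f1 := four_F0 (p1 := p1) (p2 := p2) (A := A) (c := c) (g := g) h.tan (hm.trans_le h.N) (z - p) (τ • e)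
          have f2 := four_PF l g (z - p) (τ • e)
          have f3 := four_sq (z - p) (τ • e)
          have f4 := four_G ξ k G' (z - p) (τ • e)
          rw [G1V_smul, norm_smul, mul_pow, Real.norm_eq_abs, sq_abs] at f4
          rw [norm_smul, mul_pow, Real.norm_eq_abs, sq_abs] at f3
          have f5 : ‖(inner ℂ ξ (τ • e) : ℂ) ^ 2 • k‖ ^ 2 = τ ^ 4 * ‖(inner ℂ ξ e : ℂ) ^ 2 • k‖ ^ 2 := by
            rw [← Complex.coe_smul, inner_smul_right, mul_pow, mul_smul, norm_smul, mul_pow, norm_pow,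
              Complex.norm_real, Real.norm_eq_abs, sq_abs]
            ring
          rw [f5] at f4
          rw [← hk] at f1
          rw [hH]
          unfold four at *
          dsimp only at *
          linear_combination f1 + η * f2 + δ * f3 + B * f4
        have hGb : ∀ e, ‖G1V ξ k G' (z - p) e‖ ^ 2 ≤ KG M m μ ^ 2 * ‖e‖ ^ 2 := by
          intro e
          have d1 := G1V_bound (k := k) (gv := G') h.xi hz1 e
          have d2 : (2 + 2 * ‖k‖ + ‖G'‖) * ‖e‖ ≤ KG M m μ * ‖e‖ := by
            unfold KG; gcongr
          rw [← mul_pow]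
          exact pow_le_pow_left₀ (norm_nonneg _) (d1.trans d2) 2
        have hup : ∀ e, levi univ v z e ≤ 4 * KK M m μ r * ‖e‖ ^ 2 := by
          intro e
          refine (hlev e).trans ?_
          have d1 : 4 * B * ‖G1V ξ k G' (z - p) e‖ ^ 2 ≤ 4 * B * (KG M m μ ^ 2 * ‖e‖ ^ 2) := by
            have := hGb e; gcongr
          have d2 : 4 * δ * ‖e‖ ^ 2 ≤ 4 * 1 * ‖e‖ ^ 2 := by gcongr
          unfold KK
          rw [← hBd]
          linarith
        obtain ⟨e, he1, he0⟩ := G1V_ker (z - p) h.xi hkξ hG'ξ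
        have l1 := hlev e
        rw [he0, norm_zero] at l1
        have l2 := levi_ge_of_det (hv2 z hzΩ) (hpd z hzΩ) (by linarith) (hdet z hzΩ) hup e
        have l3 : δ ≤ c0 / KK M m μ r ^ (n - 1) / 2 := by rw [hδd]; unfold Kδ; exact min_le_right _ _
        have l4 : 0 < c0 / KK M m μ r ^ (n - 1) := by positivity
        have l5 : δ < c0 / KK M m μ r ^ (n - 1) := by linarith
        have l6 : 4 * δ * ‖e‖ ^ 2 < 4 * (c0 / KK M m μ r ^ (n - 1)) * ‖e‖ ^ 2 := by gcongr
        nlinarith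
      · -- sphere
        have b2 := hρ1 z hz.1 hzr
        have b3 := h.x_sq_le (hzr.trans hr1) b2
        have b4 := hHlow (z - p)
        have b5 := hvM z hz.1
        have b6 := hvM p hpc
        have b7 := F0_bound (μ := μ) (p1 := p1) hM hm h.m1 h.b1 hb2 h.xi hkb hA hc hz1
        have b8 := WV_bound h.xi hz1 hkb hMm
        rw [← hk] at b3
        rw [heq] at b3
        set x := z - p
        have c1 : |p1 x| ≤ M := by
          have := p1.le_opNorm x
          rw [Real.norm_eq_abs] at this
          refine this.trans ?_
          calc ‖p1‖ * ‖x‖ ≤ M * 1 := by gcongr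
            _ = M := by ring
        have c1' : |l x| ≤ M := by
          have := l.le_opNorm x
          rw [Real.norm_eq_abs] at this
          refine this.trans ?_
          calc ‖l‖ * ‖x‖ ≤ M * 1 := by gcongr; exact h.b1
            _ = M := by ring
        have hx2 : ‖x‖ ^ 2 ≤ 1 := pow_le_one₀ (norm_nonneg _) hz1
        have c2 : -(2 * M) ≤ PF l g x := by
          have d1 := (abs_le.1 (Bf_bound g h.b2 x x)).1
          have d2 := (abs_le.1 c1').1
          unfold PF
          nlinarith
        have c3 : -(2 * M) ≤ η * PF l g x := by nlinarith
        have c4 : K4 M m μ * ‖x‖ ^ 2 ≤ K4 M m μ * 1 := by gcongr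
        have c5 : ‖WV ξ k x‖ ≤ 3 * (M / m) := by
          refine b8.trans ?_
          nlinarith
        have c6 : |(star (inner ℂ ξ x : ℂ) * inner ℂ gv (WV ξ k x)).re| ≤ Kg M m μ * (3 * (M / m)) := by
          refine (Complex.abs_re_le_norm _).trans ?_
          rw [norm_mul, norm_star]
          have d1 := (s_bound h.xi x).trans hz1
          have d2 := norm_inner_le_norm (𝕜 := ℂ) gv (WV ξ k x)
          calc _ ≤ 1 * (‖gv‖ * ‖WV ξ k x‖) := by gcongr
            _ ≤ 1 * (Kg M m μ * (3 * (M / m))) := by gcongr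
            _ = _ := by ring
        have c7 : (r ^ 2 / (32 * M / μ)) ≤ ‖WV ξ k x‖ := by
          rw [div_le_iff₀ (by positivity)]; linarith
        have c8 : 6 * M + K4 M m μ + Kg M m μ * (3 * (M / m)) ≤ B * ‖WV ξ k x‖ ^ 2 := by
          have hq : 0 < (r ^ 2 / (32 * M / μ)) := by positivity
          have d1 : (6 * M + K4 M m μ + Kg M m μ * (3 * (M / m))) / (r ^ 2 / (32 * M / μ)) ^ 2 ≤ B := by
            rw [hBd]; unfold KB
            linarith [(K_pos (n := n) (c := c0) hM hm hμ hr).2.2.2.1]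
          rw [div_le_iff₀ (by positivity)] at d1
          refine d1.trans ?_
          gcongr
        have c9 : 0 ≤ δ * ‖x‖ ^ 2 := by positivity
        have d1 := (abs_le.1 b7).1
        have d2 := (abs_le.1 c6).1
        have d3 := (abs_le.1 c1).1
        have d4 := le_of_abs_le b5
        have d5 := (abs_le.1 b6).1
        linarith
  -- quadratic bound of the barrier
  refine ⟨K4 M m μ + η * M + δ + B * (3 * (M / m) + Kg M m μ) ^ 2, fun y hy hyr => ?_⟩
  refine (hmain y hy hyr).trans ?_
  have hx1 := hsmall hyr
  set x := y - p
  have b7 := le_of_abs_le (F0_bound (μ := μ) (p1 := p1) hM hm h.m1 h.b1 hb2 h.xi hkb hA hc hx1)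
  have b8 := WV_bound h.xi hx1 hkb hMm
  have b9 : η * PF l g x ≤ η * l x + η * M * ‖x‖ ^ 2 := by
    have d1 := le_of_abs_le (Bf_bound g h.b2 x x)
    have : PF l g x ≤ l x + M * ‖x‖ ^ 2 := by unfold PF; nlinarith [norm_nonneg x, mul_nonneg (by linarith : (0:ℝ) ≤ M) (sq_nonneg ‖x‖)]
    nlinarith
  have b10 : ‖GV ξ k G' x‖ ^ 2 ≤ (3 * (M / m) + Kg M m μ) ^ 2 * ‖x‖ ^ 2 := by
    rw [← mul_pow]
    refine pow_le_pow_left₀ (norm_nonneg _) ?_ 2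
    unfold GV
    refine (norm_add_le _ _).trans ?_
    rw [norm_smul]
    have d1 := s_bound h.xi x
    have : ‖(inner ℂ ξ x : ℂ)‖ * ‖G'‖ ≤ ‖x‖ * Kg M m μ := by gcongr
    linarith
  have b11 : B * ‖GV ξ k G' x‖ ^ 2 ≤ B * ((3 * (M / m) + Kg M m μ) ^ 2 * ‖x‖ ^ 2) := by gcongr
  rw [hH]
  dsimp only
  linarith

end PartPE6

section PartPF1
set_option maxSynthPendingDepth 3
theorem D2_sub {s : Set (Cn n)} {v w : Cn n → ℝ} {p : Cn n} (hv : ContDiffOn ℝ 2 v s)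
    (hw : ContDiffOn ℝ 2 w s) (hs : UniqueDiffOn ℝ s) (hp : p ∈ s) :
    D2 s (fun y => v y - w y) p = D2 s v p - D2 s w p := by
  unfold D2
  have e1 : ∀ y ∈ s, fderivWithin ℝ (fun y => v y - w y) s y = fderivWithin ℝ v s y - fderivWithin ℝ w s y := by
    intro y hy
    exact fderivWithin_fun_sub (hs y hy) (hv.differentiableOn (by norm_num) y hy) (hw.differentiableOn (by norm_num) y hy)
  rw [fderivWithin_congr e1 (e1 p hp)]
  exact fderivWithin_fun_sub (hs p hp)
    ((hv.fderivWithin hs (m := 1) (by norm_num)).differentiableOn (by norm_num) p hp)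
    ((hw.fderivWithin hs (m := 1) (by norm_num)).differentiableOn (by norm_num) p hp)

theorem levi_sub {s : Set (Cn n)} {v w : Cn n → ℝ} {p : Cn n} (hv : ContDiffOn ℝ 2 v s)
    (hw : ContDiffOn ℝ 2 w s) (hs : UniqueDiffOn ℝ s) (hp : p ∈ s) (e : Cn n) :
    levi s (fun y => v y - w y) p e = levi s v p e - levi s w p e := by
  unfold levi; rw [D2_sub hv hw hs hp]; simp; ring

theorem levi_Hf (s : Set (Cn n)) (v : Cn n → ℝ) (p e : Cn n) : levi s v p e = 4 * Hf (D2 s v p) e e := by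
  unfold levi Hf; ring

theorem levi_smul (s : Set (Cn n)) (v : Cn n → ℝ) (p e : Cn n) (c : ℝ) :
    levi s v p (c • e) = c ^ 2 * levi s v p e := by
  unfold levi; rw [I_smul_real_smul]; simp; ring

namespace Defn
variable {Ω U : Set (Cn n)} {ρ : Cn n → ℝ}

theorem smooth_cl (h : Defn Ω U ρ) : ContDiffOn ℝ (⊤ : ℕ∞) ρ (closure Ω) := h.smooth.mono h.sub

theorem fw (h : Defn Ω U ρ) {p : Cn n} (hp : p ∈ closure Ω) :
    fderivWithin ℝ ρ (closure Ω) p = fderiv ℝ ρ p :=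
  fderivWithin_eq_fderiv (h.uniqueDiffOn p hp) (h.diffAt (h.sub hp))

theorem D2_cl (h : Defn Ω U ρ) {p : Cn n} (hp : p ∈ closure Ω) :
    D2 (closure Ω) ρ p = D2 univ ρ p := by
  unfold D2
  rw [fderivWithin_congr (fun y hy => h.fw hy) (h.fw hp)]
  simp only [fderivWithin_univ]
  refine fderivWithin_eq_fderiv (h.uniqueDiffOn p hp) ?_
  have h1 := (h.smooth.fderiv_of_isOpen h.open_U (m := 1) (nat_le_top 2)).differentiableOn (by norm_num)
  exact (h1 p (h.sub hp)).differentiableAt (h.open_U.mem_nhds (h.sub hp))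

theorem D2_cont (h : Defn Ω U ρ) : ContinuousOn (D2 univ ρ) U := by
  have e : D2 univ ρ = fderiv ℝ (fderiv ℝ ρ) := by
    funext z; unfold D2; simp only [fderivWithin_univ]
  rw [e]
  have h1 := h.smooth.fderiv_of_isOpen h.open_U (m := 1) (nat_le_top 2)
  exact h1.continuousOn_fderiv_of_isOpen h.open_U (by norm_num)

theorem cd2 (h : Defn Ω U ρ) {z : Cn n} (hz : z ∈ U) : ContDiffAt ℝ 2 ρ z :=
  (h.smooth.contDiffAt (h.open_U.mem_nhds hz)).of_le (nat_le_top 2)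

theorem mu_exists (h : Defn Ω U ρ) (hpd : ∀ z ∈ U, (cHess ρ z).PosDef) :
    ∃ μ > 0, μ ≤ 1 ∧ ∀ z ∈ closure Ω, ∀ e, μ * ‖e‖ ^ 2 ≤ levi univ ρ z e := by
  have hK : IsCompact (closure Ω ×ˢ sphere (0 : Cn n) 1) := h.compact.prod (isCompact_sphere _ _)
  have hc : ContinuousOn (fun q : Cn n × Cn n => levi univ ρ q.1 q.2) (closure Ω ×ˢ sphere (0 : Cn n) 1) := by
    have h1 : ContinuousOn (fun q : Cn n × Cn n => D2 univ ρ q.1) (closure Ω ×ˢ sphere (0 : Cn n) 1) :=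
      (h.D2_cont.mono h.sub).comp continuousOn_fst (fun q hq => hq.1)
    have h2 : Continuous (fun q : Cn n × Cn n => I • q.2) := by fun_prop
    unfold levi
    exact ((h1.clm_apply continuousOn_snd).clm_apply continuousOn_snd).add
      ((h1.clm_apply h2.continuousOn).clm_apply h2.continuousOn)
  have key : ∃ μ > 0, μ ≤ 1 ∧ ∀ z ∈ closure Ω, ∀ e : Cn n, ‖e‖ = 1 → μ ≤ levi univ ρ z e := by
    rcases (closure Ω ×ˢ sphere (0 : Cn n) 1).eq_empty_or_nonempty with h0 | h0
    · refine ⟨1, one_pos, le_rfl, fun z hz e he => ?_⟩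
      exact absurd (show (z, e) ∈ closure Ω ×ˢ sphere (0 : Cn n) 1 from ⟨hz, by simpa using he⟩) (by rw [h0]; simp)
    · obtain ⟨q, hq, hmin⟩ := hK.exists_isMinOn h0 hc
      have hpos : 0 < levi univ ρ q.1 q.2 := by
        refine levi_pos_of_posDef (h.cd2 (h.sub hq.1)) (hpd _ (h.sub hq.1)) ?_
        intro h0
        have := hq.2
        rw [h0] at this; simp at this
      refine ⟨min 1 (levi univ ρ q.1 q.2), by positivity, min_le_left _ _, fun z hz e he => ?_⟩
      refine (min_le_right _ _).trans ?_
      exact hmin (show (z, e) ∈ closure Ω ×ˢ sphere (0 : Cn n) 1 from ⟨hz, by simpa using he⟩)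
  obtain ⟨μ, hμ, hμ1, hk⟩ := key
  refine ⟨μ, hμ, hμ1, fun z hz e => ?_⟩
  by_cases he : e = 0
  · subst he; simp [levi]
  have hn : 0 < ‖e‖ := norm_pos_iff.2 he
  have h1 := hk z hz (‖e‖⁻¹ • e) (by rw [norm_smul, norm_inv, norm_norm, inv_mul_cancel₀ hn.ne'])
  rw [levi_smul, inv_pow, ← div_eq_inv_mul, le_div_iff₀ (by positivity)] at h1
  exact h1

theorem rho_bound (h : Defn Ω U ρ) : ∃ M, 0 ≤ M ∧ ∀ k ≤ 4, ∀ y ∈ closure Ω,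
    ‖iteratedFDerivWithin ℝ k ρ (closure Ω) y‖ ≤ M := by
  have h1 : ∀ k : ℕ, ∃ C, ∀ y ∈ closure Ω, ‖iteratedFDerivWithin ℝ k ρ (closure Ω) y‖ ≤ C := by
    intro k
    exact h.compact.exists_bound_of_continuousOn
      (h.smooth_cl.continuousOn_iteratedFDerivWithin (nat_le_top k) h.uniqueDiffOn)
  choose C hC using h1
  refine ⟨∑ k ∈ Finset.range 5, |C k|, Finset.sum_nonneg fun _ _ => abs_nonneg _, fun k hk y hy => ?_⟩
  refine (hC k y hy).trans ((le_abs_self _).trans ?_)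
  exact Finset.single_le_sum (f := fun k => |C k|) (fun _ _ => abs_nonneg _) (Finset.mem_range.2 (by omega))

end Defn

end PartPF1

section PartPF2
set_option maxSynthPendingDepth 3
theorem normal_ineq {s : Set (Cn n)} {v : Cn n → ℝ} {p ν : Cn n} {r R C : ℝ} {L : Cn n →L[ℝ] ℝ}
    (hr : 0 < r) (hR : 0 < R) (hv : DifferentiableWithinAt ℝ v s p) (hν : ‖ν‖ = 1)
    (hin : ∀ τ : ℝ, 0 < τ → τ < R → p + τ • ν ∈ s)
    (h : ∀ y ∈ s, ‖y - p‖ ≤ r → v y ≤ v p + L (y - p) + C * ‖y - p‖ ^ 2) :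
    fderivWithin ℝ v s p ν ≤ L ν := by
  refine le_of_forall_pos_le_add fun ε hε => ?_
  have h1 := hv.hasFDerivWithinAt.isLittleO.def (show 0 < ε / 2 by positivity)
  rw [eventually_nhdsWithin_iff, Metric.eventually_nhds_iff] at h1
  obtain ⟨d, hd, h1⟩ := h1
  obtain ⟨τ, hτ, hτ1⟩ : ∃ τ : ℝ, 0 < τ ∧ τ < min (min r R) (min d (ε / (2 * (|C| + 1)))) := 
    exists_between (by positivity)
  rw [lt_min_iff, lt_min_iff, lt_min_iff] at hτ1
  obtain ⟨⟨t1, t2⟩, t3, t4⟩ := hτ1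
  have hy := hin τ hτ t2
  have hn : ‖p + τ • ν - p‖ = τ := by rw [add_sub_cancel_left, norm_smul, hν, Real.norm_of_nonneg hτ.le, mul_one]
  have h2 := h1 (by rw [dist_eq_norm, hn]; exact t3) hy
  have h3 := h _ hy (by rw [hn]; exact t1.le)
  rw [hn, Real.norm_eq_abs] at h2
  rw [hn] at h3
  rw [add_sub_cancel_left, map_smul, smul_eq_mul] at h2 h3
  have h4 := (abs_le.1 h2).1
  rw [lt_div_iff₀ (by positivity)] at t4
  have h5 : C * τ ^ 2 ≤ τ * (ε / 2) := by
    have : C ≤ |C| + 1 := by linarith [le_abs_self C]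
    nlinarith
  have h6 : τ * fderivWithin ℝ v s p ν ≤ τ * (L ν + ε) := by linarith
  exact le_of_mul_le_mul_left h6 hτ

set_option maxHeartbeats 800000 in
theorem elliptic {Ω U : Set (Cn n)} {ρ : Cn n → ℝ} (D : Defn Ω U ρ)
    (hspc : ∀ z ∈ U, (cHess ρ z).PosDef) {Mφ c0 : ℝ} (hMφ : 0 ≤ Mφ) (hc0 : 0 < c0) :
    ∃ c > 0, ∀ v φ : Cn n → ℝ, ContDiffOn ℝ 2 v (closure Ω) → ContDiffOn ℝ 4 φ (closure Ω) →
      (∀ k ≤ 4, ∀ y ∈ closure Ω, ‖iteratedFDerivWithin ℝ k φ (closure Ω) y‖ ≤ Mφ) →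
      (∀ y ∈ frontier Ω, v y = φ y) → (∀ y ∈ closure Ω, |v y| ≤ Mφ) →
      (∀ y ∈ Ω, (cHess v y).PosDef) → (∀ y ∈ Ω, c0 ≤ (cHess v y).det.re) →
      ∀ p ∈ frontier Ω, ∀ ξ, fderiv ℝ ρ p ξ = 0 → fderiv ℝ ρ p (I • ξ) = 0 →
        c * ‖ξ‖ ^ 2 ≤ levi (closure Ω) v p ξ := by
  obtain ⟨m, hm, r, hr, hu⟩ := D.unif
  obtain ⟨μ, hμ, hμ1, hlev⟩ := D.mu_exists hspc
  obtain ⟨Mρ, hMρ, hbρ⟩ := D.rho_bound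
  obtain ⟨M, hMd⟩ : ∃ M, M = 1 + Mφ + 40000 * Mφ + (80000 * Mφ / μ + 1) * (40000 * Mρ) := ⟨_, rfl⟩
  obtain ⟨m', hm'd⟩ : ∃ m', m' = min m 1 := ⟨_, rfl⟩
  obtain ⟨r', hr'd⟩ : ∃ r', r' = min (r / 3 / 16 / 2) (m' * μ / (16 * M ^ 2)) := ⟨_, rfl⟩
  have hq : 0 ≤ 80000 * Mφ / μ := by positivity
  have hq2 : 0 ≤ 80000 * Mφ / μ * (40000 * Mρ) := by positivity
  have hM1 : 1 ≤ M := by rw [hMd]; nlinarith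
  have hMφM : Mφ ≤ M := by rw [hMd]; nlinarith
  have hMρM : 40000 * Mρ ≤ M := by rw [hMd]; nlinarith
  have hm' : 0 < m' := by rw [hm'd]; positivity
  have hr' : 0 < r' := by rw [hr'd]; positivity
  have hud := D.uniqueDiffOn
  refine ⟨Kη n M m' μ r' c0 * μ, mul_pos ((K_pos (n := n) hM1 hm' hμ hr').2.2.2.2.2.2.2.2 hc0) hμ, ?_⟩
  intro v φ hv hφ hφb hvφ hvM hpd hdet p hp
  have hpc : p ∈ closure Ω := frontier_subset_closure hp
  -- reduction to unit vectors
  suffices key : ∀ ξ : Cn n, ‖ξ‖ = 1 → fderiv ℝ ρ p ξ = 0 → fderiv ℝ ρ p (I • ξ) = 0 →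
      Kη n M m' μ r' c0 * μ ≤ levi (closure Ω) v p ξ by
    intro ξ h1 h2
    by_cases h0 : ξ = 0
    · subst h0; simp [levi]
    have hn : 0 < ‖ξ‖ := norm_pos_iff.2 h0
    have h3 := key (‖ξ‖⁻¹ • ξ) (by rw [norm_smul, norm_inv, norm_norm, inv_mul_cancel₀ hn.ne'])
      (by rw [map_smul, h1, smul_zero]) (by rw [I_smul_real_smul, map_smul, h2, smul_zero])
    rw [levi_smul, inv_pow, ← div_eq_inv_mul, le_div_iff₀ (by positivity)] at h3
    exact h3
  intro ξ hξ h1 h2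
  have L : LocD Ω U ρ p m r := ⟨hm, hr, hp, (hu p hp).1, (hu p hp).2⟩
  have hQ := L.qs D
  obtain ⟨g3, TR⟩ := taylor4 (by positivity) hMρ hQ hud (fun y hy => D.closure_int hy) hpc
    (D.smooth_cl.of_le (nat_le_top 4)) hbρ
  obtain ⟨q3, TF⟩ := taylor4 (by positivity) hMφ hQ hud (fun y hy => D.closure_int hy) hpc hφ hφb
  rw [D.fw hpc, D.D2_cl hpc] at TR
  set l := fderiv ℝ ρ p with hl
  set g := D2 univ ρ p with hg
  set q1 := fderivWithin ℝ φ (closure Ω) p with hq1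
  set q2 := D2 (closure Ω) φ p with hq2
  have htan : inner ℂ (cgrad l) ξ = 0 := by rw [inner_cgrad, h1, h2]; simp
  have hE : EH M m' μ l g g3 ξ :=
    { M1 := hM1
      m0 := hm'
      m1 := by rw [hm'd]; exact min_le_right _ _
      μ0 := hμ
      μ1 := hμ1
      symm := TR.symm
      b1 := TR.b1.trans hMρM
      b2 := TR.b2.trans hMρM
      b3 := TR.b3.trans hMρM
      N := by rw [hm'd]; exact (min_le_left _ _).trans L.grad_lb
      levi := fun e => by
        have := hlev p hpc e
        rwa [levi_Hf] at this
      xi := hξ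
      tan := htan }
  have hHg : μ ≤ 4 * Hf g ξ ξ := by have := hE.levi ξ; rw [hξ] at this; linarith
  obtain ⟨lam, hlam⟩ : ∃ lam, lam = - Hf q2 ξ ξ / Hf g ξ ξ := ⟨_, rfl⟩
  have hHpos : 0 < Hf g ξ ξ := by linarith
  have hlamb : |lam| ≤ 80000 * Mφ / μ := by
    rw [hlam, abs_div, abs_neg, abs_of_pos hHpos]
    have b := Hf_bound q2 TF.b2 ξ ξ
    rw [hξ] at b
    rw [div_le_div_iff₀ hHpos hμ]
    have : |Hf q2 ξ ξ| * μ ≤ (40000 * Mφ / 2) * (4 * Hf g ξ ξ) := by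
      gcongr
      linarith
    linarith
  have hlM : ∀ a : ℝ, 0 ≤ a → a ≤ 40000 * Mρ → 40000 * Mφ + |lam| * a ≤ M := by
    intro a ha0 ha
    have : |lam| * a ≤ 80000 * Mφ / μ * (40000 * Mρ) := by gcongr
    rw [hMd]; nlinarith
  have hrad : ∀ y : Cn n, ‖y - p‖ ≤ r' → ‖y - p‖ < r / 3 / 16 := by
    intro y hy
    have : r' ≤ r / 3 / 16 / 2 := by rw [hr'd]; exact min_le_left _ _
    have : 0 < r / 3 / 16 := by positivity
    linarith
  have hρp : ρ p = 0 := D.zero hp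
  have hTR : ∀ y ∈ closure Ω, ‖y - p‖ ≤ r' → |ρ y - l (y - p) - (1/2) * g (y - p) (y - p) - (1/6) * g3 (y - p) (y - p) (y - p)|
      ≤ 40000 * Mρ * ‖y - p‖ ^ 4 := by
    intro y hy hyr
    have := TR.rem y hy (hrad y hyr)
    rwa [hρp, sub_zero] at this
  have hX4 : ∀ y : Cn n, 40000 * Mρ * ‖y - p‖ ^ 4 ≤ M * ‖y - p‖ ^ 4 := fun y => by gcongr
  have hHψ : Hf (q2 + lam • g) ξ ξ = 0 := by
    have : Hf (q2 + lam • g) ξ ξ = Hf q2 ξ ξ + lam * Hf g ξ ξ := by unfold Hf; simp; ring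
    rw [this, hlam]; field_simp; ring
  obtain ⟨C, hC⟩ := barrier (p1 := q1 + lam • l) (p2 := q2 + lam • g) (p3 := q3 + lam • g3) (v := v)
    D.open_Ω D.bdd hE hr' (by rw [hr'd]; exact min_le_right _ _) hc0
    (by
      intro y hy hyr
      have a1 := (abs_le.1 (hTR y hy hyr)).1
      have a2 := D.le_zero hy
      have a3 := hX4 y
      linarith)
    (by
      intro y hy hyr
      have a1 := abs_le.1 (hTR y (frontier_subset_closure hy) hyr)
      have a2 := D.zero hy
      have a3 := hX4 y
      rw [abs_le]
      constructor <;> linarith)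
    (by
      intro y hy hyr
      have a0 := hTR y (frontier_subset_closure hy) hyr
      rw [D.zero hy] at a0
      have a1 := le_of_abs_le (TF.rem y (frontier_subset_closure hy) (hrad y hyr))
      rw [hvφ y hy, hvφ p hp]
      simp only [add_apply, smul_apply, smul_eq_mul]
      have a2 : -(|lam| * (40000 * Mρ * ‖y - p‖ ^ 4)) ≤ lam * (l (y - p) + (1/2) * g (y - p) (y - p) + (1/6) * g3 (y - p) (y - p) (y - p)) := by
        have : |lam * (l (y - p) + (1/2) * g (y - p) (y - p) + (1/6) * g3 (y - p) (y - p) (y - p))| ≤ |lam| * (40000 * Mρ * ‖y - p‖ ^ 4) := by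
          rw [abs_mul]
          gcongr
          have e0 : |l (y - p) + (1/2) * g (y - p) (y - p) + (1/6) * g3 (y - p) (y - p) (y - p)| = |0 - l (y - p) - (1/2) * g (y - p) (y - p) - (1/6) * g3 (y - p) (y - p) (y - p)| := by
            rw [← abs_neg]; congr 1; ring
          rw [e0]; exact a0
        exact (abs_le.1 this).1
      have a3 : (40000 * Mφ + |lam| * (40000 * Mρ)) * ‖y - p‖ ^ 4 ≤ M * ‖y - p‖ ^ 4 := by
        gcongr; exact hlM _ (by positivity) le_rfl
      linarith)
    (by
      refine (norm_add_le _ _).trans ?_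
      rw [norm_smul, Real.norm_eq_abs]
      linarith [TF.b1, hlM _ (norm_nonneg _) TR.b1])
    (by
      refine (norm_add_le _ _).trans ?_
      rw [norm_smul, Real.norm_eq_abs]
      linarith [TF.b2, hlM _ (norm_nonneg _) TR.b2])
    (by
      refine (norm_add_le _ _).trans ?_
      rw [norm_smul, Real.norm_eq_abs]
      linarith [TF.b3, hlM _ (norm_nonneg _) TR.b3])
    (by intro a b; simp [TF.symm a b, TR.symm a b])
    hHψ hpc (fun y hy => (hvM y hy).trans hMφM) hv.continuousOn
    (fun y hy => hv.contDiffAt (mem_of_superset (D.open_Ω.mem_nhds hy) subset_closure))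
    hpd hdet
  -- normal derivative
  obtain ⟨ν, hν, hlν⟩ := L.normal
  rw [← hl] at hlν
  have hNpos : 0 < ‖cgrad l‖ := hm'.trans_le hE.N
  have hnd := normal_ineq (v := v) (s := closure Ω) (p := p) (ν := ν) (r := r') (R := r)
    (L := q1 + lam • l + Kη n M m' μ r' c0 • l) (C := C) hr' hr
    (hv.differentiableOn (by norm_num) p hpc) hν
    (by
      intro τ hτ hτr
      have e : ‖p + τ • ν - p‖ = τ := by rw [add_sub_cancel_left, norm_smul, hν, Real.norm_of_nonneg hτ.le, mul_one]
      refine subset_closure (L.cone D (y := p) (by simpa using hr) (by rw [e]; exact hτr) hpc ?_)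
      rw [e, add_sub_cancel_left, map_smul, ← hl, hlν, smul_eq_mul]
      have := L.grad_lb
      rw [← hl] at this
      nlinarith)
    (by
      intro y hy hyr
      have := hC y hy hyr
      simp only [add_apply, smul_apply, smul_eq_mul] at this ⊢
      linarith)
  have hφ2 : ContDiffOn ℝ 2 φ (closure Ω) := hφ.of_le (by norm_num)
  obtain ⟨κ, hκ, hκl⟩ := D.boundary_levi hp (v := fun y => v y - φ y) (hv.sub hφ2)
    (fun y hy => by rw [hvφ y hy, sub_self])
  have hκξ := hκl ξ h1 h2
  rw [levi_sub hv hφ2 hud hpc] at hκξ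
  rw [fderivWithin_fun_sub (hud p hpc) (hv.differentiableOn (by norm_num) p hpc)
    (hφ2.differentiableOn (by norm_num) p hpc), D.fw hpc, ← hl, ← hq1] at hκ
  have hκν := congrArg (fun L : Cn n →L[ℝ] ℝ => L ν) hκ
  simp only [sub_apply, add_apply, smul_apply, smul_eq_mul] at hκν hnd
  rw [hlν] at hκν hnd
  have hκge : lam + Kη n M m' μ r' c0 ≤ κ := by
    by_contra hlt
    push Not at hlt
    nlinarith
  rw [levi_Hf (closure Ω) φ, levi_Hf (closure Ω) ρ, D.D2_cl hpc, ← hg, ← hq2] at hκξ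
  have hlam2 : lam * (4 * Hf g ξ ξ) = - (4 * Hf q2 ξ ξ) := by rw [hlam]; field_simp
  have hηp := (K_pos (n := n) hM1 hm' hμ hr').2.2.2.2.2.2.2.2 hc0
  have f1 : levi (closure Ω) v p ξ = (κ - lam) * (4 * Hf g ξ ξ) := by linarith
  rw [f1]
  have : Kη n M m' μ r' c0 ≤ κ - lam := by linarith
  have h00 : 0 ≤ κ - lam := by linarith
  gcongr

end PartPF2

section PartPG1
set_option maxSynthPendingDepth 3
theorem levi_const_mul {v : Cn n → ℝ} {z : Cn n} (hv : ContDiffAt ℝ 2 v z) (A : ℝ) (e : Cn n) :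
    levi univ (fun y => A * v y) z e = A * levi univ v z e := by
  have : D2 univ (fun y => A * v y) z = A • D2 univ v z := by
    unfold D2
    simp only [fderivWithin_univ]
    have e1 : (fderiv ℝ fun y => A * v y) =ᶠ[𝓝 z] fun y => A • fderiv ℝ v y := by
      filter_upwards [hv.eventually (by simp)] with y h1
      exact fderiv_const_mul (h1.differentiableAt (by norm_num)) A
    rw [e1.fderiv_eq]
    exact fderiv_fun_const_smul ((hv.fderiv_right (m := 1) (by norm_num)).differentiableAt (by norm_num)) A
  unfold levi
  rw [this]
  simp only [smul_apply, smul_eq_mul]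
  ring

theorem det_ge_of_eig (hn : 1 ≤ n) {M : Matrix (Fin n) (Fin n) ℂ} (hM : M.IsHermitian) {c : ℝ} (hc : 1 ≤ c)
    (h : ∀ i, c ≤ hM.eigenvalues i) : c ≤ M.det.re := by
  rw [hM.det_eq_prod_eigenvalues]
  have : (∏ i, (hM.eigenvalues i : ℂ)) = ((∏ i, hM.eigenvalues i : ℝ) : ℂ) := by push_cast; rfl
  erw [this]
  rw [Complex.ofReal_re]
  calc c ≤ c ^ n := le_self_pow₀ hc (by omega)
    _ = ∏ i : Fin n, c := by simp
    _ ≤ _ := Finset.prod_le_prod (fun _ _ => by linarith) (fun i _ => h i)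

theorem det_ge_of_levi (hn : 1 ≤ n) {v : Cn n → ℝ} {z : Cn n} (hv : ContDiffAt ℝ 2 v z) {c : ℝ} (hc : 1 ≤ c)
    (h : ∀ e, 4 * c * ‖e‖ ^ 2 ≤ levi univ v z e) : c ≤ (cHess v z).det.re := by
  refine det_ge_of_eig hn (cHess_herm hv) hc (eig_ge _ fun x => ?_)
  rw [cHess_form hv, normsq_toLp]
  have := h (WithLp.toLp 2 (star x))
  rw [normsq_toLp_star] at this
  linarith

/-- abstract parabolic minimum principle -/
theorem min_principle {Ω : Set (Cn n)} (ho : IsOpen Ω) (hc : IsCompact (closure Ω)) {T' : ℝ}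
    {w : Cn n → ℝ → ℝ} (hw : ContinuousOn (fun q : Cn n × ℝ => w q.1 q.2) (closure Ω ×ˢ Icc 0 T'))
    (h0 : ∀ z ∈ closure Ω, 0 ≤ w z 0) (hb : ∀ z ∈ frontier Ω, ∀ t ∈ Icc 0 T', 0 ≤ w z t)
    (hi : ∀ z ∈ Ω, ∀ t ∈ Ioc 0 T', w z t < 0 → IsLocalMin (fun y => w y t) z →
      (∀ s ∈ Icc 0 t, w z t ≤ w z s) → False) :
    ∀ z ∈ closure Ω, ∀ t ∈ Icc 0 T', 0 ≤ w z t := by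
  intro z1 hz1 t1 ht1
  by_contra hneg
  push Not at hneg
  obtain ⟨⟨z, t⟩, hq, hmin⟩ := (hc.prod isCompact_Icc).exists_isMinOn ⟨(z1, t1), hz1, ht1⟩ hw
  have hm : ∀ y ∈ closure Ω, ∀ s ∈ Icc 0 T', w z t ≤ w y s := fun y hy s hs => hmin (show (y, s) ∈ _ from ⟨hy, hs⟩)
  have hlt : w z t < 0 := (hm z1 hz1 t1 ht1).trans_lt hneg
  have hz : z ∈ closure Ω := hq.1
  have ht : t ∈ Icc 0 T' := hq.2
  have hzΩ : z ∈ Ω := by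
    by_contra hzn
    exact absurd (hb z ⟨hz, by rwa [ho.interior_eq]⟩ t ht) (not_le.2 hlt)
  have ht0 : 0 < t := by
    rcases ht.1.lt_or_eq with h | h
    · exact h
    · subst h; exact absurd (h0 z hz) (not_le.2 hlt)
  refine hi z hzΩ t ⟨ht0, ht.2⟩ hlt ?_ ?_
  · filter_upwards [ho.mem_nhds hzΩ] with y hy
    exact hm y (subset_closure hy) t ht
  · exact fun s hs => hm z hz s ⟨hs.1, hs.2.trans ht.2⟩

theorem deriv_nonpos_of_left_min {g : ℝ → ℝ} {g' t : ℝ} (ht : 0 < t) (hg : HasDerivAt g g' t)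
    (h : ∀ s ∈ Icc 0 t, g t ≤ g s) : g' ≤ 0 := by
  have h1 := hg.hasDerivWithinAt (s := Iio t)
  rw [hasDerivWithinAt_iff_tendsto_slope' (by simp)] at h1
  refine le_of_tendsto h1 ?_
  filter_upwards [Ioo_mem_nhdsLT ht] with s hs
  rw [slope_def_field]
  exact div_nonpos_of_nonneg_of_nonpos (by linarith [h s ⟨hs.1.le, hs.2.le⟩]) (by linarith [hs.2])

theorem deriv_nonneg_of_right_min {g : ℝ → ℝ} {g' t b : ℝ} (ht : t < b) (hg : HasDerivAt g g' t)
    (h : ∀ s ∈ Ioo t b, g t ≤ g s) : 0 ≤ g' := by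
  have h1 := hg.hasDerivWithinAt (s := Ioi t)
  rw [hasDerivWithinAt_iff_tendsto_slope' (by simp)] at h1
  refine ge_of_tendsto h1 ?_
  filter_upwards [Ioo_mem_nhdsGT ht] with s hs
  rw [slope_def_field]
  exact div_nonneg (by linarith [h s hs]) (by linarith [hs.1])

end PartPG1

section PartPG2
set_option maxSynthPendingDepth 3
/-- Parabolic hypotheses with one constant `K`. -/
structure PH (Ω : Set (Cn n)) (T K : ℝ) (u : Cn n × ℝ → ℝ) (f : ℝ × Cn n × ℝ → ℝ) : Prop where
  cont : ∀ T' < T, ContinuousOn u (closure Ω ×ˢ Icc 0 T')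
  dt : ∀ z ∈ Ω, ∀ t ∈ Ioo (0:ℝ) T, HasDerivAt (fun s => u (z, s))
    (Real.log ((cHess (fun w => u (w, t)) z).det.re) + f (t, z, u (z, t))) t
  c2 : ∀ z ∈ Ω, ∀ t ∈ Ioo (0:ℝ) T, ContDiffAt ℝ 2 (fun w => u (w, t)) z
  pd : ∀ z ∈ Ω, ∀ t ∈ Ioo (0:ℝ) T, (cHess (fun w => u (w, t)) z).PosDef
  init : ∀ z ∈ closure Ω, |u (z, 0)| ≤ K
  bd : ∀ z ∈ frontier Ω, ∀ t ∈ Ico (0:ℝ) T, |u (z, t)| ≤ K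
  bdlip : ∀ z ∈ frontier Ω, ∀ s ∈ Ico (0:ℝ) T, ∀ t ∈ Ico (0:ℝ) T, |u (z, t) - u (z, s)| ≤ K * |t - s|
  fb : ∀ z ∈ Ω, ∀ t ∈ Ioo (0:ℝ) T, ∀ r, |f (t, z, r)| ≤ K
  flip : ∀ z ∈ Ω, ∀ s ∈ Ioo (0:ℝ) T, ∀ t ∈ Ioo (0:ℝ) T, ∀ r r', |f (t, z, r) - f (s, z, r')| ≤ K * (|t - s| + |r - r'|)
  fmono : ∀ z ∈ Ω, ∀ t ∈ Ioo (0:ℝ) T, ∀ r r', r ≤ r' → f (t, z, r') ≤ f (t, z, r)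

namespace PH
variable {Ω U : Set (Cn n)} {ρ : Cn n → ℝ} {T K : ℝ} {u : Cn n × ℝ → ℝ} {f : ℝ × Cn n × ℝ → ℝ}

theorem det_pos (H : PH Ω T K u f) {z : Cn n} (hz : z ∈ Ω) {t : ℝ} (ht : t ∈ Ioo 0 T) :
    0 < (cHess (fun w => u (w, t)) z).det.re := (Complex.pos_iff.1 (H.pd z hz t ht).det_pos).1

theorem slice (H : PH Ω T K u f) {t : ℝ} (ht : t ∈ Ico 0 T) : ContinuousOn (fun z => u (z, t)) (closure Ω) :=
  (H.cont t ht.2).comp (by fun_prop) (fun z hz => ⟨hz, ht.1, le_rfl⟩)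

theorem upper (H : PH Ω T K u f) (hn : 1 ≤ n) (ho : IsOpen Ω) (hc : IsCompact (closure Ω)) :
    ∀ t ∈ Ico 0 T, ∀ z ∈ closure Ω, u (z, t) ≤ K := by
  intro t ht z1 hz1
  rcases ht.1.lt_or_eq with h0 | h0
  swap
  · subst h0; exact le_of_abs_le (H.init z1 hz1)
  obtain ⟨z, hz, hmax⟩ := hc.exists_isMaxOn ⟨z1, hz1⟩ (H.slice ht)
  have hm : ∀ y ∈ closure Ω, u (y, t) ≤ u (z, t) := fun y hy => hmax hy
  refine (hm z1 hz1).trans ?_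
  by_cases hzΩ : z ∈ Ω
  · exfalso
    have h1 := H.c2 z hzΩ t ⟨h0, ht.2⟩
    let i : Fin n := ⟨0, hn⟩
    have he : cvec n i 1 ≠ 0 := by
      unfold cvec; rw [Ne, EuclideanSpace.single_eq_zero_iff]; exact one_ne_zero
    have h2 := levi_pos_of_posDef h1 (H.pd z hzΩ t ⟨h0, ht.2⟩) he
    have h3 := levi_local_max (v := fun w => u (w, t)) (w := fun _ => (0:ℝ)) h1 contDiffAt_const (by
      filter_upwards [ho.mem_nhds hzΩ] with y hy
      have := hm y (subset_closure hy)
      linarith) (cvec n i 1)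
    have h4 : levi univ (fun _ : Cn n => (0:ℝ)) z (cvec n i 1) = 0 := by
      have := levi_const_mul (v := fun _ : Cn n => (0:ℝ)) (z := z) contDiffAt_const 0 (cvec n i 1)
      simpa using this
    linarith
  · exact le_of_abs_le (H.bd z ⟨hz, by rwa [ho.interior_eq]⟩ t ht)

theorem lower (H : PH Ω T K u f) (hn : 1 ≤ n) (D : Defn Ω U ρ) {μ A : ℝ} (hK : 0 ≤ K)
    (hμ : ∀ z ∈ closure Ω, ∀ e, μ * ‖e‖ ^ 2 ≤ levi univ ρ z e) (hA : 0 ≤ A) (hA' : 4 * Real.exp (K + 1) ≤ A * μ) :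
    ∀ t ∈ Ico 0 T, ∀ z ∈ closure Ω, A * ρ z - K ≤ u (z, t) := by
  intro t ht z hz
  have key := min_principle D.open_Ω D.compact (T' := t) (w := fun z s => u (z, s) - A * ρ z + K) ?_ ?_ ?_ ?_ z hz t ⟨ht.1, le_rfl⟩
  · linarith
  · refine ((H.cont t ht.2).sub ?_).add continuousOn_const
    exact continuousOn_const.mul (D.smooth_cl.continuousOn.comp continuousOn_fst (fun q hq => hq.1))
  · intro y hy
    have h1 := (abs_le.1 (H.init y hy)).1
    have h2 := mul_nonneg hA (neg_nonneg.2 (D.le_zero hy))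
    linarith
  · intro y hy s hs
    have h1 := (abs_le.1 (H.bd y hy s ⟨hs.1, hs.2.trans_lt ht.2⟩)).1
    rw [D.zero hy]
    linarith
  · intro y hy s hs _ hloc hmin
    have hs' : s ∈ Ioo 0 T := ⟨hs.1, hs.2.trans_lt ht.2⟩
    have hyc := subset_closure hy
    have hu := H.c2 y hy s hs'
    have hρ := D.cd2 (D.sub hyc)
    have hd := deriv_nonpos_of_left_min (g := fun s => u (y, s)) hs.1 (H.dt y hy s hs') (fun r hr => by
      have := hmin r hr
      linarith)
    have hl := levi_local_max (v := fun z => A * ρ z) (w := fun w => u (w, s)) (contDiffAt_const.mul hρ) hu (by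
      filter_upwards [hloc] with x hx
      linarith)
    have hdet := det_ge_of_levi hn hu (c := Real.exp (K + 1)) (Real.one_le_exp (by linarith)) (fun e => by
      refine le_trans ?_ (hl e)
      rw [levi_const_mul hρ]
      have := mul_le_mul_of_nonneg_left (hμ y hyc e) hA
      have h3 : 4 * Real.exp (K + 1) * ‖e‖ ^ 2 ≤ A * μ * ‖e‖ ^ 2 := by gcongr
      linarith)
    have hlog := Real.log_le_log (Real.exp_pos _) hdet
    rw [Real.log_exp] at hlog
    have := (abs_le.1 (H.fb y hy s hs' (u (y, s)))).1
    linarith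

theorem scale (H : PH Ω T K u f) (D : Defn Ω U ρ) {M C lam T' : ℝ} (hK : 0 ≤ K) (hM : 0 ≤ M)
    (hu : ∀ t ∈ Ico 0 T, ∀ z ∈ closure Ω, |u (z, t)| ≤ M)
    (hC1 : K ≤ C) (hC2 : K * (T + M) < C) (hlam : 1 < lam) (hT : lam * T' < T) :
    ∀ z ∈ closure Ω, ∀ t ∈ Icc 0 T', 0 ≤ lam⁻¹ * u (z, lam * t) - u (z, t) + C * (lam - 1) * (1 + t) := by
  have hl0 : 0 < lam := by linarith
  have hmem : ∀ t ∈ Icc 0 T', lam * t ∈ Ico 0 T ∧ t ∈ Ico 0 T := by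
    intro t ht
    have h1 : lam * t ≤ lam * T' := by gcongr; exact ht.2
    have h2 : 0 ≤ t := ht.1
    exact ⟨⟨by positivity, by linarith⟩, h2, by nlinarith⟩
  have hinv : 0 ≤ 1 - lam⁻¹ ∧ 1 - lam⁻¹ ≤ lam - 1 := by
    have h1 : lam * lam⁻¹ = 1 := mul_inv_cancel₀ hl0.ne'
    have h2 : 0 < lam⁻¹ := by positivity
    constructor <;> nlinarith
  refine min_principle D.open_Ω D.compact ?_ ?_ ?_ ?_
  · rcases lt_or_ge T' 0 with h | h
    · rw [Icc_eq_empty (by linarith)]; simp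
    · have hTT : T' < T := (hmem T' ⟨h, le_rfl⟩).2.2
      refine ((continuousOn_const.mul ?_).sub (H.cont T' hTT)).add (by fun_prop)
      refine (H.cont (lam * T') hT).comp (f := fun q : Cn n × ℝ => (q.1, lam * q.2)) (by fun_prop) ?_
      intro q hq
      refine ⟨hq.1, (hmem _ hq.2).1.1, ?_⟩
      have := hq.2.2
      simp only; gcongr
  · intro z hz
    have h1 := abs_le.1 (H.init z hz)
    simp only [mul_zero, add_zero, mul_one]
    have h2 : (1 - lam⁻¹) * u (z, 0) ≤ (lam - 1) * K := by
      calc (1 - lam⁻¹) * u (z, 0) ≤ (1 - lam⁻¹) * K := by gcongr; exact hinv.1; exact h1.2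
        _ ≤ _ := mul_le_mul_of_nonneg_right hinv.2 hK
    have h3 := mul_le_mul_of_nonneg_left hC1 (sub_nonneg.2 hlam.le)
    linarith
  · intro z hz t ht
    obtain ⟨m1, m2⟩ := hmem t ht
    have h1 := abs_le.1 (H.bd z hz _ m1)
    have h2 := abs_le.1 (H.bdlip z hz _ m2 _ m1)
    have h0 : 0 ≤ t := ht.1
    rw [show lam * t - t = (lam - 1) * t by ring, abs_of_nonneg (mul_nonneg (by linarith) h0)] at h2
    have h3 : (1 - lam⁻¹) * u (z, lam * t) ≤ (lam - 1) * K := by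
      calc (1 - lam⁻¹) * u (z, lam * t) ≤ (1 - lam⁻¹) * K := by gcongr; exact hinv.1; exact h1.2
        _ ≤ _ := mul_le_mul_of_nonneg_right hinv.2 hK
    have h4 : K ≤ C := hC1
    have h5 : K * ((lam - 1) * (1 + t)) ≤ C * ((lam - 1) * (1 + t)) :=
      mul_le_mul_of_nonneg_right h4 (mul_nonneg (by linarith) (by linarith))
    linarith
  · intro z hz t ht hneg hloc hmin
    obtain ⟨m1, m2⟩ := hmem t ⟨ht.1.le, ht.2⟩
    have ht0 := ht.1
    have p1 : lam * t ∈ Ioo 0 T := ⟨by positivity, m1.2⟩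
    have p2 : t ∈ Ioo 0 T := ⟨ht0, m2.2⟩
    have c1 := H.c2 z hz _ p1
    have c2 := H.c2 z hz _ p2
    have d1 : HasDerivAt (fun s => u (z, lam * s)) _ t :=
      (H.dt z hz _ p1).comp t ((hasDerivAt_id t).const_mul lam)
    have d2 := H.dt z hz _ p2
    have d3 : HasDerivAt (fun s => C * (lam - 1) * (1 + s)) (C * (lam - 1) * 1) t :=
      ((hasDerivAt_id t).const_add 1).const_mul _
    have hd := deriv_nonpos_of_left_min ht0 (((d1.const_mul lam⁻¹).sub d2).add d3) hmin
    have hl := levi_local_max (v := fun w => u (w, t)) (w := fun w => lam⁻¹ * u (w, lam * t)) c2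
      (contDiffAt_const.mul c1) (by
        filter_upwards [hloc] with x hx
        linarith)
    have hdet := det_le_of_levi c2 c1 (H.pd z hz t p2) (fun e => by
      refine (hl e).trans ?_
      rw [levi_const_mul c1]
      rcases eq_or_ne e 0 with rfl | he
      · simp [levi]
      · have := levi_pos_of_posDef c1 (H.pd z hz _ p1) he
        nlinarith [hinv.1])
    have hlog := Real.log_le_log (H.det_pos hz p2) hdet
    have b1 := abs_le.1 (hu t m2 z (subset_closure hz))
    have b2 : u (z, lam * t) ≤ u (z, t) + (lam - 1) * M := by
      have q1 : 0 ≤ C * (lam - 1) * (1 + t) := by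
        have : 0 ≤ C := hK.trans hC1
        have : 0 ≤ lam - 1 := by linarith
        positivity
      have q2 : lam * (lam⁻¹ * u (z, lam * t)) ≤ lam * u (z, t) := by
        gcongr; linarith
      rw [mul_inv_cancel_left₀ hl0.ne'] at q2
      nlinarith [b1.2]
    have b3 := H.fmono z hz _ p1 _ _ b2
    have b4 := (abs_le.1 (H.flip z hz _ p2 _ p1 (u (z, t) + (lam - 1) * M) (u (z, t)))).1
    rw [show lam * t - t = (lam - 1) * t by ring, add_sub_cancel_left, abs_of_nonneg (mul_nonneg (by linarith) ht0.le),
      abs_of_nonneg (mul_nonneg (by linarith) hM)] at b4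
    have b5 : K * ((lam - 1) * t + (lam - 1) * M) ≤ (lam - 1) * (K * (T + M)) := by
      have : K * t ≤ K * T := by gcongr; exact m2.2.le
      nlinarith
    have b6 : (lam - 1) * (K * (T + M)) < (lam - 1) * C := by
      apply mul_lt_mul_of_pos_left hC2; linarith
    have hd2 : ∀ X : ℝ, lam⁻¹ * (X * (lam * 1)) = X := fun X => by field_simp
    rw [hd2] at hd
    linarith

theorem det_lower (H : PH Ω T K u f) (D : Defn Ω U ρ) {M C ε : ℝ} (hK : 0 ≤ K) (hM : 0 ≤ M)
    (hu : ∀ t ∈ Ico 0 T, ∀ z ∈ closure Ω, |u (z, t)| ≤ M) (hC : 0 ≤ C)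
    (hC1 : K ≤ C) (hC2 : K * (T + M) < C) (hε : 0 < ε) :
    ∀ t ∈ Ioo ε T, ∀ z ∈ Ω, Real.exp (-((M + C * (1 + T)) / ε) - K) ≤ (cHess (fun w => u (w, t)) z).det.re := by
  intro t ht z hz
  have ht0 : 0 < t := hε.trans ht.1
  have p : t ∈ Ioo 0 T := ⟨ht0, ht.2⟩
  have hdt := H.dt z hz t p
  have d1 : HasDerivAt (fun s => u (z, s * t)) _ 1 :=
    HasDerivAt.comp (h₂ := fun s => u (z, s)) 1 (by simpa using hdt) ((hasDerivAt_id (1:ℝ)).mul_const t)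
  have d0 : HasDerivAt (fun s : ℝ => s⁻¹) _ 1 := hasDerivAt_inv one_ne_zero
  have d3 : HasDerivAt (fun s => C * (s - 1) * (1 + t)) (C * 1 * (1 + t)) 1 :=
    (((hasDerivAt_id (1:ℝ)).sub_const 1).const_mul C).mul_const _
  have key := deriv_nonneg_of_right_min (t := 1) (b := T / t) (by rw [lt_div_iff₀ ht0]; linarith [ht.2])
    ((d0.mul d1).add d3) (by
      intro s hs
      have h1 := hs.2
      rw [lt_div_iff₀ ht0] at h1
      have := H.scale D hK hM hu hC1 hC2 hs.1 h1 z (subset_closure hz) t ⟨ht0.le, le_rfl⟩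
      simp only [Pi.add_apply, Pi.mul_apply, inv_one, one_mul, sub_self, mul_zero, zero_mul, add_zero]
      linarith)
  have b1 := abs_le.1 (hu t ⟨ht0.le, ht.2⟩ z (subset_closure hz))
  have b2 := abs_le.1 (H.fb z hz t p (u (z, t)))
  simp only [inv_one, one_mul, one_pow, mul_one, inv_neg] at key
  set L := Real.log ((cHess (fun w => u (w, t)) z).det.re) + f (t, z, u (z, t)) with hL
  have k1 : -(M + C * (1 + T)) ≤ L * t := by
    have : C * (1 + t) ≤ C * (1 + T) := by gcongr; exact ht.2.le
    linarith
  have k2 : -((M + C * (1 + T)) / ε) ≤ L := by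
    have hP : 0 ≤ M + C * (1 + T) := by
      have : 0 < T := ht0.trans ht.2
      positivity
    have e1 : -((M + C * (1 + T)) / t) ≤ L := by
      rw [← neg_div, div_le_iff₀ ht0]; exact k1
    have e2 : (M + C * (1 + T)) / t ≤ (M + C * (1 + T)) / ε := by gcongr; exact ht.1.le
    linarith
  rw [← Real.le_log_iff_exp_le (H.det_pos hz p)]
  linarith

end PH

end PartPG2

section PartPG3
set_option maxSynthPendingDepth 3
theorem bound_ext {X : Type*} [TopologicalSpace X] {D s : Set X} (hs : s ⊆ closure D) (hD : D ⊆ s)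
    {g : X → ℝ} {K : ℝ} (hg : ContinuousOn g s) (h : ∀ x ∈ D, g x ≤ K) : ∀ x ∈ s, g x ≤ K :=
  fun x hx => ContinuousWithinAt.closure_le (hs hx) ((hg x hx).mono hD) continuousWithinAt_const h

theorem ico_sub {T : ℝ} (hT : 0 < T) : Ico 0 T ⊆ closure (Ioo 0 T) := by
  rw [closure_Ioo hT.ne]; exact Ico_subset_Icc_self

theorem C21.lip {Ω : Set (Cn n)} {T : ℝ} {u : Cn n × ℝ → ℝ} (h : C21 n Ω T u)
    (hc : IsCompact (closure Ω)) {T' : ℝ} (hT' : T' < T) : ∃ C, ∀ z ∈ closure Ω, ∀ s ∈ Icc 0 T', ∀ t ∈ Icc 0 T',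
      |u (z, t) - u (z, s)| ≤ C * |t - s| := by
  have hsub : Icc 0 T' ⊆ Ico 0 T := fun x hx => ⟨hx.1, hx.2.trans_lt hT'⟩
  obtain ⟨C, hC⟩ := (hc.prod (isCompact_Icc (a := (0:ℝ)) (b := T'))).exists_bound_of_continuousOn
    (h.2.2.1.mono (prod_mono_right hsub))
  refine ⟨C, fun z hz s hs t ht => ?_⟩
  have := (convex_Icc (0:ℝ) T').norm_image_sub_le_of_norm_hasDerivWithin_le (f := fun s => u (z, s))
    (f' := fun s => derivWithin (fun s => u (z, s)) (Ico 0 T) s) (C := C)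
    (fun x hx => (((h.2.1 z hz).differentiableOn (by norm_num) x (hsub hx)).hasDerivWithinAt).mono hsub)
    (fun x hx => hC (z, x) ⟨hz, hx⟩) hs ht
  simpa using this

theorem C21.cont {Ω : Set (Cn n)} {T : ℝ} {u : Cn n × ℝ → ℝ} (h : C21 n Ω T u)
    (hc : IsCompact (closure Ω)) {T' : ℝ} (hT' : T' < T) : ContinuousOn u (closure Ω ×ˢ Icc 0 T') := by
  obtain ⟨C, hC⟩ := h.lip hc hT'
  rintro ⟨z, t⟩ ⟨hz, ht⟩
  simp only at hz ht
  have h1 : ContinuousWithinAt (fun q : Cn n × ℝ => u (q.1, t)) (closure Ω ×ˢ Icc 0 T') (z, t) :=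
    ContinuousWithinAt.comp (g := fun y => u (y, t)) (t := closure Ω)
      ((h.1 t ⟨ht.1, ht.2.trans_lt hT'⟩).continuousOn z hz) continuousWithinAt_fst (fun q hq => hq.1)
  have h2 : Tendsto (fun q : Cn n × ℝ => u q - u (q.1, t)) (𝓝[closure Ω ×ˢ Icc 0 T'] (z, t)) (𝓝 0) := by
    refine squeeze_zero_norm' (a := fun q : Cn n × ℝ => C * |q.2 - t|) ?_ ?_
    · filter_upwards [self_mem_nhdsWithin] with q hq
      exact hC q.1 hq.1 t ht q.2 hq.2
    · have : Continuous (fun q : Cn n × ℝ => C * |q.2 - t|) := by fun_prop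
      have := (this.tendsto (z, t)).mono_left (nhdsWithin_le_nhds (s := closure Ω ×ˢ Icc 0 T'))
      simpa using this
  have h3 := h2.add h1
  simp only [sub_add_cancel, zero_add] at h3
  exact h3

theorem PH.of_apriori {Ω : Set (Cn n)} {T Cu Cφv Cf K : ℝ} {u φ : Cn n × ℝ → ℝ} {f : ℝ × Cn n × ℝ → ℝ}
    (H : AprioriHyps n Ω T Cu Cφv Cf u φ f) (hT : 0 < T) (ho : IsOpen Ω) (hc : IsCompact (closure Ω))
    (h1 : Cu ≤ K) (h2 : Cφv ≤ K) (h3 : Cf ≤ K) (hK : 0 ≤ K) : PH Ω T K u f := by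
  obtain ⟨hφ, hf, -, hu, hpd, heq, hbd, hinit, hmono, hfb, hφb⟩ := H
  have hφc := hφ.continuousOn
  have hfo : IsOpen (Ioo (0 : ℝ) T ×ˢ Ω ×ˢ (univ : Set ℝ)) := isOpen_Ioo.prod (ho.prod isOpen_univ)
  have hfd : ∀ p ∈ Ioo (0 : ℝ) T ×ˢ Ω ×ˢ (univ : Set ℝ), DifferentiableAt ℝ f p := by
    intro p hp
    refine ((hf.differentiableOn (by simp)) p ⟨Ioo_subset_Ico_self hp.1, subset_closure hp.2.1, trivial⟩).differentiableAt ?_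
    exact mem_of_superset (hfo.mem_nhds hp) (prod_mono Ioo_subset_Ico_self (prod_mono subset_closure le_rfl))
  have hcc : ContinuousOn (fun z => u (z, 0)) (closure Ω) := (hu.1 0 ⟨le_rfl, hT⟩).continuousOn
  have hφabs : ∀ q ∈ closure Ω ×ˢ Ico 0 T, |φ q| ≤ K := by
    refine bound_ext (D := Ω ×ˢ Ioo 0 T) ?_ (prod_mono subset_closure Ioo_subset_Ico_self) hφc.abs ?_
    · rw [closure_prod_eq]; exact prod_mono le_rfl (ico_sub hT)
    · intro q hq
      have := hφb 0 0 (by norm_num) q.1 hq.1 q.2 hq.2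
      rw [norm_iteratedFDeriv_zero] at this
      simp only [iteratedDeriv_zero, Real.norm_eq_abs] at this
      exact this.trans h2
  have hφlip0 : ∀ z ∈ Ω, ∀ s ∈ Ioo 0 T, ∀ t ∈ Ioo 0 T, |φ (z, t) - φ (z, s)| ≤ K * |t - s| := by
    intro z hz s hs t ht
    have := (convex_Ioo (0:ℝ) T).norm_image_sub_le_of_norm_deriv_le (f := fun s => φ (z, s)) (C := K)
      (fun x hx => by
        have hd : DifferentiableAt ℝ φ (z, x) := by
          refine ((hφ.differentiableOn (by simp)) (z, x) ⟨subset_closure hz, Ioo_subset_Ico_self hx⟩).differentiableAt ?_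
          exact mem_of_superset ((ho.prod isOpen_Ioo).mem_nhds (show (z, x) ∈ Ω ×ˢ Ioo 0 T from ⟨hz, hx⟩))
            (prod_mono subset_closure Ioo_subset_Ico_self)
        exact hd.comp x (f := fun s => (z, s)) (by fun_prop))
      (fun x hx => by
        have := hφb 0 1 (by norm_num) z hz x hx
        rw [norm_iteratedFDeriv_zero, iteratedDeriv_one] at this
        exact this.trans h2) hs ht
    simpa using this
  have hφlip : ∀ q ∈ closure Ω ×ˢ Ico 0 T ×ˢ Ico 0 T, |φ (q.1, q.2.2) - φ (q.1, q.2.1)| - K * |q.2.2 - q.2.1| ≤ 0 := by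
    refine bound_ext (D := Ω ×ˢ Ioo 0 T ×ˢ Ioo 0 T) ?_
      (prod_mono subset_closure (prod_mono Ioo_subset_Ico_self Ioo_subset_Ico_self)) ?_ ?_
    · rw [closure_prod_eq, closure_prod_eq]
      exact prod_mono le_rfl (prod_mono (ico_sub hT) (ico_sub hT))
    · refine ContinuousOn.sub (ContinuousOn.abs (ContinuousOn.sub ?_ ?_)) (by fun_prop)
      · exact hφc.comp (f := fun q : Cn n × ℝ × ℝ => (q.1, q.2.2)) (by fun_prop) (fun q hq => ⟨hq.1, hq.2.2⟩)
      · exact hφc.comp (f := fun q : Cn n × ℝ × ℝ => (q.1, q.2.1)) (by fun_prop) (fun q hq => ⟨hq.1, hq.2.1⟩)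
    · intro q hq
      linarith [hφlip0 q.1 hq.1 q.2.1 hq.2.1 q.2.2 hq.2.2]
  refine ⟨fun T' hT' => hu.cont hc hT', ?_, ?_, fun z hz t ht => hpd t ht z hz, ?_, ?_, ?_, ?_, ?_, ?_⟩
  · intro z hz t ht
    rw [← heq z hz t ht]
    refine DifferentiableAt.hasDerivAt ?_
    exact ((hu.2.1 z (subset_closure hz)).differentiableOn (by norm_num) t (Ioo_subset_Ico_self ht)).differentiableAt
      (Ico_mem_nhds ht.1 ht.2)
  · intro z hz t ht
    exact (hu.1 t (Ioo_subset_Ico_self ht)).contDiffAt (mem_of_superset (ho.mem_nhds hz) subset_closure)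
  · exact bound_ext (g := fun z => |u (z, 0)|) le_rfl subset_closure hcc.abs (fun z hz => (hinit z hz).trans h1)
  · intro z hz t ht
    rw [hbd z hz t ht]
    exact hφabs (z, t) ⟨frontier_subset_closure hz, ht⟩
  · intro z hz s hs t ht
    rw [hbd z hz t ht, hbd z hz s hs]
    linarith [hφlip (z, s, t) ⟨frontier_subset_closure hz, hs, ht⟩]
  · intro z hz t ht r
    have := hfb 0 (by norm_num) (t, z, r) ⟨ht, hz, trivial⟩
    rw [norm_iteratedFDeriv_zero] at this
    exact this.trans h3
  · intro z hz s hs t ht r r'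
    have hS : Convex ℝ (Ioo (0:ℝ) T ×ˢ ({z} : Set (Cn n)) ×ˢ (univ : Set ℝ)) :=
      (convex_Ioo _ _).prod ((convex_singleton z).prod convex_univ)
    have hsub : ∀ x ∈ Ioo (0:ℝ) T ×ˢ ({z} : Set (Cn n)) ×ˢ (univ : Set ℝ), x ∈ Ioo (0 : ℝ) T ×ˢ Ω ×ˢ (univ : Set ℝ) := by
      rintro ⟨a, b, c⟩ ⟨ha, hb, -⟩
      simp only [mem_singleton_iff] at hb
      subst hb
      exact ⟨ha, hz, trivial⟩
    have := hS.norm_image_sub_le_of_norm_fderiv_le (f := f) (C := K) (fun x hx => hfd x (hsub x hx))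
      (fun x hx => by
        have := hfb 1 (by norm_num) x (hsub x hx)
        rw [norm_iteratedFDeriv_one] at this
        exact this.trans h3) (x := (s, z, r')) (y := (t, z, r)) ⟨hs, rfl, trivial⟩ ⟨ht, rfl, trivial⟩
    refine this.trans (mul_le_mul_of_nonneg_left ?_ hK)
    simp only [Prod.mk_sub_mk, sub_self, Prod.norm_mk, norm_zero, Real.norm_eq_abs]
    refine max_le (by linarith [abs_nonneg (r - r')]) (max_le (by positivity) (by linarith [abs_nonneg (t - s)]))
  · intro z hz t ht r r' hr
    refine antitone_of_deriv_nonpos (f := fun y => f (t, z, y)) ?_ (hmono t ht z hz) hr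
    intro x
    exact (hfd (t, z, x) ⟨ht, hz, trivial⟩).comp x (f := fun y => (t, z, y)) (by fun_prop)

theorem phi_bound {Ω : Set (Cn n)} {T Cu Cφv Cf : ℝ} {u φ : Cn n × ℝ → ℝ} {f : ℝ × Cn n × ℝ → ℝ}
    (H : AprioriHyps n Ω T Cu Cφv Cf u φ f) (ho : IsOpen Ω) (hud : UniqueDiffOn ℝ (closure Ω))
    {t : ℝ} (ht : t ∈ Ioo 0 T) : ContDiffOn ℝ 4 (fun z => φ (z, t)) (closure Ω) ∧
      ∀ k ≤ 4, ∀ y ∈ closure Ω, ‖iteratedFDerivWithin ℝ k (fun z => φ (z, t)) (closure Ω) y‖ ≤ Cφv := by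
  obtain ⟨hφ, -, -, -, -, -, -, -, -, -, hφb⟩ := H
  have h1 : ContDiffOn ℝ (⊤ : ℕ∞) (fun z => φ (z, t)) (closure Ω) :=
    hφ.comp (f := fun z => (z, t)) (by fun_prop) (fun z hz => ⟨hz, Ioo_subset_Ico_self ht⟩)
  refine ⟨h1.of_le (nat_le_top 4), fun k hk => ?_⟩
  refine bound_ext (g := fun y => ‖iteratedFDerivWithin ℝ k (fun z => φ (z, t)) (closure Ω) y‖) le_rfl subset_closure
    (h1.continuousOn_iteratedFDerivWithin (nat_le_top k) hud).norm ?_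
  intro y hy
  have := hφb k 0 (by omega) y hy t ht
  simp only [iteratedDeriv_zero] at this
  rw [iteratedFDerivWithin_eq_iteratedFDeriv hud _ (subset_closure hy)]
  · exact this
  · exact ((h1.contDiffAt (mem_of_superset (ho.mem_nhds hy) subset_closure)).of_le (nat_le_top k))

end PartPG3

section PartPI
set_option maxSynthPendingDepth 3
theorem wder_tangent {ρ : Cn n → ℝ} {p : Cn n} (hd : DifferentiableAt ℝ ρ p) (ξ : Fin n → ℂ)
    (h : (∑ α, wderW univ α (fun w => (ρ w : ℂ)) p * ξ α) = 0) :
    fderiv ℝ ρ p (WithLp.toLp 2 ξ) = 0 ∧ fderiv ℝ ρ p (I • (WithLp.toLp 2 ξ : Cn n)) = 0 := by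
  have e1 : ∀ x, fderiv ℝ (fun w => (ρ w : ℂ)) p x = (fderiv ℝ ρ p x : ℂ) := by
    intro x
    have := (Complex.ofRealCLM.hasFDerivAt (x := ρ p)).comp p hd.hasFDerivAt
    have h2 : fderiv ℝ (fun w => (ρ w : ℂ)) p = _ := this.fderiv
    rw [h2]; simp
  have e2 : inner ℂ (cgrad (fderiv ℝ ρ p)) (WithLp.toLp 2 ξ : Cn n) = 2 * ∑ α, wderW univ α (fun w => (ρ w : ℂ)) p * ξ α := by
    rw [EuclideanSpace.inner_eq_star_dotProduct, dotProduct, Finset.mul_sum]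
    refine Finset.sum_congr rfl fun α _ => ?_
    simp only [wderW, fderivWithin_univ, e1, cgrad, Pi.star_apply, star_add, star_mul', Complex.star_def, Complex.conj_ofReal, Complex.conj_I]
    ring
  rw [h, mul_zero, inner_cgrad] at e2
  have r := congrArg Complex.re e2
  have i := congrArg Complex.im e2
  simp at r i
  exact ⟨r, i⟩

theorem main_est {Ω U : Set (Cn n)} {ρ : Cn n → ℝ} (hn : 1 ≤ n) (D : Defn Ω U ρ) (hspc : ∀ z ∈ U, (cHess ρ z).PosDef)
    (T Cu Cφv Cf ε : ℝ) (hT : 0 < T) (hε : 0 < ε) :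
    ∃ c > 0, ∀ (u φ : Cn n × ℝ → ℝ) (f : ℝ × Cn n × ℝ → ℝ), AprioriHyps n Ω T Cu Cφv Cf u φ f →
      ∀ p ∈ frontier Ω, ∀ t ∈ Ioo ε T, ∀ ξ, fderiv ℝ ρ p ξ = 0 → fderiv ℝ ρ p (I • ξ) = 0 →
        c * ‖ξ‖ ^ 2 ≤ levi (closure Ω) (fun z => u (z, t)) p ξ := by
  set K := |Cu| + |Cφv| + |Cf| with hK
  have k1 := abs_nonneg Cu
  have k2 := abs_nonneg Cφv
  have k3 := abs_nonneg Cf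
  have K0 : 0 ≤ K := by positivity
  obtain ⟨μ, hμ0, -, hμ⟩ := D.mu_exists hspc
  obtain ⟨R, hR0, hR⟩ := D.rho_bound
  set A := 4 * Real.exp (K + 1) / μ with hA
  have hA0 : 0 ≤ A := by positivity
  set M := A * R + K with hM
  have hM0 : 0 ≤ M := by positivity
  set C := K * (1 + T + M) + 1 with hC
  have hC0 : 0 ≤ C := by positivity
  obtain ⟨c, hc, hell⟩ := elliptic D hspc (Mφ := M) (c0 := Real.exp (-((M + C * (1 + T)) / ε) - K)) hM0 (Real.exp_pos _)
  refine ⟨c, hc, fun u φ f H p hp t ht ξ h1 h2 => ?_⟩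
  have P := PH.of_apriori (K := K) H hT D.open_Ω D.compact (by linarith [le_abs_self Cu]) (by linarith [le_abs_self Cφv])
    (by linarith [le_abs_self Cf]) K0
  have hKM : K ≤ M := by rw [hM]; have : 0 ≤ A * R := by positivity
                         linarith
  have hub : ∀ t ∈ Ico 0 T, ∀ z ∈ closure Ω, |u (z, t)| ≤ M := by
    intro t ht z hz
    have b1 := P.upper hn D.open_Ω D.compact t ht z hz
    have b2 := P.lower hn D K0 hμ hA0 (by rw [hA]; field_simp; exact le_rfl) t ht z hz
    have b3 := hR 0 (by norm_num) z hz
    rw [norm_iteratedFDerivWithin_zero] at b3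
    have b4 : A * (-R) ≤ A * ρ z := by
      gcongr; exact (abs_le.1 b3).1
    rw [abs_le]
    constructor <;> linarith
  have ht' : t ∈ Ioo 0 T := ⟨hε.trans ht.1, ht.2⟩
  obtain ⟨g1, g2⟩ := phi_bound H D.open_Ω D.uniqueDiffOn ht'
  refine hell (fun z => u (z, t)) (fun z => φ (z, t)) (H.2.2.2.1.1 t (Ioo_subset_Ico_self ht')) g1
    (fun k hk y hy => (g2 k hk y hy).trans (by linarith [le_abs_self Cφv]))
    (fun y hy => H.2.2.2.2.2.2.1 y hy t (Ioo_subset_Ico_self ht'))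
    (hub t (Ioo_subset_Ico_self ht')) (fun y hy => P.pd y hy t ht')
    (P.det_lower D K0 hM0 hub hC0 (by rw [hC]; nlinarith) (by rw [hC]; nlinarith) hε t ht) p hp ξ h1 h2

theorem main_final (n : ℕ) (Ω : Set (Cn n)) (T Cu Cφv Cf ε : ℝ)
    (hΩ : IsSPCDomain Ω) (hT : 0 < T) (hε : 0 < ε) :
    ∃ cε : ℝ, 0 < cε ∧
      ∀ (u φ : Cn n × ℝ → ℝ) (f : ℝ × Cn n × ℝ → ℝ),
        AprioriHyps n Ω T Cu Cφv Cf u φ f →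
        ∀ (U : Set (Cn n)) (ρ : Cn n → ℝ), IsOpen U → closure Ω ⊆ U →
          ContDiffOn ℝ (⊤ : ℕ∞) ρ U → Ω = {z ∈ U | ρ z < 0} →
          (∀ z ∈ frontier Ω, fderiv ℝ ρ z ≠ 0) →
          ∀ p ∈ frontier Ω, ∀ t ∈ Ioo ε T, ∀ ξ : Fin n → ℂ,
            (∑ α, wderW univ α (fun w => (ρ w : ℂ)) p * ξ α) = 0 →
            cε * ∑ α, Complex.normSq (ξ α) ≤
              (∑ α, ∑ β, cHessW (closure Ω) (fun w => u (w, t)) p α β * ξ α * star (ξ β)).re := by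
  rcases Nat.eq_zero_or_pos n with hn | hn
  · subst hn
    exact ⟨1, one_pos, fun u φ f _ U ρ _ _ _ _ _ p _ t _ ξ _ => by simp⟩
  obtain ⟨ho, -, hb, U0, ρ0, hU0, -, hsub, hsm, hpd, heq, hne⟩ := hΩ
  have D0 : Defn Ω U0 ρ0 := ⟨ho, hb, hU0, hsub, hsm, heq, hne⟩
  obtain ⟨c, hc, hmain⟩ := main_est hn D0 hpd T Cu Cφv Cf ε hT hε
  refine ⟨c / 4, by positivity, fun u φ f H U ρ hU hUs hρ hΩe hρne p hp t ht ξ hξ => ?_⟩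
  have D : Defn Ω U ρ := ⟨ho, hb, hU, hUs, hρ, hΩe, hρne⟩
  have ht' : t ∈ Ioo 0 T := ⟨hε.trans ht.1, ht.2⟩
  obtain ⟨t1, t2⟩ := wder_tangent (D.diffAt (D.fsub hp)) ξ hξ
  have hd0 : HasFDerivWithinAt ρ0 (fderiv ℝ ρ0 p) (frontier Ω) p := (D0.diffAt (D0.fsub hp)).hasFDerivAt.hasFDerivWithinAt
  have s1 := D.tangent_lin hp t1 hd0 (fun y hy => D0.zero hy)
  have s2 := D.tangent_lin hp t2 hd0 (fun y hy => D0.zero hy)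
  have := hmain u φ f H p hp t ht _ s1 s2
  rw [form_eq_levi (H.2.2.2.1.1 t (Ioo_subset_Ico_self ht')) D0.uniqueDiffOn (frontier_subset_closure hp)]
  have hns : ∑ α, Complex.normSq (ξ α) = ‖(WithLp.toLp 2 ξ : Cn n)‖ ^ 2 := by
    rw [EuclideanSpace.norm_sq_eq]
    exact Finset.sum_congr rfl fun α _ => Complex.normSq_eq_norm_sq _
  rw [hns]
  linarith

end PartPI

/-- **Uniform positivity of `dd^c u` on the holomorphic tangent bundle of the boundary**
(Lemma 4.2): under the a priori hypotheses, for every `ε ∈ (0,T)` there is `c_ε > 0`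
depending only on `Ω, ε, T, Cu, Cφv, Cf` such that for every boundary point `p`, every
`t ∈ (ε,T)`, every defining function `ρ` of `Ω`, and every vector `ξ` in the holomorphic
tangent space `{ξ : Σ_α ρ_α(p) ξ_α = 0}`, one has `Σ u_{αβ̄}(p,t) ξ_α ξ̄_β ≥ c_ε |ξ|²`. -/
theorem stmt_11 (n : ℕ) (Ω : Set (Cn n)) (T Cu Cφv Cf ε : ℝ)
    (hΩ : IsSPCDomain Ω) (hT : 0 < T) (hε : 0 < ε) (hεT : ε < T) :
    ∃ cε : ℝ, 0 < cε ∧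
      ∀ (u φ : Cn n × ℝ → ℝ) (f : ℝ × Cn n × ℝ → ℝ),
        AprioriHyps n Ω T Cu Cφv Cf u φ f →
        ∀ (U : Set (Cn n)) (ρ : Cn n → ℝ), IsOpen U → closure Ω ⊆ U →
          ContDiffOn ℝ (⊤ : ℕ∞) ρ U → Ω = {z ∈ U | ρ z < 0} →
          (∀ z ∈ frontier Ω, fderiv ℝ ρ z ≠ 0) →
          ∀ p ∈ frontier Ω, ∀ t ∈ Ioo ε T, ∀ ξ : Fin n → ℂ,
            (∑ α, wderW univ α (fun w => (ρ w : ℂ)) p * ξ α) = 0 →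
            cε * ∑ α, Complex.normSq (ξ α) ≤
              (∑ α, ∑ β, cHessW (closure Ω) (fun w => u (w, t)) p α β * ξ α * star (ξ β)).re := by
  exact main_final n Ω T Cu Cφv Cf ε hΩ hT hε
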